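/- Let α be a positive algebraic irrational real number and let b ≥ 2 be an integer. Then for every integer k ≥ 0, as N → ∞, ((k+1)!/(2πi)^{k+1}) · Σ_{1 ≤ |n| ≤ N} ζ(−k + 2πin/log b) · e^{2πin·log α/log b}/n^{k+1} = −(1/(log b)^k) · Σ_{0 < h < (log N)/(log b), h ∈ ℤ} ψ_{k+1}(b^h α) + o(log N), where the implied rate in the o-term may depend on k, b, and α. -/

import Mathlib

/-- The `k`-th periodic Bernoulli polynomial: `ψ_k(x) = B_k({x})` for `k ≠ 1`,
and `ψ_1(x) = {x} - 1/2` for non-integer `x`, `ψ_1(x) = 0` for integer `x`. -/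
noncomputable def psiB (k : ℕ) (x : ℝ) : ℝ :=
  if k = 1 then (if Int.fract x = 0 then 0 else Int.fract x - 1 / 2)
  else Polynomial.aeval (Int.fract x) (Polynomial.bernoulli k)

open Real
open Finset (abs_sum_le_sum_abs card_insert_of_notMem card_le_card card_range card_univ mem_range mul_sum prod_congr prod_empty prod_eq_zero prod_insert prod_le_prod prod_mul_distrib prod_ne_zero_iff prod_pow_eq_pow_sum prod_range_succ prod_univ_sum range range_mono sum_add_distrib sum_boole sum_comm sum_congr sum_const sum_div sum_eq_single sum_eq_zero sum_insert sum_ite_eq' sum_le_sum sum_le_sum_of_subset_of_nonneg sum_mul sum_mul_sum sum_neg_distrib sum_nonneg sum_range_add sum_range_succ sum_sub_distrib)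
open Complex (Gamma Gamma_add_one I abs_im_le_norm continuous_exp continuous_ofReal continuous_re cpow_add ext measurable_ofReal norm_I norm_exp norm_exp_ofReal_mul_I norm_real ofReal_mul ofReal_sub ofReal_sum)
open intervalIntegral (integral_add integral_add_adjacent_intervals integral_comp_neg integral_congr integral_congr_ae integral_const_mul integral_eq_sub_of_hasDerivAt integral_mul_deriv_eq_deriv_mul_of_hasDeriv_right integral_ofReal integral_of_le integral_sub norm_integral_le_of_norm_le norm_integral_le_of_norm_le_const)

set_option linter.all false

namespace Rid

open MvPolynomial

section basics

variable {σ : Type*} [Fintype σ] {K : Type*} [CommRing K]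

noncomputable def dg (f : (σ →₀ ℕ) → K) : MvPolynomial σ K →ₗ[K] MvPolynomial σ K :=
  (basisMonomials σ K).constr K (fun e => monomial e (f e))

lemma dg_monomial (f : (σ →₀ ℕ) → K) (e : σ →₀ ℕ) (c : K) :
    dg f (monomial e c) = monomial e (f e * c) := by
  have h : (monomial e c : MvPolynomial σ K) = c • basisMonomials σ K e := by
    simp [smul_monomial]
  rw [h, map_smul, dg, Module.Basis.constr_basis, smul_monomial, smul_eq_mul, mul_comm]

lemma coeff_dg (f : (σ →₀ ℕ) → K) (P : MvPolynomial σ K) (e : σ →₀ ℕ) :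
    coeff e (dg f P) = f e * coeff e P := by
  classical
  induction P using MvPolynomial.induction_on' with
  | monomial a r =>
    rw [dg_monomial, coeff_monomial, coeff_monomial]
    split_ifs with h
    · rw [h]
    · simp
  | add p q hp hq => rw [map_add, coeff_add, hp, hq, coeff_add, mul_add]

def bn (Δ e : σ →₀ ℕ) : ℕ := ∏ i, (e i).choose (Δ i)

noncomputable def hs (Δ : σ →₀ ℕ) : MvPolynomial σ K →ₗ[K] MvPolynomial σ K :=
  dg (fun e => (bn Δ e : K))

lemma coeff_hs (Δ : σ →₀ ℕ) (P : MvPolynomial σ K) (e : σ →₀ ℕ) :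
    coeff e (hs Δ P) = (bn Δ e : K) * coeff e P := coeff_dg _ _ _

lemma X_mul_pderiv (i : σ) (P : MvPolynomial σ K) :
    X i * pderiv i P = dg (fun e => (e i : K)) P := by
  induction P using MvPolynomial.induction_on' with
  | monomial a r =>
    rw [dg_monomial, pderiv_monomial]
    rcases Nat.eq_zero_or_pos (a i) with h | h
    · simp [h]
    · have h1 : Finsupp.single i 1 + (a - Finsupp.single i 1) = a := by
        ext j
        by_cases hj : i = j
        · subst hj; simp; omega
        · simp [hj]
      rw [X, monomial_mul, one_mul, mul_comm, h1]
  | add p q hp hq => rw [map_add, mul_add, hp, hq, map_add]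

lemma hs_zero (P : MvPolynomial σ K) : hs 0 P = P := by
  ext e; rw [coeff_hs]; simp [bn]

lemma bn_succ [DecidableEq σ] (Δ e : σ →₀ ℕ) (i : σ) :
    ((Δ i : K) + 1) * (bn (Δ + Finsupp.single i 1) e : K) = ((e i : K) - Δ i) * bn Δ e := by
  unfold bn
  rw [← Finset.mul_prod_erase _ _ (Finset.mem_univ i), ← Finset.mul_prod_erase _ _ (Finset.mem_univ i)]
  have h1 : ∏ x ∈ Finset.univ.erase i, (e x).choose ((Δ + Finsupp.single i 1 : σ →₀ ℕ) x) =
      ∏ x ∈ Finset.univ.erase i, (e x).choose (Δ x) := by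
    refine prod_congr rfl fun x hx => ?_
    have : i ≠ x := (Finset.ne_of_mem_erase hx).symm
    simp [this]
  rw [h1]
  have h2 : ((Δ i : K) + 1) * ((e i).choose (Δ i + 1) : K) = ((e i : K) - Δ i) * ((e i).choose (Δ i)) := by
    rcases le_or_gt (Δ i) (e i) with h | h
    · have := Nat.choose_succ_right_eq (e i) (Δ i)
      have h3 : (((e i).choose (Δ i + 1) * (Δ i + 1) : ℕ) : K) = ((e i).choose (Δ i) * (e i - Δ i) : ℕ) := by rw [this]
      rw [Nat.cast_mul, Nat.cast_mul, Nat.cast_sub h] at h3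
      push_cast at h3
      linear_combination h3
    · rw [Nat.choose_eq_zero_of_lt h, Nat.choose_eq_zero_of_lt (by omega)]; simp
  push_cast
  simp only [Pi.add_apply, Finsupp.single_eq_same]
  linear_combination (∏ x ∈ Finset.univ.erase i, ((e x).choose (Δ x) : K)) * h2

lemma hs_succ [DecidableEq σ] (Δ : σ →₀ ℕ) (i : σ) (P : MvPolynomial σ K) :
    ((Δ i : K) + 1) • hs (Δ + Finsupp.single i 1) P = X i * pderiv i (hs Δ P) - (Δ i : K) • hs Δ P := by
  ext e
  rw [X_mul_pderiv, coeff_sub, coeff_dg, coeff_smul, coeff_smul, coeff_hs, coeff_hs]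
  have := bn_succ (K := K) Δ e i
  linear_combination coeff e P * this

noncomputable def tay (ξ : σ → K) : MvPolynomial σ K →ₐ[K] MvPolynomial σ K :=
  aeval (fun i => X i + C (ξ i))

lemma tay_pderiv (ξ : σ → K) (i : σ) (P : MvPolynomial σ K) :
    tay ξ (pderiv i P) = pderiv i (tay ξ P) := by
  induction P using MvPolynomial.induction_on with
  | C a => simp
  | add p q hp hq => simp [hp, hq]
  | mul_X p j hp =>
    rw [Derivation.leibniz, map_mul, Derivation.leibniz, map_add, smul_eq_mul, smul_eq_mul, smul_eq_mul,
      smul_eq_mul, map_mul, map_mul, hp]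
    have : tay ξ (pderiv i (X j)) = pderiv i (tay ξ (X j)) := by
      by_cases h : j = i
      · subst h; simp [tay]
      · simp [tay, pderiv_X_of_ne (show j ≠ i from h)]
    rw [this]

noncomputable def wt (r : σ → ℕ) (Δ : σ →₀ ℕ) : ℝ := ∑ i, (Δ i : ℝ) / r i

lemma wt_add (r : σ → ℕ) (Δ Γ : σ →₀ ℕ) : wt r (Δ + Γ) = wt r Δ + wt r Γ := by
  simp [wt, add_div, sum_add_distrib]

lemma wt_single [DecidableEq σ] (r : σ → ℕ) (i : σ) (l : ℕ) : wt r (Finsupp.single i l) = l / r i := by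
  unfold wt
  rw [sum_eq_single i]
  · simp
  · intro j _ hj; simp [Ne.symm hj]
  · simp

lemma wt_nonneg (r : σ → ℕ) (Δ : σ →₀ ℕ) : 0 ≤ wt r Δ := by unfold wt; positivity

def IndGE (r : σ → ℕ) (θ : ℝ) (F : MvPolynomial σ K) : Prop := ∀ Δ, coeff Δ F ≠ 0 → θ ≤ wt r Δ

lemma IndGE.of_nonpos (r : σ → ℕ) {θ : ℝ} (h : θ ≤ 0) (F : MvPolynomial σ K) : IndGE r θ F :=
  fun Δ _ => h.trans (wt_nonneg r Δ)

lemma IndGE.mono {r : σ → ℕ} {θ θ' : ℝ} {F : MvPolynomial σ K} (h : IndGE r θ F) (h' : θ' ≤ θ) :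
    IndGE r θ' F := fun Δ hΔ => h'.trans (h Δ hΔ)

lemma IndGE.add {r : σ → ℕ} {θ : ℝ} {F G : MvPolynomial σ K} (hF : IndGE r θ F) (hG : IndGE r θ G) :
    IndGE r θ (F + G) := by
  intro Δ hΔ
  by_cases h : coeff Δ F = 0
  · apply hG; intro h2; rw [coeff_add, h, h2] at hΔ; simp at hΔ
  · exact hF _ h

lemma IndGE.smul {r : σ → ℕ} {θ : ℝ} {F : MvPolynomial σ K} (hF : IndGE r θ F) (c : K) :
    IndGE r θ (c • F) := by
  intro Δ hΔ
  apply hF; intro h; rw [coeff_smul, h] at hΔ; simp at hΔ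

lemma IndGE.mul {r : σ → ℕ} {θ θ' : ℝ} {F G : MvPolynomial σ K} (hF : IndGE r θ F) (hG : IndGE r θ' G) :
    IndGE r (θ + θ') (F * G) := by
  classical
  intro Δ hΔ
  rw [coeff_mul] at hΔ
  obtain ⟨x, hx, hne⟩ := Finset.exists_ne_zero_of_sum_ne_zero hΔ
  rw [Finset.HasAntidiagonal.mem_antidiagonal] at hx
  rw [← hx, wt_add]
  exact add_le_add (hF _ (left_ne_zero_of_mul hne)) (hG _ (right_ne_zero_of_mul hne))

lemma IndGE.sum {ι : Type*} {r : σ → ℕ} {θ : ℝ} (s : Finset ι) (F : ι → MvPolynomial σ K)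
    (h : ∀ i ∈ s, IndGE r θ (F i)) : IndGE r θ (∑ i ∈ s, F i) := by
  classical
  induction s using Finset.induction_on with
  | empty => intro Δ hΔ; simp at hΔ
  | insert a s ha ih =>
    rw [sum_insert ha]
    exact (h a (by simp)).add (ih fun i hi => h i (by simp [hi]))

lemma IndGE.prod {ι : Type*} {r : σ → ℕ} (s : Finset ι) (θ : ι → ℝ) (F : ι → MvPolynomial σ K)
    (h : ∀ i ∈ s, IndGE r (θ i) (F i)) : IndGE r (∑ i ∈ s, θ i) (∏ i ∈ s, F i) := by
  classical
  induction s using Finset.induction_on with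
  | empty => exact IndGE.of_nonpos r (by simp) _
  | insert a s ha ih =>
    rw [sum_insert ha, prod_insert ha]
    exact (h a (by simp)).mul (ih fun i hi => h i (by simp [hi]))

lemma IndGE.det {k : ℕ} {r : σ → ℕ} (θ : Fin k → ℝ) (M : Matrix (Fin k) (Fin k) (MvPolynomial σ K))
    (h : ∀ a i, IndGE r (θ i) (M a i)) : IndGE r (∑ i, θ i) M.det := by
  rw [Matrix.det_apply]
  refine IndGE.sum _ _ fun s _ => ?_
  have h1 := IndGE.prod Finset.univ θ (fun i => M (s i) i) fun i _ => h _ _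
  rcases Int.units_eq_one_or (Equiv.Perm.sign s) with h2 | h2
  · rw [h2, one_smul]; exact h1
  · rw [h2]
    have := h1.smul (-1)
    simpa using this

lemma IndGE.pderiv [DecidableEq σ] {r : σ → ℕ} {θ : ℝ} {F : MvPolynomial σ K} (hF : IndGE r θ F) (i : σ) :
    IndGE r (θ - 1 / r i) (pderiv i F) := by
  intro Δ hΔ
  have h1 : coeff (Δ + Finsupp.single i 1) F ≠ 0 := by
    intro h
    apply hΔ
    have h2 : coeff (Δ + Finsupp.single i 1) (X i * MvPolynomial.pderiv i F) = 0 := by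
      rw [X_mul_pderiv, coeff_dg, h, mul_zero]
    rwa [add_comm, coeff_X_mul] at h2
  have := hF _ h1
  rw [wt_add, wt_single] at this
  linarith

end basics

section fld

variable {σ : Type*} [Fintype σ] [DecidableEq σ] {K : Type*} [Field K] [CharZero K]

lemma IndGE.hs {r : σ → ℕ} {θ : ℝ} {ξ : σ → K} {P : MvPolynomial σ K} (h : IndGE r θ (tay ξ P))
    (Δ : σ →₀ ℕ) : IndGE r (θ - wt r Δ) (tay ξ (hs Δ P)) := by
  induction hn : ∑ i, Δ i generalizing Δ with
  | zero =>
    have : Δ = 0 := by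
      ext i; exact (Finset.sum_eq_zero_iff.mp hn) i (Finset.mem_univ i)
    subst this
    rw [hs_zero]
    exact h.mono (by linarith [wt_nonneg r (0 : σ →₀ ℕ)])
  | succ n ih =>
    obtain ⟨i, hi⟩ : ∃ i, Δ i ≠ 0 := by
      by_contra hc; push Not at hc; simp [hc] at hn
    set Γ := Δ - Finsupp.single i 1 with hΓ
    have hΔ : Δ = Γ + Finsupp.single i 1 := by
      ext j; by_cases hj : i = j
      · subst hj; simp [hΓ]; omega
      · simp [hΓ, Finsupp.single_apply, hj]
    have h1 : ∑ i, Γ i = n := by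
      rw [hΔ] at hn
      simp only [Finsupp.coe_add, Pi.add_apply, sum_add_distrib] at hn
      have : ∑ x, (Finsupp.single i 1 : σ →₀ ℕ) x = 1 := by simp
      omega
    have h2 := ih Γ h1
    have h3 := congrArg (tay ξ) (hs_succ Γ i P)
    rw [map_smul, map_sub, map_mul, map_smul, tay_pderiv] at h3
    rw [hΔ, wt_add, wt_single]
    have hne : ((Γ i : K) + 1) ≠ 0 := Nat.cast_add_one_ne_zero (Γ i)
    have h4 : tay ξ (Rid.hs (Γ + Finsupp.single i 1) P) = ((Γ i : K) + 1)⁻¹ •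
      (tay ξ (X i) * MvPolynomial.pderiv i (tay ξ (Rid.hs Γ P)) + (-(Γ i : K)) • tay ξ (Rid.hs Γ P)) := by
      rw [neg_smul, ← sub_eq_add_neg, ← h3, smul_smul, inv_mul_cancel₀ hne, one_smul]
    rw [h4]
    refine IndGE.smul (IndGE.add ?_ ?_) _
    · have := (IndGE.of_nonpos r (le_refl 0) (tay ξ (X i))).mul (h2.pderiv i)
      refine this.mono ?_
      push_cast; linarith
    · refine (h2.smul _).mono ?_
      have : 0 ≤ (1:ℝ) / r i := by positivity
      linarith

end fld

end Rid

namespace Rid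

open MvPolynomial

section wr

variable {σ : Type*} [Fintype σ] [DecidableEq σ] {K : Type*} [Field K] [CharZero K]

lemma echelon (m : MonomialOrder σ) (k : ℕ) : ∀ φ : Fin k → MvPolynomial σ K, LinearIndependent K φ →
    ∃ (f : Fin k → MvPolynomial σ K) (e : Fin k → (σ →₀ ℕ)), Function.Injective e ∧
      ∀ j, f j ∈ Submodule.span K (Set.range φ) ∧ coeff (e j) (f j) ≠ 0 ∧
        m.toSyn (m.degree (f j)) ≤ m.toSyn (e j) := by
  induction k with
  | zero => intro φ _; exact ⟨φ, fun _ => 0, fun a => a.elim0, fun j => j.elim0⟩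
  | succ k ih =>
    intro φ hφ
    obtain ⟨j0, hj0⟩ := Finite.exists_max (fun j => m.toSyn (m.degree (φ j)))
    set d := m.degree (φ j0) with hd
    have hc0 := m.coeff_degree_ne_zero_iff.mpr (hφ.ne_zero j0)
    set c := fun i : Fin k => coeff d (φ (j0.succAbove i)) / coeff d (φ j0) with hc
    set φ' := fun i : Fin k => φ (j0.succAbove i) - c i • φ j0 with hφ'
    have hli : LinearIndependent K φ' := by
      rw [Fintype.linearIndependent_iff] at hφ ⊢
      intro g hg i
      have h1 := hφ (j0.insertNth (-∑ i, g i * c i) g) (by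
        rw [Fin.sum_univ_succAbove _ j0]
        simp only [Fin.insertNth_apply_same, Fin.insertNth_apply_succAbove]
        simp only [hφ', smul_sub, sum_sub_distrib, smul_smul, ← Finset.sum_smul] at hg
        rw [neg_smul, neg_add_eq_sub, hg]) (j0.succAbove i)
      simpa using h1
    obtain ⟨f, e, he, hf⟩ := ih φ' hli
    have hsub : Submodule.span K (Set.range φ') ≤ Submodule.span K (Set.range φ) := by
      rw [Submodule.span_le]
      rintro _ ⟨i, rfl⟩
      exact Submodule.sub_mem _ (Submodule.subset_span ⟨_, rfl⟩)
        (Submodule.smul_mem _ _ (Submodule.subset_span ⟨_, rfl⟩))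
    have hz : ∀ g ∈ Submodule.span K (Set.range φ'), coeff d g = 0 := by
      intro g hg
      induction hg using Submodule.span_induction with
      | mem x hx =>
        obtain ⟨i, rfl⟩ := hx
        simp only [hφ', coeff_sub, coeff_smul, smul_eq_mul]
        rw [div_mul_cancel₀ _ hc0, sub_self]
      | zero => simp
      | add x y _ _ hx hy => rw [coeff_add, hx, hy, add_zero]
      | smul a x _ hx => rw [coeff_smul, hx, smul_zero]
    refine ⟨Fin.cons (φ j0) f, Fin.cons d e, ?_, ?_⟩
    · rw [Fin.cons_injective_iff]
      refine ⟨?_, he⟩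
      rintro ⟨j, hj⟩
      exact (hf j).2.1 (by rw [hj]; exact hz _ (hf j).1)
    · intro j
      refine Fin.cases ?_ (fun i => ?_) j
      · simp
        exact ⟨Submodule.subset_span ⟨_, rfl⟩, hc0, le_rfl⟩
      · simp
        exact ⟨hsub (hf i).1, (hf i).2⟩

lemma lead_prod (m : MonomialOrder σ) {ι : Type*} (s : Finset ι) (F : ι → MvPolynomial σ K) (e : ι → (σ →₀ ℕ))
    (h : ∀ i ∈ s, m.toSyn (m.degree (F i)) ≤ m.toSyn (e i)) :
    coeff (∑ i ∈ s, e i) (∏ i ∈ s, F i) = ∏ i ∈ s, coeff (e i) (F i) ∧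
      m.toSyn (m.degree (∏ i ∈ s, F i)) ≤ m.toSyn (∑ i ∈ s, e i) := by
  classical
  induction s using Finset.induction_on with
  | empty => simp
  | insert a s ha ih =>
    have h1 := ih fun i hi => h i (by simp [hi])
    have h2 := h a (by simp)
    rw [sum_insert ha, prod_insert ha, prod_insert ha]
    refine ⟨by rw [m.coeff_mul_of_add_of_degree_le h2 h1.2, h1.1], ?_⟩
    refine m.degree_mul_le.trans ?_
    rw [map_add, map_add]
    exact add_le_add h2 h1.2

lemma lead_det (m : MonomialOrder σ) {k : ℕ} (M : Matrix (Fin k) (Fin k) (MvPolynomial σ K)) (e : Fin k → (σ →₀ ℕ))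
    (h : ∀ a j, m.toSyn (m.degree (M a j)) ≤ m.toSyn (e j)) :
    coeff (∑ i, e i) M.det = (Matrix.of fun a j => coeff (e j) (M a j)).det := by
  rw [Matrix.det_apply', Matrix.det_apply', coeff_sum]
  refine sum_congr rfl fun s _ => ?_
  have := (lead_prod m Finset.univ (fun i => M (s i) i) e fun i _ => h _ _).1
  rcases Int.units_eq_one_or (Equiv.Perm.sign s) with h2 | h2
  · rw [h2]; simpa using this
  · rw [h2]; simp [this]

lemma minor {ι : Type*} {k : ℕ} (v : ι → Fin k → K)
    (h : ∀ l : Fin k → K, (∀ i, ∑ j, l j * v i j = 0) → l = 0) :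
    ∃ x : Fin k → ι, (Matrix.of fun a j => v (x a) j).det ≠ 0 := by
  have htop : Submodule.span K (Set.range v) = ⊤ := by
    by_contra hne
    obtain ⟨f, hf0, hf⟩ := Submodule.exists_le_ker_of_lt_top _ (lt_top_iff_ne_top.mpr hne)
    apply hf0
    have h1 := h (fun j => f (Pi.single j 1)) (fun i => by
      have h2 := hf (Submodule.subset_span ⟨i, rfl⟩)
      rw [← h2, LinearMap.pi_apply_eq_sum_univ f (v i)]
      refine sum_congr rfl fun j _ => ?_
      rw [mul_comm]; congr 2
      ext x; simp [Pi.single_apply, eq_comm])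
    refine LinearMap.pi_ext' fun j => ?_
    ext
    simpa using congrFun h1 j
  obtain ⟨f, hf, hs, hli⟩ := Submodule.exists_fun_fin_finrank_span_eq K (Set.range v)
  have hk : Module.finrank K (Submodule.span K (Set.range v)) = k := by rw [htop]; simp
  choose x hx using hf
  refine ⟨fun a => x (Fin.cast hk.symm a), ?_⟩
  have : LinearIndependent K (fun a : Fin k => v (x (Fin.cast hk.symm a))) := by
    simp only [hx]
    exact hli.comp _ (Fin.cast_injective hk.symm)
  have h2 := Matrix.linearIndependent_rows_iff_isUnit (A := Matrix.of fun a j => v (x (Fin.cast hk.symm a)) j)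
  have h3 := h2.mp this
  exact ((Matrix.isUnit_iff_isUnit_det _).mp h3).ne_zero

def Sm (σ K : Type*) [Fintype σ] [Field K] (m : ℕ) : Submodule K ((σ →₀ ℕ) → K) :=
  Submodule.span K {g | ∃ Δ : σ →₀ ℕ, ∑ i, Δ i ≤ m ∧ g = fun e => (bn Δ e : K)}

lemma Sm_one : (fun _ => 1) ∈ Sm σ K 0 :=
  Submodule.subset_span ⟨0, by simp, by ext e; simp [bn]⟩

lemma Sm_mono {m : ℕ} : Sm σ K m ≤ Sm σ K (m + 1) :=
  Submodule.span_mono fun g ⟨Δ, h, h'⟩ => ⟨Δ, by omega, h'⟩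

lemma Sm_mul {m : ℕ} (i : σ) (g : (σ →₀ ℕ) → K) (hg : g ∈ Sm σ K m) :
    (fun e => (e i : K) * g e) ∈ Sm σ K (m + 1) := by
  induction hg using Submodule.span_induction with
  | mem g hg =>
    obtain ⟨Δ, hΔ, rfl⟩ := hg
    have : (fun e : σ →₀ ℕ => (e i : K) * (bn Δ e : K)) =
        ((Δ i : K) + 1) • (fun e : σ →₀ ℕ => (bn (Δ + Finsupp.single i 1) e : K)) +
          (Δ i : K) • (fun e : σ →₀ ℕ => (bn Δ e : K)) := by
      ext e
      have := bn_succ (K := K) Δ e i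
      simp
      linear_combination -this
    rw [this]
    refine Submodule.add_mem _ (Submodule.smul_mem _ _ (Submodule.subset_span ⟨_, ?_, rfl⟩))
      (Submodule.smul_mem _ _ (Submodule.subset_span ⟨Δ, by omega, rfl⟩))
    simp only [Finsupp.coe_add, Pi.add_apply, sum_add_distrib]
    have : ∑ x, (Finsupp.single i 1 : σ →₀ ℕ) x = 1 := by simp
    omega
  | zero => simp; exact Submodule.zero_mem _
  | add x y _ _ hx hy =>
    convert Submodule.add_mem _ hx hy using 1
    ext e; simp [mul_add]
  | smul a x _ hx =>
    convert Submodule.smul_mem _ a hx using 1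
    ext e; simp; ring

lemma Sm_prod {ι : Type*} (s : Finset ι) (i : ι → σ) (c : ι → K) :
    (fun e : σ →₀ ℕ => ∏ j ∈ s, ((e (i j) : K) - c j)) ∈ Sm σ K s.card := by
  classical
  induction s using Finset.induction_on with
  | empty => simpa using Sm_one
  | insert a s ha ih =>
    rw [card_insert_of_notMem ha]
    simp only [prod_insert ha, sub_mul]
    exact Submodule.sub_mem _ (Sm_mul (i a) _ ih) (Sm_mono (Submodule.smul_mem _ (c a) ih))

lemma interp [Nonempty σ] {k : ℕ} (e : Fin k → (σ →₀ ℕ)) (he : Function.Injective e) :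
    ∃ Δ : Fin k → (σ →₀ ℕ), (∀ a, ∑ i, Δ a i < k) ∧
      (Matrix.of fun a j => (bn (Δ a) (e j) : K)).det ≠ 0 := by
  obtain ⟨x, hx⟩ := minor (K := K) (ι := {Δ : σ →₀ ℕ // ∑ i, Δ i < k}) (fun Δ j => (bn Δ.1 (e j) : K)) (by
    intro l hl
    ext j0
    have hk : 0 < k := by have := j0.2; omega
    have h1 : ∀ g ∈ Sm σ K (k - 1), ∑ j, l j * g (e j) = 0 := by
      intro g hg
      induction hg using Submodule.span_induction with
      | mem g hg => obtain ⟨Δ, hΔ, rfl⟩ := hg; exact hl ⟨Δ, by omega⟩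
      | zero => simp
      | add x y _ _ hx hy => simp only [Pi.add_apply, mul_add, sum_add_distrib, hx, hy, add_zero]
      | smul a x _ hx =>
        simp only [Pi.smul_apply, smul_eq_mul, mul_left_comm _ a, ← mul_sum, hx, mul_zero]
    have h2 : ∀ j : Fin k, ∃ i : σ, j ≠ j0 → e j0 i ≠ e j i := by
      intro j
      by_cases hj : j = j0
      · exact ⟨Classical.arbitrary σ, fun h => absurd hj h⟩
      · by_contra hc
        push Not at hc
        exact hj (he (Finsupp.ext fun i => ((hc i).2).symm))
    choose i hi using h2
    have h3 := h1 _ (by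
      have := Sm_prod (K := K) (Finset.univ.erase j0) i (fun j => (e j (i j) : K))
      rwa [Finset.card_erase_of_mem (Finset.mem_univ _), card_univ, Fintype.card_fin] at this)
    rw [sum_eq_single j0] at h3
    · refine (mul_eq_zero.mp h3).resolve_right ?_
      refine prod_ne_zero_iff.mpr ?_
      intro j hj
      rw [sub_ne_zero]
      exact_mod_cast hi j (Finset.ne_of_mem_erase hj)
    · intro j _ hj
      rw [prod_eq_zero (i := j) (by simp [hj]) (by simp), mul_zero]
    · simp)
  exact ⟨fun a => (x a).1, fun a => (x a).2, hx⟩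

theorem wronsk [Nonempty σ] (m : MonomialOrder σ) {k : ℕ} (φ : Fin k → MvPolynomial σ K) (hφ : LinearIndependent K φ) :
    ∃ Δ : Fin k → (σ →₀ ℕ), (∀ a, ∑ i, Δ a i < k) ∧
      (Matrix.of fun a j => hs (Δ a) (φ j)).det ≠ 0 := by
  obtain ⟨f, e, he, hf⟩ := echelon m k φ hφ
  obtain ⟨Δ, hΔ, hdet⟩ := interp (K := K) e he
  refine ⟨Δ, hΔ, ?_⟩
  have h1 : (Matrix.of fun a j => hs (Δ a) (f j)).det ≠ 0 := by
    intro h0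
    have h2 := lead_det m (Matrix.of fun a j => hs (Δ a) (f j)) e (by
      intro a j
      rw [m.degree_le_iff]
      intro c hc
      rw [mem_support_iff, Matrix.of_apply, coeff_hs] at hc
      exact (m.le_degree (mem_support_iff.mpr (right_ne_zero_of_mul hc))).trans (hf j).2.2)
    rw [h0, coeff_zero] at h2
    have h3 : (Matrix.of fun a j => coeff (e j) ((Matrix.of fun a j => hs (Δ a) (f j)) a j)) =
       (Matrix.of fun a j => (coeff (e j) (f j)) * (Matrix.of fun a j => (bn (Δ a) (e j) : K)) a j) := by
      ext a j; simp [coeff_hs, mul_comm]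
    rw [h3, Matrix.det_mul_row] at h2
    refine mul_ne_zero ?_ hdet h2.symm
    rw [prod_ne_zero_iff]; exact fun j _ => (hf j).2.1
  intro h0
  apply h1
  choose A hA using fun j => (Submodule.mem_span_range_iff_exists_fun K).mp (hf j).1
  have h2 : (Matrix.of fun a j => hs (Δ a) (f j)) = (Matrix.of fun a j => hs (Δ a) (φ j)) *
      (Matrix.of fun i j => C (A j i)) := by
    ext1 a j
    rw [Matrix.mul_apply]
    simp only [Matrix.of_apply]
    rw [← hA j, map_sum]
    refine sum_congr rfl fun i _ => ?_
    rw [map_smul, smul_eq_C_mul, mul_comm]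
  rw [h2, Matrix.det_mul, h0, zero_mul]

end wr

end Rid

namespace Rid

open MvPolynomial

section nrm

variable {σ : Type*} [Fintype σ] {K : Type*} [NormedField K]

noncomputable def N1 (P : MvPolynomial σ K) : ℝ := ∑ e ∈ P.support, ‖coeff e P‖

lemma N1_nonneg (P : MvPolynomial σ K) : 0 ≤ N1 P := sum_nonneg fun _ _ => norm_nonneg _

lemma N1_eq {P : MvPolynomial σ K} {S : Finset (σ →₀ ℕ)} (h : P.support ⊆ S) :
    N1 P = ∑ e ∈ S, ‖coeff e P‖ :=
  Finset.sum_subset h fun e _ he => by simpa using he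

lemma norm_coeff_le (P : MvPolynomial σ K) (e : σ →₀ ℕ) : ‖coeff e P‖ ≤ N1 P := by
  rw [N1_eq (Finset.subset_insert e P.support)]
  exact Finset.single_le_sum (f := fun e => ‖coeff e P‖) (fun _ _ => norm_nonneg _) (Finset.mem_insert_self _ _)

lemma N1_add (P Q : MvPolynomial σ K) : N1 (P + Q) ≤ N1 P + N1 Q := by
  classical
  rw [N1_eq (S := P.support ∪ Q.support) support_add,
    N1_eq (S := P.support ∪ Q.support) (P := P) Finset.subset_union_left,
    N1_eq (S := P.support ∪ Q.support) (P := Q) Finset.subset_union_right, ← sum_add_distrib]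
  exact sum_le_sum fun e _ => by rw [coeff_add]; exact norm_add_le _ _

lemma N1_zero : N1 (0 : MvPolynomial σ K) = 0 := by simp [N1]

lemma N1_sum {ι : Type*} (s : Finset ι) (F : ι → MvPolynomial σ K) : N1 (∑ i ∈ s, F i) ≤ ∑ i ∈ s, N1 (F i) := by
  classical
  induction s using Finset.induction_on with
  | empty => simp [N1_zero]
  | insert a s ha ih =>
    rw [sum_insert ha, sum_insert ha]
    exact (N1_add _ _).trans (by gcongr)

lemma N1_monomial (e : σ →₀ ℕ) (c : K) : N1 (monomial e c) = ‖c‖ := by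
  classical
  rw [N1_eq (S := {e}) support_monomial_subset]; simp

lemma N1_mul (P Q : MvPolynomial σ K) : N1 (P * Q) ≤ N1 P * N1 Q := by
  conv_lhs => rw [P.as_sum, Q.as_sum, sum_mul_sum]
  refine (N1_sum _ _).trans ?_
  rw [N1, N1, sum_mul_sum]
  refine sum_le_sum fun e _ => (N1_sum _ _).trans ?_
  refine sum_le_sum fun f _ => ?_
  rw [monomial_mul, N1_monomial, norm_mul]

lemma N1_smul (c : K) (P : MvPolynomial σ K) : N1 (c • P) ≤ ‖c‖ * N1 P := by
  rw [N1_eq (S := P.support) support_smul, N1, mul_sum]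
  exact sum_le_sum fun e _ => by rw [coeff_smul, norm_smul]

lemma N1_one : N1 (1 : MvPolynomial σ K) = 1 := by
  have := N1_monomial (σ := σ) (0 : σ →₀ ℕ) (1 : K); simpa using this

lemma N1_prod {ι : Type*} (s : Finset ι) (F : ι → MvPolynomial σ K) : N1 (∏ i ∈ s, F i) ≤ ∏ i ∈ s, N1 (F i) := by
  classical
  induction s using Finset.induction_on with
  | empty => simp [N1_one]
  | insert a s ha ih =>
    rw [prod_insert ha, prod_insert ha]
    exact (N1_mul _ _).trans (mul_le_mul_of_nonneg_left ih (N1_nonneg _))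

def DB (r : σ → ℕ) (P : MvPolynomial σ K) : Prop := ∀ e, coeff e P ≠ 0 → ∀ i, e i ≤ r i

lemma bn_le {r : σ → ℕ} (Δ e : σ →₀ ℕ) (he : ∀ i, e i ≤ r i) : bn Δ e ≤ 2 ^ ∑ i, r i := by
  rw [← prod_pow_eq_pow_sum]
  exact Finset.prod_le_prod' fun i _ =>
    (Nat.choose_le_two_pow _ _).trans (Nat.pow_le_pow_right (by norm_num) (he i))

end nrm

section bd

variable {σ : Type*} [Fintype σ]

structure Bd (r : σ → ℕ) (M : ℝ) (P : MvPolynomial σ ℚ) : Prop where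
  int : ∀ e, ∃ z : ℤ, coeff e P = z
  deg : DB r P
  n1 : N1 P ≤ M

lemma Bd.add {r : σ → ℕ} {M M' : ℝ} {P Q : MvPolynomial σ ℚ} (hP : Bd r M P) (hQ : Bd r M' Q) :
    Bd r (M + M') (P + Q) where
  int e := by
    obtain ⟨a, ha⟩ := hP.int e
    obtain ⟨b, hb⟩ := hQ.int e
    exact ⟨a + b, by rw [coeff_add, ha, hb]; push_cast; rfl⟩
  deg e he := by
    by_cases h : coeff e P = 0
    · apply hQ.deg; intro h2; rw [coeff_add, h, h2] at he; simp at he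
    · exact hP.deg e h
  n1 := (N1_add _ _).trans (add_le_add hP.n1 hQ.n1)

lemma Bd.neg {r : σ → ℕ} {M : ℝ} {P : MvPolynomial σ ℚ} (hP : Bd r M P) : Bd r M (-P) where
  int e := by
    obtain ⟨a, ha⟩ := hP.int e
    exact ⟨-a, by rw [coeff_neg, ha]; rfl⟩
  deg e he := hP.deg e (by rwa [coeff_neg, neg_ne_zero] at he)
  n1 := by
    have := N1_smul (-1) P
    simp at this
    exact this.trans hP.n1

lemma Bd.mul {r r' : σ → ℕ} {M M' : ℝ} {P Q : MvPolynomial σ ℚ} (hP : Bd r M P) (hQ : Bd r' M' Q) :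
    Bd (r + r') (M * M') (P * Q) where
  int e := by
    classical
    choose a ha using hP.int
    choose b hb using hQ.int
    refine ⟨∑ x ∈ Finset.HasAntidiagonal.antidiagonal e, a x.1 * b x.2, ?_⟩
    rw [coeff_mul]; push_cast
    exact sum_congr rfl fun x _ => by rw [ha, hb]
  deg e he := by
    classical
    rw [coeff_mul] at he
    obtain ⟨x, hx, hne⟩ := Finset.exists_ne_zero_of_sum_ne_zero he
    rw [Finset.HasAntidiagonal.mem_antidiagonal] at hx
    intro i
    rw [← hx]
    exact add_le_add (hP.deg _ (left_ne_zero_of_mul hne) i) (hQ.deg _ (right_ne_zero_of_mul hne) i)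
  n1 := (N1_mul _ _).trans (mul_le_mul hP.n1 hQ.n1 (N1_nonneg _) ((N1_nonneg _).trans hP.n1))

lemma Bd.prod {ι : Type*} {r : σ → ℕ} {M : ℝ} (s : Finset ι) (F : ι → MvPolynomial σ ℚ)
    (h : ∀ i ∈ s, Bd r M (F i)) : Bd (fun x => s.card * r x) (M ^ s.card) (∏ i ∈ s, F i) := by
  classical
  induction s using Finset.induction_on with
  | empty =>
    refine ⟨fun e => ?_, fun e he i => ?_, by simp [N1_one]⟩
    · rw [prod_empty, coeff_one]; split_ifs
      · exact ⟨1, by simp⟩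
      · exact ⟨0, by simp⟩
    · rw [prod_empty, coeff_one] at he
      have : 0 = e := by by_contra hc; simp [hc] at he
      simp [← this]
  | insert a s ha ih =>
    rw [prod_insert ha, card_insert_of_notMem ha, pow_succ, mul_comm (M ^ _)]
    have := (h a (by simp)).mul (ih fun i hi => h i (by simp [hi]))
    convert this using 1
    ext x; simp; ring

lemma Bd.sum {ι : Type*} {r : σ → ℕ} {M : ℝ} (s : Finset ι) (F : ι → MvPolynomial σ ℚ)
    (h : ∀ i ∈ s, Bd r M (F i)) : Bd r (s.card * M) (∑ i ∈ s, F i) := by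
  classical
  induction s using Finset.induction_on with
  | empty => exact ⟨fun e => ⟨0, by simp⟩, fun e he => by simp at he, by simp [N1_zero]⟩
  | insert a s ha ih =>
    rw [sum_insert ha, card_insert_of_notMem ha]
    have := (h a (by simp)).add (ih fun i hi => h i (by simp [hi]))
    convert this using 1
    push_cast; ring

lemma Bd.det {k : ℕ} {r : σ → ℕ} {M : ℝ} (A : Matrix (Fin k) (Fin k) (MvPolynomial σ ℚ))
    (h : ∀ a i, Bd r M (A a i)) : Bd (fun x => k * r x) (k.factorial * M ^ k) A.det := by
  rw [Matrix.det_apply]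
  have := Bd.sum (r := fun x => k * r x) (M := M ^ k) (Finset.univ : Finset (Equiv.Perm (Fin k)))
    (fun s => Equiv.Perm.sign s • ∏ i, A (s i) i) (by
      intro s _
      have h1 := Bd.prod Finset.univ (fun i => A (s i) i) fun i _ => h _ _
      simp at h1
      rcases Int.units_eq_one_or (Equiv.Perm.sign s) with h2 | h2
      · rw [h2, one_smul]; exact h1
      · rw [h2]; simpa using h1.neg)
  rwa [card_univ, Fintype.card_perm, Fintype.card_fin] at this

lemma Bd.hs {r : σ → ℕ} {M : ℝ} {P : MvPolynomial σ ℚ} (hP : Bd r M P) (Δ : σ →₀ ℕ) :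
    Bd r (2 ^ (∑ i, r i) * M) (hs Δ P) where
  int e := by
    obtain ⟨a, ha⟩ := hP.int e
    exact ⟨bn Δ e * a, by rw [coeff_hs, ha]; push_cast; rfl⟩
  deg e he := hP.deg e (by rw [coeff_hs] at he; exact right_ne_zero_of_mul he)
  n1 := by
    rw [N1_eq (S := P.support)]
    · refine le_trans ?_ (mul_le_mul_of_nonneg_left hP.n1 (by positivity))
      rw [N1, mul_sum]
      refine sum_le_sum fun e he => ?_
      rw [coeff_hs, norm_mul]
      refine mul_le_mul_of_nonneg_right ?_ (norm_nonneg _)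
      have := bn_le Δ e (hP.deg e (by simpa using he))
      have h2 : ‖((bn Δ e : ℕ) : ℚ)‖ = (bn Δ e : ℝ) := by simp [← Rat.norm_cast_real]
      rw [h2]; exact_mod_cast this
    · intro e he
      rw [mem_support_iff, coeff_hs] at he
      exact mem_support_iff.mpr (right_ne_zero_of_mul he)

end bd

section sep

variable {n : ℕ} {K : Type*} [CommRing K]

noncomputable def sep (φ : MvPolynomial (Fin n) K) (ψ : MvPolynomial (Fin 1) K) : MvPolynomial (Fin (n + 1)) K :=
  rename Fin.succ φ * rename (fun _ => (0 : Fin (n + 1))) ψ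

lemma cons_eq (e : Fin n →₀ ℕ) (f : Fin 1 →₀ ℕ) :
    Finsupp.mapDomain Fin.succ e + Finsupp.mapDomain (fun _ => (0 : Fin (n + 1))) f = Finsupp.cons (f 0) e := by
  have h0 : f = Finsupp.single 0 (f 0) := by
    refine Finsupp.ext fun i => ?_
    rw [Subsingleton.elim i 0]; simp
  ext i
  refine Fin.cases ?_ (fun j => ?_) i
  · rw [h0, Finsupp.mapDomain_single]
    simp [Finsupp.mapDomain_notin_range, Fin.succ_ne_zero]
  · rw [h0, Finsupp.add_apply, Finsupp.mapDomain_apply (Fin.succ_injective n)]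
    simp

lemma coeff_sep (φ : MvPolynomial (Fin n) K) (ψ : MvPolynomial (Fin 1) K) (i : ℕ) (e : Fin n →₀ ℕ) :
    coeff (Finsupp.cons i e) (sep φ ψ) = coeff e φ * coeff (Finsupp.single 0 i) ψ := by
  unfold sep
  induction φ using MvPolynomial.induction_on' with
  | add p q hp hq => rw [map_add, add_mul, coeff_add, hp, hq, coeff_add, add_mul]
  | monomial a r =>
    induction ψ using MvPolynomial.induction_on' with
    | add p q hp hq => rw [map_add, mul_add, coeff_add, hp, hq, coeff_add, mul_add]
    | monomial b s =>
      rw [rename_monomial, rename_monomial, monomial_mul, cons_eq, coeff_monomial]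
      have h1 : (Finsupp.cons (b 0) a = Finsupp.cons i e) ↔ a = e ∧ b = Finsupp.single 0 i := by
        constructor
        · intro h
          refine ⟨by rw [← Finsupp.tail_cons (b 0) a, h, Finsupp.tail_cons], ?_⟩
          refine Finsupp.ext fun x => ?_
          rw [Subsingleton.elim x 0]
          have := DFunLike.congr_fun h 0
          simpa using this
        · rintro ⟨rfl, rfl⟩; simp
      simp only [h1]
      by_cases h2 : a = e <;> by_cases h3 : b = Finsupp.single 0 i <;> simp [h3]

lemma hs_sep (φ : MvPolynomial (Fin n) K) (ψ : MvPolynomial (Fin 1) K) (i : ℕ) (Δ : Fin n →₀ ℕ) :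
    hs (Finsupp.cons i Δ) (sep φ ψ) = sep (hs Δ φ) (hs (Finsupp.single 0 i) ψ) := by
  ext e
  rw [← Finsupp.cons_tail e, coeff_hs, coeff_sep, coeff_sep, coeff_hs, coeff_hs]
  have : bn (Finsupp.cons i Δ) (Finsupp.cons (e 0) e.tail) = bn (Finsupp.single 0 i) (Finsupp.single (0 : Fin 1) (e 0)) * bn Δ e.tail := by
    unfold bn
    rw [Fin.prod_univ_succ]; simp only [Finsupp.cons_succ]; simp
  rw [this]; push_cast; ring

lemma tay_rename {σ τ : Type*} (f : σ → τ) (ξ : τ → K) (P : MvPolynomial σ K) :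
    tay ξ (rename f P) = rename f (tay (ξ ∘ f) P) := by
  have : (tay ξ).comp (rename f) = (rename f).comp (tay (ξ ∘ f)) := by
    ext i; simp [tay]
  exact DFunLike.congr_fun this P

lemma tay_sep (ξ : Fin (n + 1) → K) (φ : MvPolynomial (Fin n) K) (ψ : MvPolynomial (Fin 1) K) :
    tay ξ (sep φ ψ) = sep (tay (ξ ∘ Fin.succ) φ) (tay (fun _ => ξ 0) ψ) := by
  unfold sep
  rw [map_mul, tay_rename, tay_rename]; rfl

lemma sep_det {k : ℕ} (A : Matrix (Fin k) (Fin k) (MvPolynomial (Fin n) K))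
    (B : Matrix (Fin k) (Fin k) (MvPolynomial (Fin 1) K)) :
    (Matrix.of fun a i => ∑ j, sep (A a j) (B i j)).det = sep A.det B.det := by
  have : (Matrix.of fun a i => ∑ j, sep (A a j) (B i j)) =
    (rename (Fin.succ : Fin n → Fin (n+1))).toRingHom.mapMatrix A *
      ((rename (fun _ : Fin 1 => (0 : Fin (n + 1)))).toRingHom.mapMatrix B).transpose := by
    ext1 a i
    simp [Matrix.mul_apply, sep]
  rw [this, Matrix.det_mul, Matrix.det_transpose, ← RingHom.map_det, ← RingHom.map_det]
  rfl

end sep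

lemma sep_decomp {n : ℕ} (P : MvPolynomial (Fin (n + 1)) ℚ) (r0 : ℕ)
    (hr : ∀ e, coeff e P ≠ 0 → e 0 ≤ r0) : ∃ k ≤ r0 + 1, ∃ (φ : Fin k → MvPolynomial (Fin n) ℚ)
      (ψ : Fin k → MvPolynomial (Fin 1) ℚ), LinearIndependent ℚ φ ∧ LinearIndependent ℚ ψ ∧
        P = ∑ j, sep (φ j) (ψ j) := by
  classical
  set c : Fin (r0 + 1) → MvPolynomial (Fin n) ℚ := fun j => (finSuccEquiv ℚ n P).coeff j with hc
  set V := Submodule.span ℚ (Set.range c) with hV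
  have hcV : ∀ j, c j ∈ V := fun j => Submodule.subset_span ⟨j, rfl⟩
  have hfin := FiniteDimensional.span_of_finite ℚ (Set.finite_range c)
  set B := Module.finBasis ℚ V
  refine ⟨Module.finrank ℚ V, ?_, fun j => (B j : MvPolynomial (Fin n) ℚ),
    fun i => ∑ j : Fin (r0 + 1), monomial (Finsupp.single 0 j) (B.repr ⟨c j, hcV j⟩ i), ?_, ?_, ?_⟩
  · have := finrank_range_le_card (R := ℚ) c
    rwa [Fintype.card_fin] at this
  · exact B.linearIndependent.map' V.subtype (Submodule.ker_subtype V)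
  · rw [Fintype.linearIndependent_iff]
    intro μ hμ i
    have h1 : ∀ j : Fin (r0 + 1), ∑ i, μ i * B.repr ⟨c j, hcV j⟩ i = 0 := by
      intro j
      have := congrArg (coeff (Finsupp.single 0 j)) hμ
      rw [coeff_sum] at this
      simp only [coeff_smul, coeff_sum, coeff_monomial, coeff_zero, smul_eq_mul] at this
      rw [← this]
      refine sum_congr rfl fun i _ => ?_
      rw [sum_eq_single j]
      · simp
      · intro j' _ hj'
        rw [if_neg]
        intro h
        have := DFunLike.congr_fun h 0
        simp at this
        exact hj' (Fin.ext this)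
      · simp
    have h2 : ∀ v : V, ∑ i, μ i * B.repr v i = 0 := by
      rintro ⟨v, hv⟩
      induction hv using Submodule.span_induction with
      | mem x hx => obtain ⟨j, rfl⟩ := hx; exact h1 j
      | zero =>
        have : (⟨0, V.zero_mem⟩ : V) = 0 := rfl
        simp [this]
      | add x y hx hy h h' =>
        have : (⟨x + y, V.add_mem hx hy⟩ : V) = ⟨x, hx⟩ + ⟨y, hy⟩ := rfl
        rw [this, map_add]
        simp only [Finsupp.add_apply, mul_add, sum_add_distrib, h, h', add_zero]
      | smul a x hx h =>
        have : (⟨a • x, V.smul_mem a hx⟩ : V) = a • ⟨x, hx⟩ := rfl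
        rw [this, map_smul]
        simp only [Finsupp.smul_apply, smul_eq_mul, mul_left_comm _ a, ← mul_sum, h, mul_zero]
    have := h2 (B i)
    rw [sum_eq_single i] at this
    · simpa using this
    · intro j _ hj; simp [Finsupp.single_apply, hj.symm]
    · simp
  · ext e
    rw [← Finsupp.cons_tail e, coeff_sum]
    simp only [coeff_sep, coeff_sum, coeff_monomial]
    have hrep : ∀ j, c j = ∑ i, B.repr ⟨c j, hcV j⟩ i • (B i : MvPolynomial (Fin n) ℚ) := by
      intro j
      have := congrArg Subtype.val (B.sum_repr ⟨c j, hcV j⟩)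
      simp only [Submodule.coe_sum, Submodule.coe_smul] at this
      exact this.symm
    by_cases h : e 0 ≤ r0
    · have h3 := congrArg (coeff e.tail) (hrep ⟨e 0, by omega⟩)
      have h4 : coeff e.tail (c ⟨e 0, by omega⟩) = coeff (Finsupp.cons (e 0) e.tail) P := by
        simp only [hc, finSuccEquiv_coeff_coeff]
      rw [← h4, h3, coeff_sum]
      refine sum_congr rfl fun i _ => ?_
      rw [sum_eq_single ⟨e 0, by omega⟩]
      · rw [if_pos rfl, coeff_smul, smul_eq_mul, mul_comm]
      · intro j' _ hj'
        rw [if_neg]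
        intro h
        have := DFunLike.congr_fun h 0
        simp at this
        exact hj' (Fin.ext this)
      · simp
    · have : coeff (Finsupp.cons (e 0) e.tail) P = 0 := by
        by_contra hne
        exact h (by simpa using hr _ hne)
      rw [this]
      symm
      refine sum_eq_zero fun i _ => ?_
      rw [sum_eq_zero, mul_zero]
      intro j _
      rw [if_neg]
      intro h'
      have := DFunLike.congr_fun h' 0
      simp at this
      have := j.2; omega

end Rid

namespace Rid

open MvPolynomial

lemma tay_inj {σ K : Type*} [CommRing K] (ξ : σ → K) (P : MvPolynomial σ K) (h : tay ξ P = 0) : P = 0 := by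
  have : (tay (-ξ)).comp (tay ξ) = AlgHom.id K _ := by ext i; simp [tay]
  have h2 := DFunLike.congr_fun this P
  rw [AlgHom.comp_apply, h, map_zero] at h2
  exact h2.symm

lemma N1_le_of_inj {σ τ K : Type*} [Fintype σ] [Fintype τ] [NormedField K] (F : MvPolynomial σ K) (Q : MvPolynomial τ K)
    (g : (σ →₀ ℕ) → (τ →₀ ℕ)) (hg : Function.Injective g) (h : ∀ e, coeff e F = coeff (g e) Q) : N1 F ≤ N1 Q := by
  unfold N1
  have h1 : ∑ e ∈ F.support, ‖coeff e F‖ = ∑ e ∈ F.support.image g, ‖coeff e Q‖ := by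
    rw [Finset.sum_image (fun a _ b _ hab => hg hab)]
    exact sum_congr rfl fun e _ => by rw [h]
  rw [h1]
  refine sum_le_sum_of_subset_of_nonneg ?_ fun _ _ _ => norm_nonneg _
  intro x hx
  obtain ⟨e, he, rfl⟩ := Finset.mem_image.mp hx
  rw [mem_support_iff] at he ⊢
  rwa [← h]

lemma gauss_den (p : Polynomial ℤ) (hp : p ≠ 0) (ξ : ℚ) (l : ℕ)
    (h : (Polynomial.X - Polynomial.C ξ) ^ l ∣ p.map (Int.castRingHom ℚ)) : (ξ.den : ℤ) ^ l ∣ p.leadingCoeff := by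
  set q : Polynomial ℤ := Polynomial.C (ξ.den : ℤ) * Polynomial.X + Polynomial.C (-ξ.num) with hq
  have hden : (ξ.den : ℤ) ≠ 0 := mod_cast ξ.den_nz
  have hprim : q.IsPrimitive := by
    rw [Polynomial.isPrimitive_iff_isUnit_of_C_dvd]
    intro r hr
    rw [Polynomial.C_dvd_iff_dvd_coeff] at hr
    have h0 := hr 0
    have h1 := hr 1
    simp [hq, Polynomial.coeff_one] at h0
    have h1 : r ∣ (ξ.den : ℤ) := by
      have e1 : q.coeff 1 = (ξ.den : ℤ) := by rw [Polynomial.coeff_add, Polynomial.coeff_C]; simp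
      rwa [e1] at h1
    have hco : IsCoprime ξ.num (ξ.den : ℤ) := by
      rw [Int.isCoprime_iff_gcd_eq_one]; exact ξ.reduced
    exact hco.isUnit_of_dvd' h0 h1
  have hprim2 : (q ^ l).IsPrimitive := by
    induction l with
    | zero => simpa using Polynomial.isPrimitive_one
    | succ l ih => rw [pow_succ]; exact (ih ((pow_dvd_pow _ (Nat.le_succ l)).trans h)).mul hprim
  have hmap : q.map (Int.castRingHom ℚ) = Polynomial.C (ξ.den : ℚ) * (Polynomial.X - Polynomial.C ξ) := by
    rw [hq, mul_sub, ← Polynomial.C_mul, Rat.den_mul_eq_num]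
    simp [sub_eq_add_neg]
  have hd : q ^ l ∣ p := by
    rw [Polynomial.IsPrimitive.Int.dvd_iff_map_cast_dvd_map_cast _ _ hprim2]
    · rw [Polynomial.map_pow, hmap, mul_pow]
      refine (IsUnit.mul_left_dvd ?_).mpr h
      refine IsUnit.pow _ (Polynomial.isUnit_C.mpr ?_)
      rw [isUnit_iff_ne_zero]; exact_mod_cast ξ.den_nz
  obtain ⟨s, hs⟩ := hd
  have hlq : q.leadingCoeff = ξ.den := by
    rw [hq]; exact Polynomial.leadingCoeff_linear hden
  rw [hs, Polynomial.leadingCoeff_mul, Polynomial.leadingCoeff_pow, hlq]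
  exact dvd_mul_right _ _

lemma toPoly_coeff {K : Type*} [CommRing K] (P : MvPolynomial (Fin 1) K) (l : ℕ) :
    (aeval (fun _ => Polynomial.X) P : Polynomial K).coeff l = coeff (Finsupp.single 0 l) P := by
  induction P using MvPolynomial.induction_on' with
  | add p q hp hq => rw [map_add, Polynomial.coeff_add, hp, hq, coeff_add]
  | monomial a r =>
    rw [aeval_monomial, coeff_monomial]
    have h0 : a = Finsupp.single 0 (a 0) := by
      refine Finsupp.ext fun i => ?_
      rw [Subsingleton.elim i 0]; simp
    have h1 : (a.prod fun _ k => (Polynomial.X : Polynomial K) ^ k) = Polynomial.X ^ (a 0) := by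
      simp
    rw [h1, Polynomial.algebraMap_eq, Polynomial.coeff_C_mul_X_pow]
    by_cases h : l = a 0
    · rw [if_pos h, if_pos]; rw [h, ← h0]
    · rw [if_neg h, if_neg]; intro h2; apply h; rw [h2]; simp

lemma toPoly_tay {K : Type*} [CommRing K] (P : MvPolynomial (Fin 1) K) (ξ : K) :
    (aeval (fun _ => Polynomial.X) (tay (fun _ => ξ) P) : Polynomial K) =
      (aeval (fun _ => Polynomial.X) P : Polynomial K).comp (Polynomial.X + Polynomial.C ξ) := by
  have : (aeval (fun _ : Fin 1 => (Polynomial.X : Polynomial K))).comp (tay (fun _ => ξ)) =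
      (Polynomial.compRingHom (Polynomial.X + Polynomial.C ξ)).comp
        (aeval (fun _ : Fin 1 => (Polynomial.X : Polynomial K)) : MvPolynomial (Fin 1) K →ₐ[K] Polynomial K).toRingHom := by
    apply MvPolynomial.ringHom_ext
    · intro r; simp
    · intro i; simp [tay]
  exact DFunLike.congr_fun this P

theorem roth1 {R : ℕ} (hR : 0 < R) {M ε T : ℝ} (P : MvPolynomial (Fin 1) ℚ) (hP : P ≠ 0) (hB : Bd (fun _ => R) M P)
    (ξ : ℚ) (hT : 0 < T) (hden : T ≤ R * log ξ.den) (hε : 0 < ε) (hM : log M ≤ ε * T) :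
    ∃ l : ℕ, (l : ℝ) / R ≤ ε ∧ coeff (Finsupp.single 0 l) (tay (fun _ => ξ) P) ≠ 0 := by
  have hex : ∃ l : ℕ, coeff (Finsupp.single 0 l) (tay (fun _ => ξ) P) ≠ 0 := by
    by_contra hc
    push Not at hc
    apply hP
    apply tay_inj (fun _ => ξ)
    ext e
    have h0 : e = Finsupp.single 0 (e 0) := by
      refine Finsupp.ext fun i => ?_
      rw [Subsingleton.elim i 0]; simp
    rw [h0, hc, coeff_zero]
  refine ⟨Nat.find hex, ?_, Nat.find_spec hex⟩
  set l := Nat.find hex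
  have hmin : ∀ j < l, coeff (Finsupp.single 0 j) (tay (fun _ => ξ) P) = 0 := fun j hj => by
    have := Nat.find_min hex hj; simpa using this
  set p : Polynomial ℚ := aeval (fun _ => Polynomial.X) P with hp
  have hdvd : (Polynomial.X - Polynomial.C ξ) ^ l ∣ p := by
    rw [Polynomial.X_sub_C_pow_dvd_iff, Polynomial.X_pow_dvd_iff]
    intro j hj
    rw [← toPoly_tay, toPoly_coeff]; exact hmin j hj
  have hpi : ∃ q : Polynomial ℤ, q.map (Int.castRingHom ℚ) = p := by
    have : p ∈ Polynomial.lifts (Int.castRingHom ℚ) := by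
      rw [Polynomial.lifts_iff_coeff_lifts]
      intro n
      rw [hp, toPoly_coeff]
      obtain ⟨z, hz⟩ := hB.int (Finsupp.single 0 n)
      exact ⟨z, by rw [hz]; simp⟩
    rw [Polynomial.mem_lifts] at this
    exact this
  obtain ⟨q, hq⟩ := hpi
  have hq0 : q ≠ 0 := by
    rintro rfl
    apply hP
    ext e
    have h0 : e = Finsupp.single 0 (e 0) := by
      refine Finsupp.ext fun i => ?_
      rw [Subsingleton.elim i 0]; simp
    rw [h0, ← toPoly_coeff, ← hp, ← hq]; simp
  have h1 := gauss_den q hq0 ξ l (by rw [hq]; exact hdvd)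
  have hlc := Polynomial.leadingCoeff_ne_zero.mpr hq0
  have h2 : (ξ.den : ℤ) ^ l ≤ |q.leadingCoeff| := by
    have := Int.le_of_dvd (abs_pos.mpr hlc) ((dvd_abs _ _).mpr h1)
    exact this
  have h3 : (|q.leadingCoeff| : ℝ) ≤ M := by
    refine le_trans ?_ hB.n1
    refine le_trans (le_of_eq ?_) (norm_coeff_le P (Finsupp.single 0 q.natDegree))
    rw [← toPoly_coeff, ← hp, ← hq, Polynomial.coeff_map, ← Rat.norm_cast_real]
    rw [Polynomial.coeff_natDegree]; simp
  have h4 : ((ξ.den : ℝ)) ^ l ≤ M := by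
    refine le_trans ?_ h3
    exact_mod_cast h2
  have h5 : l * log ξ.den ≤ log M := by
    rw [← log_pow]
    exact log_le_log (by positivity) h4
  have hRp : (0:ℝ) < R := mod_cast hR
  have hlog : 0 < log ξ.den := by
    by_contra hc
    push Not at hc
    have := mul_nonpos_of_nonneg_of_nonpos hRp.le hc
    linarith
  rw [div_le_iff₀ hRp]
  have h6 : l * log ξ.den ≤ (ε * R) * log ξ.den := by
    calc _ ≤ ε * T := h5.trans hM
      _ ≤ ε * (R * log ξ.den) := by gcongr
      _ = _ := by ring
  exact le_of_mul_le_mul_right h6 hlog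

end Rid

namespace Rid

open MvPolynomial

def RothL (n : ℕ) : Prop := ∀ ε : ℝ, 0 < ε → ∃ ω : ℝ, 0 < ω ∧ ∀ (r : Fin n → ℕ) (ξ : Fin n → ℚ) (T M : ℝ)
  (P : MvPolynomial (Fin n) ℚ), (∀ i, 0 < r i) → (∀ i j, i < j → (r i : ℝ) ≤ ω * r j) → 0 < T →
  (∀ i, T ≤ r i * log (ξ i).den) → (∀ i, (r i : ℝ) ≤ ω * T) → P ≠ 0 → Bd r M P → log M ≤ ω * T →
  ∃ Δ, wt r Δ ≤ ε ∧ coeff Δ (tay ξ P) ≠ 0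

lemma rothL_one : RothL 1 := by
  intro ε hε
  refine ⟨ε, hε, fun r ξ T M P hr _ hT hden _ hP hB hM => ?_⟩
  have hr1 : r = fun _ => r 0 := by ext i; rw [Subsingleton.elim i 0]
  have hξ1 : ξ = fun _ => ξ 0 := by ext1 i; rw [Subsingleton.elim i 0]
  rw [hr1] at hB
  obtain ⟨l, h1, h2⟩ := roth1 (hr 0) P hP hB (ξ 0) hT (hden 0) hε hM
  refine ⟨Finsupp.single 0 l, ?_, ?_⟩
  · rw [wt_single]; exact h1
  · rw [hξ1]; exact h2

lemma count_sum {k r0 : ℕ} (hk : 1 ≤ k) (hkr : k ≤ r0 + 1) (hr0 : 0 < r0) {ε1 : ℝ} (h0 : 0 < ε1) (h1 : ε1 ≤ 1) (Γ : Fin k → ℕ)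
    (hΓ : ∀ i, Γ i < k) (hinj : Function.Injective Γ) :
    ε1 ^ 2 * k / 8 ≤ ∑ i, max 0 (ε1 - (Γ i : ℝ) / r0) := by
  have hb : Function.Bijective (fun i => (⟨Γ i, hΓ i⟩ : Fin k)) := by
    rw [Fintype.bijective_iff_injective_and_card]
    exact ⟨fun a b h => hinj (by simpa using h), rfl⟩
  have e1 : ∑ i, max 0 (ε1 - (Γ i : ℝ) / r0) = ∑ i : Fin k, max 0 (ε1 - i / r0) :=
    Function.Bijective.sum_comp hb (fun i : Fin k => max 0 (ε1 - (i : ℝ) / r0))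
  rw [e1, Fin.sum_univ_eq_sum_range (fun i => max 0 (ε1 - i / r0))]
  set c := ⌈ε1 * k / 4⌉₊ with hc
  have hrp : (0:ℝ) < r0 := mod_cast hr0
  have hkr' : (k:ℝ) ≤ 2 * r0 := by
    have : k ≤ 2 * r0 := by omega
    exact_mod_cast this
  have hck : c ≤ k := by
    rw [Nat.ceil_le]; nlinarith
  have h2 : ∑ i ∈ range c, ε1 / 2 ≤ ∑ i ∈ range k, max 0 (ε1 - i / r0) := by
    refine le_trans ?_ (sum_le_sum_of_subset_of_nonneg (range_mono hck) fun _ _ _ => le_max_left _ _)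
    refine sum_le_sum fun i hi => le_trans ?_ (le_max_right _ _)
    have : i < ε1 * k / 4 := Nat.lt_ceil.mp (mem_range.mp hi)
    have h3 : i / r0 ≤ ε1 / 2 := by
      rw [div_le_iff₀ hrp]; nlinarith
    linarith
  refine le_trans ?_ h2
  rw [sum_const, card_range, nsmul_eq_mul]
  have : ε1 * k / 4 ≤ c := Nat.le_ceil _
  nlinarith

lemma wt_cons {n : ℕ} (r : Fin (n + 1) → ℕ) (l : ℕ) (Δ : Fin n →₀ ℕ) :
    wt r (Finsupp.cons l Δ) = l / r 0 + wt (fun i => r i.succ) Δ := by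
  unfold wt
  rw [Fin.sum_univ_succ]
  simp

lemma log_fact_le {k : ℕ} (hk : 1 ≤ k) {r : ℕ} (h : k ≤ r + 1) : log (k.factorial) ≤ k * r := by
  have hk0 : (0:ℝ) < k := mod_cast hk
  have h1 : (k.factorial : ℝ) ≤ k ^ k := mod_cast Nat.factorial_le_pow k
  calc log (k.factorial) ≤ log (k ^ k) := log_le_log (mod_cast k.factorial_pos) h1
    _ = k * log k := by rw [log_pow]
    _ ≤ k * r := by
      gcongr
      have := log_le_sub_one_of_pos hk0
      have h2 : (k:ℝ) ≤ r + 1 := mod_cast h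
      linarith

lemma one_le_of_bd {σ : Type*} [Fintype σ] {r : σ → ℕ} {M : ℝ} {P : MvPolynomial σ ℚ} (hB : Bd r M P) (hP : P ≠ 0) : 1 ≤ M := by
  obtain ⟨e, he⟩ := MvPolynomial.ne_zero_iff.mp hP
  refine le_trans ?_ ((norm_coeff_le P e).trans hB.n1)
  obtain ⟨z, hz⟩ := hB.int e
  rw [hz] at he ⊢
  have : z ≠ 0 := mod_cast he
  rw [← Rat.norm_cast_real]
  simp
  exact_mod_cast Int.one_le_abs this

lemma rothL_step {n : ℕ} [NeZero n] (ih : RothL n) : RothL (n + 1) := by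
  intro ε₀ hε₀
  set ε := min ε₀ 1 with hε
  have hεp : 0 < ε := lt_min hε₀ one_pos
  have hε1 : ε ≤ 1 := min_le_right _ _
  set ε' := ε ^ 2 / 100 with hε'
  have hε'p : 0 < ε' := by positivity
  obtain ⟨ω', hω', IH⟩ := ih ε' hε'p
  set ω := min (min ω' ε') (ε / 2) / (n + 3) with hω
  have hn3 : 0 < n + 3 := by positivity
  have hωp : 0 < ω := by positivity
  have hω0 : (n + 3) * ω = min (min ω' ε') (ε / 2) := by rw [hω]; field_simp
  have hω1 : (n + 3) * ω ≤ ω' := hω0.le.trans ((min_le_left _ _).trans (min_le_left _ _))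
  have hω2 : (n + 3) * ω ≤ ε' := hω0.le.trans ((min_le_left _ _).trans (min_le_right _ _))
  have hω3 : (n + 3) * ω ≤ ε / 2 := hω0.le.trans (min_le_right _ _)
  have hωn : ω ≤ (n + 3) * ω := by nlinarith [show 0 ≤ n from Nat.cast_nonneg n]
  refine ⟨ω, hωp, fun r ξ T M P hr hrr hT hden hrT hP hB hM => ?_⟩
  by_contra hcon
  push Not at hcon
  have hind : IndGE r ε (tay ξ P) := by
    intro Δ hΔ
    by_contra hlt
    push Not at hlt
    exact hΔ (hcon Δ (hlt.le.trans (min_le_left _ _)))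
  obtain ⟨k, hk, φ, ψ, hφ, hψ, hPs⟩ := sep_decomp P (r 0) (fun e he => hB.deg e he 0)
  have hk1 : 1 ≤ k := by
    by_contra hc
    have : k = 0 := by omega
    subst this
    apply hP; rw [hPs]; simp
  obtain ⟨Δ, hΔ, hU⟩ := wronsk MonomialOrder.lex φ hφ
  obtain ⟨Γ, hΓ, hW⟩ := wronsk MonomialOrder.lex ψ hψ
  set U := (Matrix.of fun a j => hs (Δ a) (φ j)).det with hUdef
  set W := (Matrix.of fun a j => hs (Γ a) (ψ j)).det with hWdef
  have hΓ0 : ∀ i, Γ i = Finsupp.single 0 (Γ i 0) := by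
    intro i
    refine Finsupp.ext fun x => ?_
    rw [Subsingleton.elim x 0]; simp
  have hQ : (Matrix.of fun a i => hs (Finsupp.cons (Γ i 0) (Δ a)) P).det = sep U W := by
    rw [hUdef, hWdef, ← sep_det]
    congr 1
    ext1 a i
    simp only [Matrix.of_apply]
    conv_lhs => rw [hPs, map_sum]
    refine sum_congr rfl fun j _ => ?_
    rw [hs_sep, ← hΓ0]
  set MQ : ℝ := k.factorial * (2 ^ (∑ i, r i) * M) ^ k with hMQ
  have hBQ : Bd (fun x => k * r x) MQ (sep U W) := by
    rw [← hQ]; exact Bd.det _ fun a i => hB.hs _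
  have hM1 : 1 ≤ M := one_le_of_bd hB hP
  have hkp : 0 < k := mod_cast hk1
  have hr0p : (0:ℝ) < r 0 := mod_cast hr 0
  have hlogMQ : log MQ ≤ ((n + 3) * ω) * (k * T) := by
    rw [hMQ, log_mul (by positivity) (by positivity), log_pow, log_mul (by positivity) (by positivity),
      log_pow]
    have h1 := log_fact_le hk1 hk
    have h2 : ((∑ i, r i : ℕ) : ℝ) * log 2 ≤ (n + 1) * (ω * T) := by
      have h3 : ((∑ i, r i : ℕ) : ℝ) ≤ (n + 1) * (ω * T) := by
        push_cast
        refine (sum_le_sum fun i _ => hrT i).trans ?_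
        simp
      have h4 : log 2 ≤ 1 := by have := log_two_lt_d9; linarith
      have h5 : 0 ≤ ((∑ i, r i : ℕ) : ℝ) := by positivity
      nlinarith
    have h6 : k * r 0 ≤ k * (ω * T) := by gcongr; exact hrT 0
    have h7 : k * (((∑ i, r i : ℕ) : ℝ) * log 2 + log M) ≤ k * ((n + 1) * (ω * T) + ω * T) := by
      gcongr
    calc _ ≤ k * (ω * T) + k * ((n + 1) * (ω * T) + ω * T) := by linarith
      _ = _ := by ring
  -- U part
  obtain ⟨f, hf⟩ := MvPolynomial.ne_zero_iff.mp hW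
  have hf0 : f = Finsupp.single 0 (f 0) := by
    refine Finsupp.ext fun x => ?_
    rw [Subsingleton.elim x 0]; simp
  obtain ⟨e, he⟩ := MvPolynomial.ne_zero_iff.mp hU
  have hcU : ∀ x, coeff x (coeff f W • U) = coeff (Finsupp.cons (f 0) x) (sep U W) := by
    intro x; rw [coeff_sep, coeff_smul, smul_eq_mul, mul_comm, ← hf0]
  have hcW : ∀ x : Fin 1 →₀ ℕ, coeff x (coeff e U • W) = coeff (Finsupp.cons (x 0) e) (sep U W) := by
    intro x
    have hx0 : x = Finsupp.single 0 (x 0) := by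
      refine Finsupp.ext fun y => ?_
      rw [Subsingleton.elim y 0]; simp
    rw [coeff_sep, coeff_smul, smul_eq_mul, ← hx0]
  have hBU : Bd (fun i => k * r i.succ) MQ (coeff f W • U) := by
    refine ⟨fun x => ?_, fun x hx i => ?_, ?_⟩
    · rw [hcU]; exact hBQ.int _
    · rw [hcU] at hx; simpa using hBQ.deg _ hx i.succ
    · exact (N1_le_of_inj _ _ (fun x => Finsupp.cons (f 0) x) (Finsupp.cons_right_injective _) hcU).trans hBQ.n1
  have hBW : Bd (fun _ => k * r 0) MQ (coeff e U • W) := by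
    refine ⟨fun x => ?_, fun x hx i => ?_, ?_⟩
    · rw [hcW]; exact hBQ.int _
    · rw [hcW] at hx; rw [Subsingleton.elim i 0]; simpa using hBQ.deg _ hx 0
    · refine (N1_le_of_inj _ _ (fun x : Fin 1 →₀ ℕ => Finsupp.cons (x 0) e) ?_ hcW).trans hBQ.n1
      intro x y hxy
      have := DFunLike.congr_fun hxy 0
      simp at this
      refine Finsupp.ext fun z => ?_
      rw [Subsingleton.elim z 0]; exact this
  have hkT : 0 < k * T := by positivity
  obtain ⟨Δ', hw', hc'⟩ := IH (fun i => k * r i.succ) (fun i => ξ i.succ) (k * T) MQ (coeff f W • U)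
    (fun i => Nat.mul_pos hk1 (hr _)) (by
      intro i j hij
      have := hrr i.succ j.succ (Fin.succ_lt_succ_iff.mpr hij)
      push_cast
      have h2 : ω * r j.succ ≤ ω' * r j.succ := by gcongr; linarith
      calc k * r i.succ ≤ k * (ω' * r j.succ) := by gcongr; linarith
        _ = _ := by ring) hkT (by
      intro i
      push_cast
      have := hden i.succ
      rw [mul_assoc]; gcongr) (by
      intro i
      push_cast
      have := hrT i.succ
      calc k * r i.succ ≤ k * (ω * T) := by gcongr
        _ = ω * (k * T) := by ring
        _ ≤ ω' * (k * T) := by gcongr; linarith) (smul_ne_zero hf hU) hBU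
      (hlogMQ.trans (by gcongr))
  obtain ⟨l, hl, hlc⟩ := roth1 (Nat.mul_pos hk1 (hr 0)) (coeff e U • W) (smul_ne_zero he hW) hBW (ξ 0) hkT (by
      push_cast
      have := hden 0
      rw [mul_assoc]; gcongr) hε'p (hlogMQ.trans (by gcongr))
  have hne : coeff (Finsupp.cons l Δ') (tay ξ (sep U W)) ≠ 0 := by
    rw [tay_sep, coeff_sep]
    rw [map_smul, coeff_smul, smul_eq_mul] at hc' hlc
    exact mul_ne_zero (right_ne_zero_of_mul hc') (right_ne_zero_of_mul hlc)
  -- index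
  have hε1p : 0 < ε - ω := by linarith
  have hentry : ∀ a i, IndGE r (max 0 (ε - ω - ((Γ i 0 : ℕ) : ℝ) / r 0)) (tay ξ (hs (Finsupp.cons (Γ i 0) (Δ a)) P)) := by
    intro a i
    rcases le_total 0 (ε - ω - ((Γ i 0 : ℕ) : ℝ) / r 0) with h | h
    · rw [max_eq_right h]
      refine (hind.hs _).mono ?_
      rw [wt_cons]
      have : wt (fun i => r i.succ) (Δ a) ≤ ω := by
        unfold wt
        have h1 : ∀ j, ((Δ a j : ℕ) : ℝ) / r (Fin.succ j) ≤ Δ a j * (ω / r 0) := by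
          intro j
          rw [div_eq_mul_inv]
          gcongr
          have h2 : (0:ℝ) < r (Fin.succ j) := mod_cast hr _
          rw [inv_eq_one_div, div_le_div_iff₀ h2 hr0p, one_mul]
          exact hrr 0 j.succ (Fin.succ_pos j)
        refine (sum_le_sum fun j _ => h1 j).trans ?_
        rw [← sum_mul]
        have h3 : (∑ j, ((Δ a j : ℕ) : ℝ)) ≤ r 0 := by
          have := hΔ a
          have h4 : ∑ j, Δ a j ≤ r 0 := by omega
          exact_mod_cast h4
        calc _ ≤ (r 0 : ℝ) * (ω / r 0) := by gcongr
          _ = ω := by field_simp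
      linarith
    · rw [max_eq_left h]; exact IndGE.of_nonpos r le_rfl _
  have hindQ : IndGE r (∑ i, max 0 (ε - ω - ((Γ i 0 : ℕ) : ℝ) / r 0)) (tay ξ (sep U W)) := by
    rw [← hQ]
    have : tay ξ (Matrix.of fun a i => hs (Finsupp.cons (Γ i 0) (Δ a)) P).det =
      ((tay ξ).toRingHom.mapMatrix (Matrix.of fun a i => hs (Finsupp.cons (Γ i 0) (Δ a)) P)).det := by
        rw [← RingHom.map_det]; rfl
    rw [this]
    exact IndGE.det _ _ hentry
  have hfin := hindQ _ hne
  have hsum := count_sum hk1 hk (hr 0) hε1p (by linarith) (fun i => Γ i 0) (fun i => by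
    have := hΓ i; simpa using this) (by
      intro i j hij
      by_contra hne
      apply hW
      rw [hWdef]
      refine Matrix.det_zero_of_row_eq hne ?_
      ext1 x
      simp only [Matrix.of_apply]
      have hij' : Γ i 0 = Γ j 0 := hij
      rw [hΓ0 i, hΓ0 j, hij'])
  rw [wt_cons] at hfin
  have h1 : wt (fun i => r i.succ) Δ' ≤ k * ε' := by
    have : wt (fun i => r i.succ) Δ' = k * wt (fun i => k * r i.succ) Δ' := by
      unfold wt
      rw [mul_sum]
      refine sum_congr rfl fun i _ => ?_
      have : 0 < r i.succ := mod_cast hr _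
      push_cast
      field_simp
    rw [this]; gcongr
  have h2 : l / r 0 ≤ k * ε' := by
    push_cast at hl
    rw [div_le_iff₀ (by positivity)] at hl ⊢
    linarith
  have h3 : ε / 2 ≤ ε - ω := by linarith
  have h4 : (ε / 2) ^ 2 * k / 8 ≤ (ε - ω) ^ 2 * k / 8 := by gcongr
  have h5 : 0 < ε ^ 2 * k := by positivity
  rw [hε'] at h1 h2
  nlinarith

theorem rothL (n : ℕ) : RothL (n + 1) := by
  induction n with
  | zero => exact rothL_one
  | succ n ih => exact rothL_step ih

end Rid

namespace Rid

open MvPolynomial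

section siegel

attribute [local instance] Matrix.seminormedAddCommGroup

lemma siegel {ι κ : Type*} [Fintype ι] [Fintype κ] (A : ι → κ → ℤ) {X : ℝ} (hX : 1 ≤ X) (hA : ∀ i j, |(A i j : ℝ)| ≤ X)
    (h2 : 2 * Fintype.card ι ≤ Fintype.card κ) (h0 : 0 < Fintype.card ι) :
    ∃ t : κ → ℤ, t ≠ 0 ∧ (∀ i, ∑ j, A i j * t j = 0) ∧ ∀ j, |(t j : ℝ)| ≤ Fintype.card κ * X := by
  obtain ⟨t, ht0, ht, hn⟩ := Int.Matrix.exists_ne_zero_int_vec_norm_le (Matrix.of A) (by omega) h0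
  refine ⟨t, ht0, fun i => congrFun ht i, fun j => ?_⟩
  have h3 : ‖Matrix.of A‖ ≤ X := by
    rw [Matrix.norm_le_iff (by linarith)]
    intro i j
    rw [Int.norm_eq_abs]; exact hA i j
  have hκ : (1:ℝ) ≤ Fintype.card κ := by
    have : 1 ≤ Fintype.card κ := by omega
    exact_mod_cast this
  have hc2 : 2 * (Fintype.card ι : ℝ) ≤ Fintype.card κ := mod_cast h2
  calc |(t j : ℝ)| = ‖t j‖ := (Int.norm_eq_abs _).symm
    _ ≤ ‖t‖ := norm_le_pi_norm t j
    _ ≤ _ := hn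
    _ ≤ ((Fintype.card κ : ℝ) * max 1 ‖Matrix.of A‖) ^ (1 : ℝ) := by
      refine rpow_le_rpow_of_exponent_le ?_ ?_
      · nlinarith [le_max_left 1 ‖Matrix.of A‖]
      · rw [div_le_one (by linarith)]; linarith
    _ ≤ Fintype.card κ * X := by
      rw [rpow_one]; gcongr; exact max_le hX h3

end siegel

lemma chern {m : ℕ} (s : Fin m → Finset ℕ) (x : Fin m → ℕ → ℝ) (hx : ∀ i, ∀ j ∈ s i, |x i j| ≤ 1 / 2)
    (h0 : ∀ i, ∑ j ∈ s i, x i j = 0) {η : ℝ} (hη : 0 < η) (hη1 : η ≤ 1) :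
    (((Fintype.piFinset s).filter (fun f => m * η ≤ ∑ i, x i (f i))).card : ℝ) ≤
      (∏ i, ((s i).card : ℝ)) * exp (-(m * η ^ 2)) := by
  have h1 : ∑ f ∈ Fintype.piFinset s, exp (2 * η * ∑ i, x i (f i)) ≤
      (∏ i, ((s i).card : ℝ)) * exp (m * η ^ 2) := by
    have : ∀ f : Fin m → ℕ, exp (2 * η * ∑ i, x i (f i)) = ∏ i, exp (2 * η * x i (f i)) := by
      intro f; rw [mul_sum, exp_sum]
    simp only [this]
    rw [← prod_univ_sum s (fun i j => exp (2 * η * x i j))]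
    have h2 : exp (m * η ^ 2) = ∏ i : Fin m, exp (η ^ 2) := by
      rw [Finset.prod_const, card_univ, Fintype.card_fin, ← exp_nat_mul]
    rw [h2, ← prod_mul_distrib]
    refine prod_le_prod (fun i _ => sum_nonneg fun _ _ => (exp_pos _).le) fun i _ => ?_
    calc ∑ j ∈ s i, exp (2 * η * x i j) ≤ ∑ j ∈ s i, ((1 + η ^ 2) + 2 * η * x i j) := by
          refine sum_le_sum fun j hj => ?_
          have h3 := hx i j hj
          have h4 : |2 * η * x i j| ≤ η := by
            rw [abs_mul, abs_of_pos (by positivity)]; nlinarith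
          have h5 := abs_exp_sub_one_sub_id_le (h4.trans hη1)
          have h6 := (abs_le.mp h5).2
          have h7 : (2 * η * x i j) ^ 2 ≤ η ^ 2 := by
            rw [← sq_abs]; gcongr
          linarith
      _ = (s i).card * (1 + η ^ 2) := by
          rw [sum_add_distrib, ← mul_sum, h0]; simp; ring
      _ ≤ _ := by
          gcongr
          have := add_one_le_exp (η ^ 2); linarith
  have h2 : (((Fintype.piFinset s).filter (fun f => m * η ≤ ∑ i, x i (f i))).card : ℝ) * exp (2 * η * (m * η)) ≤
      ∑ f ∈ Fintype.piFinset s, exp (2 * η * ∑ i, x i (f i)) := by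
    rw [← nsmul_eq_mul, ← sum_const]
    refine le_trans ?_ (sum_le_sum_of_subset_of_nonneg (Finset.filter_subset (fun f => m * η ≤ ∑ i, x i (f i)) _)
      fun _ _ _ => (exp_pos _).le)
    refine sum_le_sum fun f hf => ?_
    rw [Finset.mem_filter] at hf
    rw [exp_le_exp]
    have := hf.2
    gcongr
  have h3 := h2.trans h1
  have h4 : exp (-(m * η ^ 2)) * exp (2 * η * (m * η)) = exp (m * η ^ 2) := by
    rw [← exp_add]; ring_nf
  refine le_of_mul_le_mul_right (a := exp (2 * η * (m * η))) ?_ (exp_pos _)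
  rw [mul_assoc (∏ i, ((s i).card : ℝ)), h4]; exact h3

lemma alg_pow {α : ℝ} (hα : IsAlgebraic ℚ α) : ∃ (d : ℕ) (C : ℝ), 0 < d ∧ 1 ≤ C ∧ ∀ R : ℕ, ∃ D : ℝ, D ≠ 0 ∧
    ∀ s ≤ R, ∃ z : Fin d → ℤ, (∀ t, |(z t : ℝ)| ≤ C ^ R) ∧ D * α ^ s = ∑ t, (z t : ℝ) * α ^ (t : ℕ) := by
  have h1 : IsAlgebraic ℤ α := (IsFractionRing.isAlgebraic_iff ℤ ℚ ℝ).mpr hα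
  obtain ⟨p, hp, hpα⟩ := h1
  rw [Polynomial.aeval_eq_sum_range, sum_range_succ] at hpα
  have hd : p.natDegree ≠ 0 := by
    intro h
    rw [h] at hpα
    simp at hpα
    rw [Polynomial.eq_C_of_natDegree_eq_zero h, hpα] at hp; simp at hp
  obtain ⟨d, hd'⟩ := Nat.exists_eq_succ_of_ne_zero hd
  set a := p.coeff p.natDegree with ha
  have ha0 : a ≠ 0 := by rw [ha, Polynomial.coeff_natDegree]; exact Polynomial.leadingCoeff_ne_zero.mpr hp
  have hrel : a * α ^ (d + 1) = ∑ t : Fin (d + 1), (-(p.coeff t) : ℝ) * α ^ (t : ℕ) := by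
    rw [Fin.sum_univ_eq_sum_range (fun t => (-(p.coeff t) : ℝ) * α ^ t)]
    rw [hd'] at hpα
    simp only [zsmul_eq_mul, Nat.succ_eq_add_one] at hpα
    simp only [neg_mul, sum_neg_distrib]
    linarith
  set G : ℝ := ∑ t : Fin (d + 1), |(p.coeff t : ℝ)| with hG
  have hG0 : 0 ≤ G := sum_nonneg fun _ _ => abs_nonneg _
  have ha1 : 1 ≤ |(a : ℝ)| := by exact_mod_cast Int.one_le_abs ha0
  set C := |(a : ℝ)| + G with hC
  have key : ∀ s : ℕ, ∃ z : Fin (d + 1) → ℤ, (∀ t, |(z t : ℝ)| ≤ C ^ s) ∧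
      (a : ℝ) ^ s * α ^ s = ∑ t, (z t : ℝ) * α ^ (t : ℕ) := by
    intro s
    induction s with
    | zero =>
      refine ⟨fun t => if t = 0 then 1 else 0, fun t => ?_, ?_⟩
      · dsimp only; split_ifs <;> simp
      · simp
    | succ s ih =>
      obtain ⟨z, hz, hzs⟩ := ih
      refine ⟨fun t => Fin.cases 0 (fun t' => a * z t'.castSucc) t + z (Fin.last d) * (-(p.coeff t)), fun t => ?_, ?_⟩
      · have h2 : |(((Fin.cases 0 (fun t' => a * z t'.castSucc) t : ℤ)) : ℝ)| ≤ |(a : ℝ)| * C ^ s := by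
          refine Fin.cases ?_ (fun t' => ?_) t
          · simp; positivity
          · simp only [Fin.cases_succ]; push_cast; rw [abs_mul]; gcongr; exact hz _
        have h3 : |((p.coeff t : ℤ) : ℝ)| ≤ G :=
          Finset.single_le_sum (f := fun t : Fin (d + 1) => |(p.coeff t : ℝ)|) (fun _ _ => abs_nonneg _) (Finset.mem_univ t)
        push_cast
        refine (abs_add_le _ _).trans ?_
        rw [abs_mul, abs_neg, pow_succ]
        have h4 : |(z (Fin.last d) : ℝ)| * |((p.coeff t : ℤ) : ℝ)| ≤ C ^ s * G := by
          gcongr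
          exact hz _
        calc _ ≤ |(a : ℝ)| * C ^ s + C ^ s * G := add_le_add h2 h4
          _ = _ := by rw [hC]; ring
      · push_cast
        simp only [add_mul, sum_add_distrib, mul_assoc]
        rw [← mul_sum, ← hrel]
        rw [Fin.sum_univ_succ]
        simp only [Fin.cases_zero, Fin.cases_succ, Fin.val_succ]
        rw [Fin.sum_univ_castSucc] at hzs
        have : (a : ℝ) ^ (s + 1) * α ^ (s + 1) = a * α * (a ^ s * α ^ s) := by ring
        rw [this, hzs, mul_add, mul_sum]
        simp only [Fin.val_castSucc, Fin.val_last]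
        push_cast
        have h5 : ∀ i : Fin d, (a : ℝ) * z i.castSucc * α ^ ((i : ℕ) + 1) = a * α * (z i.castSucc * α ^ (i : ℕ)) := by
          intro i; ring
        simp only [h5]
        ring
  refine ⟨d + 1, C, by omega, by linarith, fun R => ⟨(a : ℝ) ^ R, by positivity, fun s hs => ?_⟩⟩
  obtain ⟨z, hz, hzs⟩ := key s
  refine ⟨fun t => a ^ (R - s) * z t, fun t => ?_, ?_⟩
  · push_cast
    rw [abs_mul, abs_pow]
    calc |(a : ℝ)| ^ (R - s) * |(z t : ℝ)| ≤ C ^ (R - s) * C ^ s := by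
          gcongr
          · linarith
          · exact hz t
      _ = C ^ R := by rw [← pow_add]; congr 1; omega
  · push_cast
    simp only [mul_assoc]
    rw [← mul_sum, ← hzs, ← mul_assoc, ← pow_add]
    congr 2; omega

lemma tay_monomial {σ K : Type*} [Fintype σ] [DecidableEq σ] [CommRing K] (ξ : σ → K) (e : σ →₀ ℕ) (c : K) :
    tay ξ (monomial e c) = ∑ f ∈ Fintype.piFinset (fun i => range (e i + 1)),
      monomial (Finsupp.equivFunOnFinite.symm f) (c * ∏ i, (((e i).choose (f i) : K) * ξ i ^ (e i - f i))) := by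
  rw [tay, aeval_monomial, Finsupp.prod_fintype _ _ (by simp)]
  simp only [add_pow]
  rw [prod_univ_sum, algebraMap_eq, mul_sum]
  refine sum_congr rfl fun f _ => ?_
  have : ∀ i, (X i ^ f i * C (ξ i) ^ (e i - f i) * (((e i).choose (f i) : ℕ) : MvPolynomial σ K)) =
     X i ^ f i * C (((e i).choose (f i) : K) * ξ i ^ (e i - f i)) := by
    intro i
    rw [map_mul, map_pow, map_natCast]; ring
  simp only [this]
  rw [prod_mul_distrib, ← map_prod, monomial_eq, Finsupp.prod_fintype _ _ (by simp), map_mul]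
  simp only [Finsupp.equivFunOnFinite_symm_apply_apply]
  ring

lemma eval_hs {σ K : Type*} [Fintype σ] [DecidableEq σ] [CommRing K] (ξ : σ → K) (Δ : σ →₀ ℕ) (P : MvPolynomial σ K) :
    eval ξ (hs Δ P) = (∏ i, ξ i ^ Δ i) * coeff Δ (tay ξ P) := by
  induction P using MvPolynomial.induction_on' with
  | add p q hp hq => rw [map_add, map_add, hp, hq, map_add, coeff_add, mul_add]
  | monomial e c =>
    rw [tay_monomial, coeff_sum, hs, dg_monomial, eval_monomial, Finsupp.prod_fintype _ _ (by simp)]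
    simp only [coeff_monomial]
    by_cases h : ∀ i, Δ i ≤ e i
    · rw [sum_eq_single (Δ : σ → ℕ)]
      · rw [if_pos (by ext; simp)]
        unfold bn
        push_cast
        rw [prod_mul_distrib]
        have : ∏ i, ξ i ^ e i = (∏ i, ξ i ^ Δ i) * ∏ i, ξ i ^ (e i - Δ i) := by
          rw [← prod_mul_distrib]
          exact prod_congr rfl fun i _ => by rw [← pow_add, Nat.add_sub_cancel' (h i)]
        rw [this]; ring
      · intro f _ hf
        rw [if_neg]
        intro h'; apply hf; rw [← h']; ext; simp
      · intro h'
        exfalso; apply h'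
        rw [Fintype.mem_piFinset]
        intro i; rw [mem_range]; have := h i; omega
    · push Not at h
      obtain ⟨i, hi⟩ := h
      have : bn Δ e = 0 := prod_eq_zero (Finset.mem_univ i) (Nat.choose_eq_zero_of_lt hi)
      rw [this, sum_eq_zero]
      · simp
      · intro f hf
        rw [if_neg]
        intro h'
        rw [Fintype.mem_piFinset] at hf
        have := hf i
        rw [mem_range] at this
        have h2 : f i = Δ i := by rw [← h']; simp
        omega

end Rid

namespace Rid

open MvPolynomial

lemma aux_poly {α : ℝ} (hα : IsAlgebraic ℚ α) (hα0 : α ≠ 0) {η : ℝ} (hη : 0 < η) (hη1 : η ≤ 1 / 2) :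
    ∃ (m : ℕ) (C : ℝ), 0 < m ∧ 1 ≤ C ∧ ∀ r : Fin m → ℕ, (∀ i, 0 < r i) → ∃ P : MvPolynomial (Fin m) ℚ, P ≠ 0 ∧
      Bd r (C ^ (∑ i, r i)) P ∧ (∀ e, coeff e P ≠ 0 → wt r e ≤ m * (1 / 2 + η)) ∧
      ∀ Δ, wt r Δ < m * (1 / 2 - η) → coeff Δ (tay (fun _ => α) (map (algebraMap ℚ ℝ) P)) = 0 := by
  classical
  obtain ⟨d, C, hd, hC, hpow⟩ := alg_pow hα
  obtain ⟨m, hm0, hm⟩ : ∃ m : ℕ, 0 < m ∧ d * exp (-(m * η ^ 2)) ≤ 1 / 4 := by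
    have h1 : Filter.Tendsto (fun m : ℕ => d * exp (-(m * η ^ 2))) Filter.atTop (nhds (d * 0)) := by
      refine Filter.Tendsto.const_mul _ (tendsto_exp_neg_atTop_nhds_zero.comp ?_)
      exact tendsto_natCast_atTop_atTop.atTop_mul_const (by positivity)
    rw [mul_zero] at h1
    obtain ⟨m, h2, h3⟩ := ((h1.eventually (ge_mem_nhds (by norm_num : (0:ℝ) < 1 / 4))).and (Filter.eventually_gt_atTop 0)).exists
    exact ⟨m, h3, h2⟩
  refine ⟨m, 8 * C, hm0, by linarith, fun r hr => ?_⟩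
  set S := ∑ i, r i with hS
  obtain ⟨D, hD, hz⟩ := hpow S
  choose! z hzb hz using hz
  set s : Fin m → Finset ℕ := fun i => range (r i + 1) with hs'
  set box := Fintype.piFinset s with hbox
  set V := box.filter (fun f => m * η ≤ ∑ i, (1 / 2 - (f i : ℝ) / r i)) with hV
  set W := box.filter (fun f => m * η ≤ ∑ i, ((f i : ℝ) / r i - 1 / 2)) with hW
  set U := box \ W with hU
  have hr' : ∀ i, (0:ℝ) < r i := fun i => by exact_mod_cast hr i
  have hx1 : ∀ i, ∀ j ∈ s i, |((j : ℝ) / r i - 1 / 2)| ≤ 1 / 2 := by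
    intro i j hj
    have h1 : (j : ℝ) ≤ r i := by
      have := mem_range.mp hj
      exact_mod_cast Nat.lt_succ_iff.mp this
    have h2 : (j : ℝ) / r i ≤ 1 := by rw [div_le_one (hr' i)]; exact h1
    have h3 : 0 ≤ (j : ℝ) / r i := by positivity
    rw [abs_le]; constructor <;> linarith
  have hx0 : ∀ i, ∑ j ∈ s i, ((j : ℝ) / r i - 1 / 2) = 0 := by
    intro i
    rw [sum_sub_distrib, ← sum_div]
    have : ∑ j ∈ range (r i + 1), (j : ℝ) = (r i + 1) * r i / 2 := by
      have := Finset.sum_range_id_mul_two (r i + 1)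
      rw [Nat.add_sub_cancel] at this
      have h2 : (∑ j ∈ range (r i + 1), (j : ℝ)) * 2 = (r i + 1) * r i := by
        have h3 := congrArg (Nat.cast : ℕ → ℝ) this
        push_cast at h3; exact h3
      linarith
    rw [hs']; simp only; rw [this]
    have := hr' i
    simp; field_simp; ring
  have hcs : ∀ i, ((s i).card : ℝ) = r i + 1 := fun i => by simp [hs']
  have hcb : (box.card : ℝ) = ∏ i, ((s i).card : ℝ) := by rw [hbox, Fintype.card_piFinset]; push_cast; rfl
  have hVc := chern s (fun i j => 1 / 2 - (j : ℝ) / r i) (fun i j hj => by rw [abs_sub_comm]; exact hx1 i j hj)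
    (fun i => by
      have := hx0 i
      rw [← neg_eq_zero, ← sum_neg_distrib, ← this]
      exact sum_congr rfl fun _ _ => by ring) hη (by linarith)
  have hWc := chern s (fun i j => (j : ℝ) / r i - 1 / 2) hx1 hx0 hη (by linarith)
  rw [← hcb] at hVc hWc
  change (V.card : ℝ) ≤ _ at hVc
  change (W.card : ℝ) ≤ _ at hWc
  have hUc : (U.card : ℝ) = box.card - W.card := by
    rw [hU, Finset.card_sdiff_of_subset (Finset.filter_subset _ _), Nat.cast_sub (card_le_card (Finset.filter_subset _ _))]
  have hbox0 : (0:ℝ) ≤ box.card := by positivity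
  have hd1 : (1:ℝ) ≤ d := by exact_mod_cast hd
  have hcard : 2 * Fintype.card (V × Fin d) ≤ Fintype.card U := by
    rw [Fintype.card_prod, Fintype.card_coe, Fintype.card_coe, Fintype.card_fin]
    have h1 : (V.card : ℝ) * d ≤ box.card * (1 / 4) := by
      calc (V.card : ℝ) * d ≤ (box.card * exp (-(m * η ^ 2))) * d := by gcongr
        _ = box.card * (d * exp (-(m * η ^ 2))) := by ring
        _ ≤ _ := by gcongr
    have h2 : (W.card : ℝ) ≤ box.card * (1 / 4) := by
      refine hWc.trans ?_
      gcongr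
      have := exp_pos (-(m * η ^ 2))
      nlinarith
    have h3 : (2 * (V.card * d) : ℝ) ≤ U.card := by rw [hUc]; linarith
    exact_mod_cast h3
  have h0V : (0 : Fin m → ℕ) ∈ V := by
    rw [hV, Finset.mem_filter]
    refine ⟨by simp [hbox, hs'], ?_⟩
    simp
    have : (0:ℝ) < m := by exact_mod_cast hm0
    nlinarith
  have hcard0 : 0 < Fintype.card (V × Fin d) := by
    rw [Fintype.card_prod, Fintype.card_coe, Fintype.card_fin]
    exact Nat.mul_pos (Finset.card_pos.mpr ⟨0, h0V⟩) hd
  have hbU : ∀ u ∈ box, ∀ i, u i ≤ r i := by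
    intro u hu i
    have := Fintype.mem_piFinset.mp hu i
    exact Nat.lt_succ_iff.mp (mem_range.mp this)
  have hUb : ∀ u ∈ U, u ∈ box := fun u hu => (Finset.mem_sdiff.mp hu).1
  set eq : (Fin m → ℕ) ≃ (Fin m →₀ ℕ) := Finsupp.equivFunOnFinite.symm with heq
  have heqa : ∀ u i, eq u i = u i := fun u i => rfl
  have hsumle : ∀ u ∈ box, ∑ i, u i ≤ S := fun u hu => sum_le_sum fun i _ => hbU u hu i
  obtain ⟨t, ht0, htz, htb⟩ := siegel (ι := V × Fin d) (κ := U)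
    (fun v u => (bn (eq v.1) (eq u) : ℤ) * z (∑ i, u.1 i) v.2) (X := (2 * C) ^ S)
    (one_le_pow₀ (by linarith)) (by
      intro v u
      push_cast
      rw [abs_mul, mul_pow, Nat.abs_cast]
      gcongr
      · have := bn_le (r := r) (eq v.1) (eq u) (hbU _ (hUb _ u.2))
        exact_mod_cast this
      · exact hzb _ (hsumle _ (hUb _ u.2)) _) hcard hcard0
  have hcU : (Fintype.card U : ℝ) ≤ 2 ^ S := by
    rw [Fintype.card_coe]
    calc (U.card : ℝ) ≤ box.card := by exact_mod_cast card_le_card (Finset.sdiff_subset)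
      _ = ∏ i, ((r i : ℝ) + 1) := by rw [hcb]; exact prod_congr rfl fun i _ => hcs i
      _ ≤ ∏ i, (2:ℝ) ^ r i := by
        refine prod_le_prod (fun i _ => by positivity) fun i _ => ?_
        have : r i + 1 ≤ 2 ^ r i := Nat.lt_two_pow_self
        exact_mod_cast this
      _ = _ := prod_pow_eq_pow_sum _ _ _
  set P : MvPolynomial (Fin m) ℚ := ∑ u : U, monomial (eq u) (t u : ℚ) with hP
  have hco : ∀ u : U, coeff (eq u) P = t u := by
    intro u
    rw [hP, coeff_sum, sum_eq_single u]
    · simp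
    · intro v _ hv
      rw [coeff_monomial, if_neg]
      intro h; exact hv (Subtype.ext (eq.injective h))
    · simp
  have hsup : ∀ e, coeff e P ≠ 0 → ∃ u : U, e = eq u := by
    intro e he
    rw [hP, coeff_sum] at he
    obtain ⟨u, _, hu⟩ := Finset.exists_ne_zero_of_sum_ne_zero he
    rw [coeff_monomial] at hu
    refine ⟨u, ?_⟩
    by_contra h; rw [if_neg (fun h' => h h'.symm)] at hu; exact hu rfl
  have hmap : map (algebraMap ℚ ℝ) P = ∑ u : U, monomial (eq u) (t u : ℝ) := by
    rw [hP, map_sum]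
    exact sum_congr rfl fun u _ => by rw [map_monomial]; simp
  refine ⟨P, ?_, ⟨?_, ?_, ?_⟩, ?_, ?_⟩
  · obtain ⟨u, hu⟩ := Function.ne_iff.mp ht0
    intro h
    have := hco u
    rw [h, coeff_zero] at this
    apply hu; exact_mod_cast this.symm
  · intro e
    by_cases h : coeff e P = 0
    · exact ⟨0, by simp [h]⟩
    · obtain ⟨u, rfl⟩ := hsup e h
      exact ⟨t u, hco u⟩
  · intro e he i
    obtain ⟨u, rfl⟩ := hsup e he
    exact hbU _ (hUb _ u.2) i
  · refine (N1_sum _ _).trans ?_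
    calc ∑ u : U, N1 (monomial (eq u) (t u : ℚ)) ≤ ∑ u : U, (2 : ℝ) ^ S * (2 * C) ^ S := by
          refine sum_le_sum fun u _ => ?_
          rw [N1_monomial]
          have : ‖(t u : ℚ)‖ = |(t u : ℝ)| := by simp [← Rat.norm_cast_real]
          rw [this]
          refine (htb u).trans ?_
          gcongr
      _ = Fintype.card U * ((2 : ℝ) ^ S * (2 * C) ^ S) := by
          rw [sum_const, card_univ, nsmul_eq_mul]
      _ ≤ 2 ^ S * ((2 : ℝ) ^ S * (2 * C) ^ S) := by gcongr
      _ = (8 * C) ^ S := by rw [← mul_pow, ← mul_pow]; ring_nf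
  · intro e he
    obtain ⟨u, rfl⟩ := hsup e he
    have h1 := (Finset.mem_sdiff.mp u.2).2
    rw [hW, Finset.mem_filter] at h1
    have h2 : ¬ (m * η ≤ ∑ i, ((u.1 i : ℝ) / r i - 1 / 2)) := fun h => h1 ⟨hUb _ u.2, h⟩
    rw [not_le, sum_sub_distrib] at h2
    simp at h2
    unfold wt
    simp only [heqa]
    linarith
  · intro Δ hΔ
    have hpr : (∏ i, (fun _ : Fin m => α) i ^ Δ i) ≠ 0 := prod_ne_zero_iff.mpr fun i _ => pow_ne_zero _ hα0
    have h1 := eval_hs (fun _ => α) Δ (map (algebraMap ℚ ℝ) P)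
    suffices h : eval (fun _ => α) (hs Δ (map (algebraMap ℚ ℝ) P)) = 0 by
      rw [h] at h1
      exact (mul_eq_zero.mp h1.symm).resolve_left hpr
    have h2 : eval (fun _ => α) (hs Δ (map (algebraMap ℚ ℝ) P)) =
        ∑ u : U, (bn Δ (eq u) : ℝ) * t u * α ^ (∑ i, u.1 i) := by
      rw [hmap, map_sum, map_sum]
      refine sum_congr rfl fun u _ => ?_
      rw [hs, dg_monomial, eval_monomial, Finsupp.prod_fintype _ _ (by simp)]
      simp only [heqa]
      rw [prod_pow_eq_pow_sum]
    rw [h2]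
    by_cases hb : ∀ i, Δ i ≤ r i
    · have hΔV : (Δ : Fin m → ℕ) ∈ V := by
        rw [hV, Finset.mem_filter]
        refine ⟨?_, ?_⟩
        · rw [hbox, Fintype.mem_piFinset]
          intro i; rw [hs', mem_range]; have := hb i; omega
        · rw [sum_sub_distrib]
          unfold wt at hΔ
          simp
          linarith
      have hΔe : eq (Δ : Fin m → ℕ) = Δ := by ext; rfl
      have h3 : D * ∑ u : U, (bn Δ (eq u) : ℝ) * t u * α ^ (∑ i, u.1 i) = 0 := by
        rw [mul_sum]
        have : ∀ u : U, D * ((bn Δ (eq u) : ℝ) * t u * α ^ (∑ i, u.1 i)) =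
            ∑ τ : Fin d, α ^ (τ : ℕ) * ((bn Δ (eq u) : ℝ) * z (∑ i, u.1 i) τ * t u) := by
          intro u
          have := hz _ (hsumle _ (hUb _ u.2))
          calc _ = (bn Δ (eq u) : ℝ) * t u * (D * α ^ (∑ i, u.1 i)) := by ring
            _ = _ := by
              rw [this, mul_sum]
              exact sum_congr rfl fun _ _ => by ring
        simp only [this]
        rw [sum_comm]
        refine sum_eq_zero fun τ _ => ?_
        rw [← mul_sum]
        have h4 := htz (⟨Δ, hΔV⟩, τ)
        simp only [hΔe] at h4
        have h5 : ∑ u : U, ((bn Δ (eq u) : ℝ) * z (∑ i, u.1 i) τ * t u) = 0 := by exact_mod_cast h4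
        rw [h5, mul_zero]
      exact (mul_eq_zero.mp h3).resolve_left hD
    · push Not at hb
      obtain ⟨i, hi⟩ := hb
      refine sum_eq_zero fun u _ => ?_
      have : bn Δ (eq u) = 0 := prod_eq_zero (Finset.mem_univ i)
        (Nat.choose_eq_zero_of_lt (lt_of_le_of_lt (hbU _ (hUb _ u.2) i) hi))
      rw [this]; simp

end Rid

namespace Rid

open MvPolynomial

lemma hs_map {σ : Type*} [Fintype σ] (Δ : σ →₀ ℕ) (P : MvPolynomial σ ℚ) :
    hs Δ (map (algebraMap ℚ ℝ) P) = map (algebraMap ℚ ℝ) (hs Δ P) := by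
  ext e
  rw [coeff_hs, coeff_map, coeff_map, coeff_hs]; simp

lemma eval_tay {σ : Type*} (a x : σ → ℝ) (P : MvPolynomial σ ℝ) :
    eval (fun i => x i - a i) (tay a P) = eval x P := by
  have : (aeval (fun i => x i - a i)).comp (tay a) = (aeval x : MvPolynomial σ ℝ →ₐ[ℝ] ℝ) := by
    ext i; simp [tay]
  have h := DFunLike.congr_fun this P
  simpa using h

lemma N1_tay {m : ℕ} {r : Fin m → ℕ} (a : ℝ) (P : MvPolynomial (Fin m) ℝ) (hP : DB r P) :
    N1 (tay (fun _ => a) P) ≤ (1 + |a|) ^ (∑ i, r i) * N1 P := by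
  conv_lhs => rw [P.as_sum, map_sum]
  refine (N1_sum _ _).trans ?_
  rw [N1, mul_sum]
  refine sum_le_sum fun e he => ?_
  have hX : ∀ i : Fin m, N1 (X i + C a : MvPolynomial (Fin m) ℝ) ≤ 1 + |a| := by
    intro i
    refine (N1_add _ _).trans ?_
    rw [X, N1_monomial, ← monomial_zero', N1_monomial]; simp
  rw [tay, aeval_monomial, Finsupp.prod_fintype _ _ (by simp), algebraMap_eq]
  refine (N1_mul _ _).trans ?_
  rw [← monomial_zero', N1_monomial, mul_comm]
  gcongr
  refine (N1_prod _ _).trans ?_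
  rw [← prod_pow_eq_pow_sum]
  refine prod_le_prod (fun i _ => N1_nonneg _) fun i _ => ?_
  calc N1 ((X i + C a : MvPolynomial (Fin m) ℝ) ^ e i) = N1 (∏ _j ∈ range (e i), (X i + C a : MvPolynomial (Fin m) ℝ)) := by simp
    _ ≤ ∏ _j ∈ range (e i), N1 (X i + C a : MvPolynomial (Fin m) ℝ) := N1_prod _ _
    _ = N1 (X i + C a : MvPolynomial (Fin m) ℝ) ^ e i := by simp
    _ ≤ (1 + |a|) ^ e i := pow_le_pow_left₀ (N1_nonneg _) (hX i) _
    _ ≤ _ := by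
      refine pow_le_pow_right₀ (by linarith [abs_nonneg a]) ?_
      exact hP e (by simpa using he) i

lemma abs_eval_le {m : ℕ} (y : Fin m → ℝ) (F : MvPolynomial (Fin m) ℝ) {B : ℝ}
    (h : ∀ Δ, coeff Δ F ≠ 0 → ∏ i, |y i| ^ Δ i ≤ B) : |eval y F| ≤ N1 F * B := by
  rw [eval_eq', N1, sum_mul]
  refine (abs_sum_le_sum_abs _ _).trans (sum_le_sum fun e he => ?_)
  rw [abs_mul, Finset.abs_prod, norm_eq_abs]
  gcongr
  simp only [abs_pow]
  exact h e (by simpa using he)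

lemma N1_map {m : ℕ} (P : MvPolynomial (Fin m) ℚ) : N1 (map (algebraMap ℚ ℝ) P) = N1 P := by
  rw [N1_eq (S := P.support) (support_map_subset _ _)]
  refine sum_congr rfl fun e _ => ?_
  rw [← Rat.norm_cast_real]; rfl

lemma eval_lower {m : ℕ} {r h : Fin m → ℕ} (hr : ∀ i, 0 < r i) {b : ℕ} (hb : 2 ≤ b) (p : Fin m → ℤ)
    (F : MvPolynomial (Fin m) ℚ) (hF : ∀ e, ∃ z : ℤ, coeff e F = z) {H θ : ℝ} (hθ : 0 ≤ θ) (hH : 0 ≤ H)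
    (hw : ∀ e, coeff e F ≠ 0 → wt r e ≤ θ) (hrh : ∀ i, (h i * r i : ℝ) ≤ H)
    (hne : eval (fun i => (p i : ℚ) / b ^ h i) F ≠ 0) :
    1 ≤ |((eval (fun i => (p i : ℚ) / b ^ h i) F : ℚ) : ℝ)| * (b : ℝ) ^ (H * θ) := by
  set n := ⌊H * θ⌋₊ with hn
  have hb0 : (b : ℚ) ≠ 0 := by positivity
  have hle : ∀ e, coeff e F ≠ 0 → ∑ i, h i * e i ≤ n := by
    intro e he
    rw [hn]; apply Nat.le_floor
    push_cast
    calc ∑ i, (h i * e i : ℝ) = ∑ i, (h i * r i : ℝ) * ((e i : ℝ) / r i) := by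
          refine sum_congr rfl fun i _ => ?_
          have : (r i : ℝ) ≠ 0 := by have := hr i; positivity
          field_simp
      _ ≤ ∑ i, H * ((e i : ℝ) / r i) := by gcongr; exact hrh _
      _ = H * wt r e := by rw [wt, mul_sum]
      _ ≤ _ := by gcongr; exact hw e he
  have hint : ∃ z : ℤ, (b : ℚ) ^ n * eval (fun i => (p i : ℚ) / b ^ h i) F = z := by
    choose c hc using hF
    refine ⟨∑ e ∈ F.support, b ^ (n - ∑ i, h i * e i) * (c e * ∏ i, p i ^ e i), ?_⟩
    rw [eval_eq', mul_sum]
    push_cast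
    refine sum_congr rfl fun e he => ?_
    have h1 := hle e (by simpa using he)
    rw [hc]
    have h2 : ∏ i, ((p i : ℚ) / b ^ h i) ^ e i = (∏ i, (p i : ℚ) ^ e i) / b ^ (∑ i, h i * e i) := by
      simp only [div_pow, ← pow_mul]
      rw [Finset.prod_div_distrib, prod_pow_eq_pow_sum]
    rw [h2]
    have h3 : (b : ℚ) ^ n = b ^ (n - ∑ i, h i * e i) * b ^ (∑ i, h i * e i) := by rw [← pow_add]; congr 1; omega
    rw [h3]
    field_simp
  obtain ⟨z, hz⟩ := hint
  have hz0 : z ≠ 0 := by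
    intro h0
    rw [h0] at hz
    rw [Int.cast_zero] at hz
    rcases mul_eq_zero.mp hz with h | h
    · exact pow_ne_zero _ hb0 h
    · exact hne h
  have h1 : 1 ≤ |(z : ℝ)| := mod_cast Int.one_le_abs hz0
  have h2 : z = (b : ℝ) ^ n * ((eval (fun i => (p i : ℚ) / b ^ h i) F : ℚ) : ℝ) := by
    exact_mod_cast congrArg (Rat.cast : ℚ → ℝ) hz.symm
  rw [h2, abs_mul, abs_of_pos (by positivity)] at h1
  refine h1.trans ?_
  rw [mul_comm]
  gcongr
  rw [← rpow_natCast]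
  refine rpow_le_rpow_of_exponent_le (mod_cast (by omega : 1 ≤ b)) (Nat.floor_le (by positivity))

lemma den_lower {α : ℝ} (halg : IsAlgebraic ℚ α) (hirr : Irrational α) {b : ℕ} (hb : 2 ≤ b) :
    ∃ (D : ℝ) (H : ℕ), 0 < D ∧ ∀ h : ℕ, H ≤ h → ∀ p : ℤ, |b ^ h * α - p| ≤ 1 →
      (h : ℝ) * log b / D ≤ log ((p : ℚ) / b ^ h : ℚ).den := by
  have h1 := (IsFractionRing.isAlgebraic_iff ℤ ℚ ℝ).mpr halg
  obtain ⟨f, hf, hfα⟩ := h1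
  obtain ⟨A, hA, hL⟩ := Liouville.exists_pos_real_of_irrational_root hirr hf (by
    rw [Polynomial.aeval_def] at hfα; rw [Polynomial.eval_map]; simpa using hfα)
  have hlb : 0 < log b := log_pos (mod_cast (by omega : 1 < b))
  obtain ⟨H, hH⟩ := exists_nat_ge (2 * log A / log b)
  refine ⟨2 * (f.natDegree + 1), H, by positivity, fun h hh p hp => ?_⟩
  set q := ((p : ℚ) / b ^ h : ℚ) with hq
  have hq0 := q.den_pos
  have h2 := hL q.num (q.den - 1)
  have h3 : ((q.den - 1 : ℕ) : ℝ) + 1 = q.den := by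
    have : q.den - 1 + 1 = q.den := by omega
    exact_mod_cast this
  rw [h3] at h2
  have h4 : (q.num : ℝ) / q.den = p / b ^ h := by
    have := Rat.num_div_den q
    have h5 := congrArg (Rat.cast : ℚ → ℝ) this
    push_cast at h5
    rw [h5, hq]; push_cast; rfl
  rw [h4] at h2
  have hbp : (0:ℝ) < b ^ h := by positivity
  have h5 : |α - p / b ^ h| ≤ 1 / b ^ h := by
    have : α - p / b ^ h = (b ^ h * α - p) / b ^ h := by field_simp
    rw [this, abs_div, abs_of_pos hbp]
    gcongr
  have hq1 : (1:ℝ) ≤ q.den := mod_cast hq0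
  have h6 : b ^ h ≤ (q.den : ℝ) ^ (f.natDegree + 1) * A := by
    have h7 : 1 ≤ (q.den : ℝ) ^ (f.natDegree + 1) * (1 / b ^ h * A) := by
      refine h2.trans ?_
      gcongr
      omega
    have : (q.den : ℝ) ^ (f.natDegree + 1) * (1 / b ^ h * A) = (q.den : ℝ) ^ (f.natDegree + 1) * A / b ^ h := by field_simp
    rw [this, le_div_iff₀ hbp] at h7
    linarith
  have h7 := log_le_log hbp h6
  rw [log_mul (by positivity) hA.ne', log_pow, log_pow] at h7
  rw [div_le_iff₀ (by positivity)]
  rw [div_le_iff₀ hlb] at hH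
  have h8 : H * log b ≤ h * log b := by gcongr
  push_cast at h7
  nlinarith

set_option maxHeartbeats 2000000 in
theorem ridout_aux {α : ℝ} (halg : IsAlgebraic ℚ α) (hirr : Irrational α) {b : ℕ} (hb : 2 ≤ b)
    {ε : ℝ} (hε : 0 < ε) (hε1 : ε ≤ 1) :
    ∃ H0 : ℕ, ∀ h ≥ H0, ∀ p : ℤ, (b : ℝ) ^ (-(ε * h)) ≤ |(b : ℝ) ^ h * α - p| := by
  by_contra! hcon
  have hα0 : α ≠ 0 := hirr.ne_zero
  set η := ε / 20 with hη
  have hη0 : 0 < η := by positivity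
  have hη1 : η ≤ 1 / 20 := by rw [hη]; linarith
  obtain ⟨m, C, hm, hC, haux⟩ := aux_poly halg hα0 hη0 (by linarith)
  obtain ⟨n, rfl⟩ : ∃ n, m = n + 1 := ⟨m - 1, by omega⟩
  set m : ℝ := ((n + 1 : ℕ) : ℝ) with hm'
  have hm0 : 0 < m := by positivity
  obtain ⟨ω, hω, hroth⟩ := rothL n (m * η) (by positivity)
  obtain ⟨D, Hd, hD, hden⟩ := den_lower halg hirr hb
  set L := log b with hL
  have hb1 : (1:ℝ) < b := by exact_mod_cast (by omega : 1 < b)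
  have hL0 : 0 < L := log_pos hb1
  set K := max (2 / ω) 1 with hK
  set c := 2 * C * (1 + |α|) with hc
  have hc1 : 1 ≤ c := by
    have := abs_nonneg α
    rw [hc]; nlinarith
  have hlc : 0 ≤ log c := log_nonneg hc1
  have hlC : 0 ≤ log C := log_nonneg hC
  obtain ⟨H0, hH0⟩ := exists_nat_ge (Hd + 1 + 1 / |α| + 2 * D / (ω * L) + 2 * m * log C * D / (ω * L) + 2 * log c / (η * L))
  have t1 : 0 ≤ 1 / |α| := by positivity
  have t2 : 0 ≤ 2 * D / (ω * L) := by positivity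
  have t3 : 0 ≤ 2 * m * log C * D / (ω * L) := by positivity
  have t4 : 0 ≤ 2 * log c / (η * L) := by positivity
  have t5 : 0 ≤ Hd := by positivity
  choose f hfge p hp using hcon
  obtain ⟨g, hg00, hgss⟩ : ∃ g : ℕ → ℕ, g 0 = f H0 ∧ ∀ j, g (j + 1) = f ⌈K * (g j : ℝ)⌉₊ :=
    ⟨fun j => Nat.rec (motive := fun _ => ℕ) (f H0) (fun _ x => f ⌈K * x⌉₊) j, rfl, fun _ => rfl⟩
  have hg0 : H0 ≤ g 0 := hg00 ▸ hfge H0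
  have hgs : ∀ j : ℕ, K * (g j : ℝ) ≤ (g (j + 1) : ℝ) := fun j => by
    have h1 := Nat.le_ceil (K * (g j : ℝ))
    have h2 : ⌈K * (g j : ℝ)⌉₊ ≤ g (j + 1) := hgss j ▸ hfge ⌈K * (g j : ℝ)⌉₊
    exact h1.trans (by exact_mod_cast h2)
  have hK1 : 1 ≤ K := le_max_right _ _
  have hgm : ∀ j, (g j : ℝ) ≤ g (j + 1) := fun j => by
    have := hgs j
    have h0 : 0 ≤ g j := by positivity
    nlinarith
  have hgmono : Monotone g := monotone_nat_of_le_succ fun j => by exact_mod_cast hgm j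
  have hgK : ∀ i j : ℕ, i < j → K * (g i : ℝ) ≤ (g j : ℝ) := fun i j hij => (hgs i).trans (by exact_mod_cast hgmono hij)
  have hgbad : ∀ j, ∃ q : ℤ, |b ^ g j * α - q| < b ^ (-(ε * g j)) := by
    intro j
    cases j with
    | zero => rw [hg00]; exact ⟨_, hp H0⟩
    | succ j => rw [hgss]; exact ⟨_, hp ⌈K * g j⌉₊⟩
  have hgH : ∀ j, (H0 : ℝ) ≤ g j := fun j => by exact_mod_cast hg0.trans (hgmono (Nat.zero_le j))
  choose q hq using hgbad
  set R : ℝ := g (n + 1) / η with hR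
  have hH0p : (0:ℝ) < H0 := by linarith
  have hgpos : ∀ j, (0:ℝ) < g j := fun j => hH0p.trans_le (hgH j)
  have hR0 : 0 < R := by have := hgpos (n + 1); positivity
  let h : Fin (n + 1) → ℕ := fun i => g (i.rev)
  have hhp : ∀ i, (0:ℝ) < h i := fun i => hgpos _
  have hhH : ∀ i, (H0:ℝ) ≤ h i := fun i => hgH _
  have hhR : ∀ i, (h i : ℝ) ≤ η * R := by
    intro i
    have : (h i : ℝ) ≤ g (n + 1) := by exact_mod_cast hgmono (by have := i.rev.2; omega)
    rw [hR]; field_simp; exact this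
  let r : Fin (n + 1) → ℕ := fun i => ⌈R / h i⌉₊
  have hrpos : ∀ i, 0 < r i := fun i => Nat.ceil_pos.mpr (div_pos hR0 (hhp i))
  have hrR : ∀ i, R ≤ h i * r i := by
    intro i
    have := Nat.le_ceil (R / h i)
    rw [div_le_iff₀ (hhp i)] at this
    linarith
  have hrR' : ∀ i, (h i * r i : ℝ) ≤ (1 + η) * R := by
    intro i
    have := (Nat.ceil_lt_add_one (div_pos hR0 (hhp i)).le).le
    have h2 : (r i : ℝ) * h i ≤ (R / h i + 1) * h i := mul_le_mul_of_nonneg_right this (hhp i).le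
    have h3 : (R / h i + 1) * h i = R + h i := by have := hhp i; field_simp
    have := hhR i
    nlinarith
  have hr2 : ∀ i, (r i : ℝ) ≤ 2 * R / h i := by
    intro i
    rw [le_div_iff₀ (hhp i)]
    have := hrR' i
    nlinarith
  have hr3 : ∀ i, (r i : ℝ) ≤ 2 * R / H0 := by
    intro i
    refine (hr2 i).trans ?_
    have := hhH i
    gcongr
  set S := ∑ i, r i with hS
  have hSb : (S : ℝ) ≤ m * (2 * R / H0) := by
    rw [hS]; push_cast
    calc ∑ i, (r i : ℝ) ≤ ∑ _i : Fin (n + 1), 2 * R / H0 := sum_le_sum fun i _ => hr3 i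
      _ = _ := by rw [sum_const, card_univ, Fintype.card_fin, nsmul_eq_mul]
  let ξ : Fin (n + 1) → ℚ := fun i => (q i.rev : ℚ) / b ^ h i
  have hbad : ∀ i, |(b : ℝ) ^ h i * α - q i.rev| < (b : ℝ) ^ (-(ε * h i)) := fun i => hq _
  have hbad1 : ∀ i, |(b : ℝ) ^ h i * α - q i.rev| < 1 := by
    intro i
    refine (hbad i).trans_le (rpow_le_one_of_one_le_of_nonpos hb1.le ?_)
    have := hhp i; nlinarith
  have hξ0 : ∀ i, ξ i ≠ 0 := by
    intro i h0
    have hb0 : ((b : ℚ) ^ h i) ≠ 0 := by positivity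
    have : q i.rev = 0 := by
      rcases div_eq_zero_iff.mp h0 with h1 | h1
      · exact_mod_cast h1
      · exact absurd h1 hb0
    have h2 := hbad1 i
    rw [this] at h2
    rw [Int.cast_zero, sub_zero, abs_mul, abs_of_pos (by positivity)] at h2
    have h3 : (h i : ℝ) < b ^ h i := by exact_mod_cast Nat.lt_pow_self (by omega)
    have h4 := hhH i
    have h5 : 1 / |α| ≤ b ^ h i := by linarith
    rw [div_le_iff₀ (abs_pos.mpr hα0)] at h5
    linarith
  obtain ⟨P, hP0, hPB, hPw, hPi⟩ := haux r hrpos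
  have hlogb : ∀ x : ℝ, log ((b : ℝ) ^ x) = x * L := fun x => log_rpow (by linarith) x
  obtain ⟨Δ, hΔw, hΔ⟩ := hroth r ξ (R * L / D) (C ^ S) P hrpos (by
      intro i j hij
      have h1 : K * h j ≤ h i := hgK _ _ (by exact Fin.rev_lt_rev.mpr hij)
      have h2 : 2 / ω ≤ K := le_max_left _ _
      have h3 : 2 * (h j : ℝ) ≤ ω * h i := by
        have := mul_le_mul_of_nonneg_right h2 (hhp j).le
        have h4 : 2 / ω * h j ≤ h i := this.trans h1
        rw [div_mul_eq_mul_div, div_le_iff₀ hω] at h4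
        linarith
      have h4 := hr2 i
      have h5 := hrR j
      have h6 : (r i : ℝ) * h i ≤ 2 * R := by rwa [le_div_iff₀ (hhp i)] at h4
      have hri : (0:ℝ) ≤ r i := by positivity
      have h7 : (r i : ℝ) * (2 * h j) ≤ r i * (ω * h i) := by gcongr
      have h8 : (r i : ℝ) * h j ≤ ω * r j * h j := by
        have a1 : ω * (r i * h i) ≤ ω * (2 * R) := by gcongr
        have a2 : ω * R ≤ ω * (h j * r j) := by gcongr
        linarith
      exact le_of_mul_le_mul_right h8 (hhp j)) (by positivity) (by
      intro i
      have h1 := hden (h i) (by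
        have := hhH i
        have : (Hd : ℝ) ≤ h i := by linarith
        exact_mod_cast this) (q i.rev) (hbad1 i).le
      have h2 := hrR i
      calc R * L / D ≤ (h i * r i) * L / D := by gcongr
        _ = r i * (h i * L / D) := by ring
        _ ≤ _ := by gcongr) (by
      intro i
      refine (hr3 i).trans ?_
      rw [div_le_iff₀ hH0p]
      have h1 : 2 * D / (ω * L) ≤ H0 := by linarith
      rw [div_le_iff₀ (by positivity)] at h1
      calc 2 * R = R * (2 * D) / D := by field_simp
        _ ≤ R * (H0 * (ω * L)) / D := by gcongr
        _ = _ := by ring) hP0 hPB (by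
      rw [log_pow]
      have h1 : 2 * m * log C * D / (ω * L) ≤ H0 := by linarith
      rw [div_le_iff₀ (by positivity)] at h1
      calc (S : ℝ) * log C ≤ m * (2 * R / H0) * log C := by gcongr
        _ = R * (2 * m * log C * D) / (D * H0) := by field_simp
        _ ≤ R * (H0 * (ω * L)) / (D * H0) := by gcongr
        _ = _ := by field_simp)
  have hev : eval ξ (hs Δ P) ≠ 0 := by
    rw [eval_hs]
    exact mul_ne_zero (prod_ne_zero_iff.mpr fun i _ => pow_ne_zero _ (hξ0 i)) hΔ
  have hFB := hPB.hs Δ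
  have hlow := eval_lower (r := r) (h := h) hrpos hb (fun i => q i.rev) (hs Δ P) hFB.int (H := (1 + η) * R)
    (θ := m * (1 / 2 + η)) (by positivity) (by positivity) (by
      intro e he
      apply hPw
      rw [coeff_hs] at he
      exact right_ne_zero_of_mul he) hrR' hev
  have hind : IndGE r (m * (1 / 2 - η) - wt r Δ) (tay (fun _ => α) (map (algebraMap ℚ ℝ) (hs Δ P))) := by
    rw [← hs_map]
    apply IndGE.hs
    intro Γ hΓ
    by_contra h'
    exact hΓ (hPi Γ (not_le.mp h'))
  have hN : N1 (tay (fun _ => α) (map (algebraMap ℚ ℝ) (hs Δ P))) ≤ c ^ S := by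
    refine (N1_tay (r := r) α _ (by
      intro e he
      apply hFB.deg e
      rw [coeff_map] at he
      intro h0; rw [h0] at he; simp at he)).trans ?_
    rw [N1_map]
    calc _ ≤ (1 + |α|) ^ S * (2 ^ S * C ^ S) := by gcongr; exact hFB.n1
      _ = c ^ S := by rw [← mul_pow, ← mul_pow, hc]; ring
  have hevR : ((eval ξ (hs Δ P) : ℚ) : ℝ) = eval (fun i => (ξ i : ℝ)) (map (algebraMap ℚ ℝ) (hs Δ P)) := by
    rw [eval_map]
    exact eval₂_comp_left (algebraMap ℚ ℝ) (RingHom.id ℚ) ξ (hs Δ P)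
  have hξα : ∀ i, |(ξ i : ℝ) - α| ≤ (b : ℝ) ^ (-((1 + ε) * h i)) := by
    intro i
    have hbp : (0:ℝ) < b ^ h i := by positivity
    have h1 : (ξ i : ℝ) - α = -((b : ℝ) ^ h i * α - q i.rev) / b ^ h i := by
      simp only [ξ]; push_cast; field_simp; ring
    rw [h1, abs_div, abs_neg, abs_of_pos hbp, div_le_iff₀ hbp]
    refine (hbad i).le.trans (le_of_eq ?_)
    rw [← rpow_natCast (b : ℝ) (h i), ← rpow_add (by linarith)]
    congr 1; ring
  have hup : |((eval ξ (hs Δ P) : ℚ) : ℝ)| ≤ c ^ S * (b : ℝ) ^ (-((1 + ε) * (R * (m * (1 / 2 - 2 * η))))) := by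
    rw [hevR, ← eval_tay (fun _ => α)]
    refine (abs_eval_le _ _ (B := (b : ℝ) ^ (-((1 + ε) * (R * (m * (1 / 2 - 2 * η)))))) ?_).trans ?_
    · intro Γ hΓ
      have h1 := hind Γ hΓ
      calc ∏ i, |(ξ i : ℝ) - α| ^ Γ i ≤ ∏ i, ((b : ℝ) ^ (-((1 + ε) * h i))) ^ Γ i := by
            refine prod_le_prod (fun _ _ => by positivity) fun i _ => ?_
            exact pow_le_pow_left₀ (abs_nonneg _) (hξα i) _
        _ = (b : ℝ) ^ (∑ i, -((1 + ε) * h i) * Γ i) := by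
            rw [rpow_sum_of_pos (by linarith)]
            refine prod_congr rfl fun i _ => ?_
            rw [← rpow_natCast, ← rpow_mul (by linarith)]
        _ ≤ _ := by
            refine rpow_le_rpow_of_exponent_le hb1.le ?_
            have h2 : R * wt r Γ ≤ ∑ i, (h i : ℝ) * Γ i := by
              rw [wt, mul_sum]
              refine sum_le_sum fun i _ => ?_
              have hr0 : (0:ℝ) < r i := by exact_mod_cast hrpos i
              rw [mul_div_assoc', div_le_iff₀ hr0]
              have h3 := hrR i
              have h4 : (0:ℝ) ≤ Γ i := by positivity
              nlinarith
            have h3 : ∑ i, -((1 + ε) * h i) * (Γ i : ℝ) = -((1 + ε) * ∑ i, (h i : ℝ) * Γ i) := by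
              rw [mul_sum, ← sum_neg_distrib]
              exact sum_congr rfl fun _ _ => by ring
            rw [h3]
            have h5 : R * (m * (1 / 2 - 2 * η)) ≤ R * wt r Γ := by
              gcongr; linarith
            have h6 := h5.trans h2
            have : (1 + ε) * (R * (m * (1 / 2 - 2 * η))) ≤ (1 + ε) * ∑ i, (h i : ℝ) * Γ i := by gcongr
            linarith
    · gcongr
  have hcS : c ^ S ≤ (b : ℝ) ^ (R * m * η) := by
    rw [← log_le_log_iff (by positivity) (by positivity), hlogb, log_pow]
    have h1 : 2 * log c / (η * L) ≤ H0 := by linarith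
    rw [div_le_iff₀ (by positivity)] at h1
    calc (S : ℝ) * log c ≤ m * (2 * R / H0) * log c := by gcongr
      _ = m * R * (2 * log c) / H0 := by field_simp
      _ ≤ m * R * (H0 * (η * L)) / H0 := by gcongr
      _ = _ := by field_simp
  have hfin : (1:ℝ) ≤ (b : ℝ) ^ (R * m * η + -((1 + ε) * (R * (m * (1 / 2 - 2 * η)))) + (1 + η) * R * (m * (1 / 2 + η))) := by
    rw [rpow_add (by linarith), rpow_add (by linarith)]
    refine hlow.trans ?_
    gcongr
    refine hup.trans ?_
    gcongr
  have hneg : R * m * η + -((1 + ε) * (R * (m * (1 / 2 - 2 * η)))) + (1 + η) * R * (m * (1 / 2 + η)) < 0 := by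
    have he : ε = 20 * η := by rw [hη]; ring
    rw [he]
    have : R * m * η + -((1 + 20 * η) * (R * (m * (1 / 2 - 2 * η)))) + (1 + η) * R * (m * (1 / 2 + η)) =
      R * m * η * (41 * η - 5.5) := by ring
    rw [this]
    have h1 : 0 < R * m * η := by positivity
    nlinarith
  have := rpow_lt_one_of_one_lt_of_neg hb1 hneg
  linarith

theorem ridout {α : ℝ} (halg : IsAlgebraic ℚ α) (hirr : Irrational α) {b : ℕ} (hb : 2 ≤ b)
    {ε : ℝ} (hε : 0 < ε) :
    ∃ H0 : ℕ, ∀ h ≥ H0, ∀ p : ℤ, (b : ℝ) ^ (-(ε * h)) ≤ |(b : ℝ) ^ h * α - p| := by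
  obtain ⟨H0, h0⟩ := ridout_aux halg hirr hb (ε := min ε 1) (by positivity) (min_le_right _ _)
  refine ⟨H0, fun h hh p => le_trans ?_ (h0 h hh p)⟩
  refine rpow_le_rpow_of_exponent_le (mod_cast (by omega : 1 ≤ b)) ?_
  have : min ε 1 * h ≤ ε * h := by gcongr; exact min_le_left _ _
  linarith

end Rid

namespace Rid

open MeasureTheory Filter Topology Set Complex

noncomputable def pf (m : ℕ) (x : ℝ) : ℝ := bernoulliFun m (Int.fract x)

lemma pf_bdd (m : ℕ) : ∃ C : ℝ, 0 < C ∧ ∀ x, |pf m x| ≤ C := by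
  obtain ⟨C, hC⟩ := (isCompact_Icc (a := 0) (b := 1)).exists_bound_of_continuousOn
    (continuous_bernoulliFun (k := m)).continuousOn
  refine ⟨max C 1, by positivity, fun x => le_trans ?_ (le_max_left _ _)⟩
  exact hC _ ⟨Int.fract_nonneg x, (Int.fract_lt_one x).le⟩

lemma pf_meas (m : ℕ) : Measurable (pf m) :=
  (continuous_bernoulliFun (k := m)).measurable.comp measurable_fract

lemma pf_cont {m : ℕ} (hm : m ≠ 1) : Continuous (pf m) := by
  have h := ContinuousOn.comp_fract'' (f := bernoulliFun m)
    (continuous_bernoulliFun (k := m)).continuousOn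
    ((bernoulliFun_endpoints_eq_of_ne_one hm).symm)
  exact h

lemma pf_right (m : ℕ) (x : ℝ) :
    HasDerivWithinAt (pf (m + 1)) ((m + 1) * pf m x) (Ioi x) x := by
  have h1 := (hasDerivAt_bernoulliFun (m + 1) (Int.fract x))
  have h2 : HasDerivAt (fun y : ℝ => bernoulliFun (m + 1) (y - ⌊x⌋)) ((m + 1) * pf m x) x := by
    have := h1.comp_sub_const x (⌊x⌋ : ℝ)
    simpa [pf] using this
  refine (h2.hasDerivWithinAt (s := Ioi x)).congr_of_eventuallyEq ?_ ?_
  · have : Iio ((⌊x⌋ : ℝ) + 1) ∈ 𝓝 x := Iio_mem_nhds (Int.lt_floor_add_one x)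
    filter_upwards [self_mem_nhdsWithin, mem_nhdsWithin_of_mem_nhds this] with y hy hy2
    have : ⌊y⌋ = ⌊x⌋ := by
      rw [Int.floor_eq_iff]
      exact ⟨(Int.floor_le x).trans (le_of_lt hy), hy2⟩
    simp only [pf]; rw [Int.fract, this]
  · simp only [pf]; rw [Int.fract]

lemma pf_int (m : ℕ) (g : ℝ → ℂ) {a X : ℝ} (hg : ContinuousOn g (uIcc a X)) :
    IntervalIntegrable (fun x => (pf m x : ℂ) * g x) volume a X := by
  refine IntervalIntegrable.mul_continuousOn ?_ hg
  obtain ⟨C, hC0, hC⟩ := pf_bdd m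
  refine (intervalIntegrable_const (c := C)).mono_fun
    ((measurable_ofReal.comp (pf_meas m)).aestronglyMeasurable) ?_
  filter_upwards with x
  simpa [abs_of_pos hC0] using hC x

lemma pow_cont {a X : ℝ} (ha : 0 < a) (hX : 0 < X) (w : ℂ) :
    ContinuousOn (fun x : ℝ => (x : ℂ) ^ w) (uIcc a X) := by
  intro x hx
  have hx0 := (lt_min ha hX).trans_le hx.1
  exact ((continuousAt_ofReal_cpow_const x w (Or.inr hx0.ne'))).continuousWithinAt

lemma pf_ibp (m : ℕ) (hm : m ≠ 0) {a X : ℝ} (ha : 0 < a) (hX : 0 < X) (w : ℂ) :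
    w * ∫ x in a..X, (pf (m + 1) x : ℂ) * (x : ℂ) ^ (-w - 1) =
      pf (m + 1) a * (a : ℂ) ^ (-w) - pf (m + 1) X * (X : ℂ) ^ (-w)
        + (m + 1) * ∫ x in a..X, (pf m x : ℂ) * (x : ℂ) ^ (-w) := by
  have key := integral_mul_deriv_eq_deriv_mul_of_hasDeriv_right
    (u := fun x : ℝ => (pf (m + 1) x : ℂ)) (u' := fun x => (m + 1) * (pf m x : ℂ))
    (v := fun x : ℝ => x ^ (-w)) (v' := fun x : ℝ => -w * x ^ (-w - 1)) (a := a) (b := X)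
    ((continuous_ofReal.comp (pf_cont (by omega))).continuousOn) (pow_cont ha hX _)
    (fun x _ => by
      have := (pf_right m x).ofReal_comp
      simpa using this)
    (fun x hx => by
      have hx0 := (lt_min ha hX).trans hx.1
      by_cases hw : w = 0
      · subst hw; simp; exact hasDerivWithinAt_const _ _ _
      exact (hasDerivAt_ofReal_cpow_const (x := x) hx0.ne' (r := -w) (neg_ne_zero.2 hw)).hasDerivWithinAt)
    (by
      have := (pf_int m (fun _ => 1) (a := a) (X := X) continuousOn_const).const_mul (m + 1)
      simpa using this)
    ((continuousOn_const.mul (pow_cont ha hX _)).intervalIntegrable)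
  have e1 : ∫ x in a..X, (pf (m + 1) x : ℂ) * (-w * x ^ (-w - 1)) =
      -(w * ∫ x in a..X, (pf (m + 1) x : ℂ) * x ^ (-w - 1)) := by
    rw [← intervalIntegral.integral_const_mul, ← intervalIntegral.integral_neg]
    congr 1; ext x; ring
  have e2 : ∫ x in a..X, (m + 1) * (pf m x : ℂ) * x ^ (-w) =
      (m + 1) * ∫ x in a..X, (pf m x : ℂ) * x ^ (-w) := by
    rw [← intervalIntegral.integral_const_mul]
    congr 1; ext x; ring
  rw [e1, e2] at key
  linear_combination -key

noncomputable def Rr (a : ℝ) (m : ℕ) (w : ℂ) : ℂ :=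
  ∑ j ∈ range (m + 1), ((Polynomial.bernoulli m).coeff j : ℂ) * (a : ℂ) ^ ((j : ℂ) - w) / (w - j)

noncomputable def Ik (m : ℕ) (w : ℂ) : ℂ :=
  (m.factorial : ℂ) * riemannZeta (w - m + 1) / ∏ j ∈ range m, (w - j)

lemma bern_deg (m : ℕ) : (Polynomial.bernoulli m).natDegree ≤ m := by
  rw [Polynomial.bernoulli_def]
  refine Polynomial.natDegree_sum_le_of_forall_le _ _ fun i hi => ?_
  refine (Polynomial.natDegree_monomial_le _).trans (by simp at hi; omega)

lemma bern_coeff (m j : ℕ) : ((Polynomial.bernoulli (m + 1)).coeff (j + 1)) * (j + 1) =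
    (m + 1) * (Polynomial.bernoulli m).coeff j := by
  have := congrArg (fun p => Polynomial.coeff p j) (Polynomial.derivative_bernoulli_add_one m)
  simp only [Polynomial.coeff_derivative] at this
  rw [this]
  have : ((m : Polynomial ℚ) + 1) = Polynomial.C ((m : ℚ) + 1) := by simp
  rw [this, Polynomial.coeff_C_mul]

lemma Rr_rec {a : ℝ} (ha : 0 < a) (m : ℕ) {w : ℂ} (hw : ∀ j ∈ range (m + 2), w ≠ j) :
    w * Rr a (m + 1) w = bernoulliFun (m + 1) a * (a : ℂ) ^ (-w) + (m + 1) * Rr a m (w - 1) := by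
  have hac : (a : ℂ) ≠ 0 := mod_cast ha.ne'
  have e0 : w * Rr a (m + 1) w = ∑ j ∈ range (m + 2),
      (((Polynomial.bernoulli (m+1)).coeff j : ℂ) * a ^ (j - w) +
      (((Polynomial.bernoulli (m+1)).coeff j : ℂ) * j) * a ^ (j - w) / (w - j)) := by
    rw [Rr, mul_sum]
    refine sum_congr rfl fun j hj => ?_
    have : w - j ≠ 0 := sub_ne_zero.2 (hw j hj)
    field
  rw [e0, sum_add_distrib]
  congr 1
  · rw [bernoulliFun, Polynomial.eval_map_algebraMap, Polynomial.aeval_eq_sum_range' (n := m + 2) (by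
      have := bern_deg (m + 1); omega)]
    push_cast
    rw [sum_mul]
    refine sum_congr rfl fun j hj => ?_
    rw [sub_eq_add_neg, cpow_add _ _ hac, Complex.cpow_natCast, Algebra.smul_def]
    push_cast
    simp
    ring
  · rw [Finset.sum_range_succ']
    simp
    rw [Rr, mul_sum]
    refine sum_congr rfl fun j hj => ?_
    have := bern_coeff m j
    have h2 : ((Polynomial.bernoulli (m + 1)).coeff (j + 1) : ℂ) * (j + 1) =
      (m + 1) * ((Polynomial.bernoulli m).coeff j : ℂ) := mod_cast congrArg (Rat.cast : ℚ → ℂ) this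
    push_cast
    rw [h2]
    have e1 : j + 1 - w = j - (w - 1) := by ring
    have e2 : w - (j + 1) = (w - 1) - j := by ring
    rw [e1, e2]; ring

lemma Ik_rec (m : ℕ) {w : ℂ} (hw : w ≠ 0) : w * Ik (m + 1) w = (m + 1) * Ik m (w - 1) := by
  simp only [Ik]
  rw [Finset.prod_range_succ', Nat.factorial_succ]
  have : w - ((m + 1 : ℕ) : ℂ) + 1 = w - 1 - m + 1 := by push_cast; ring
  rw [this]
  have : ∏ k ∈ range m, (w - ((k + 1 : ℕ) : ℂ)) = ∏ k ∈ range m, (w - 1 - k) := by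
    refine prod_congr rfl fun k _ => ?_
    push_cast; ring
  rw [this]
  push_cast
  simp only [sub_zero]
  by_cases h : ∏ k ∈ range m, (w - 1 - k) = 0
  · simp [h]
  field_simp

def CC (a : ℝ) (m : ℕ) (w : ℂ) : Prop :=
  Tendsto (fun X : ℝ => ∫ x in a..X, (pf m x : ℂ) * (x : ℂ) ^ (-w - 1)) atTop (𝓝 (Rr a m w - Ik m w))

lemma bdry (m : ℕ) {w : ℂ} (hw : 0 < w.re) :
    Tendsto (fun X : ℝ => (pf m X : ℂ) * (X : ℂ) ^ (-w)) atTop (𝓝 0) := by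
  obtain ⟨C, hC0, hC⟩ := pf_bdd m
  have h1 : Tendsto (fun X : ℝ => C * X ^ (-w.re)) atTop (𝓝 (C * 0)) :=
    (tendsto_rpow_neg_atTop hw).const_mul C
  rw [mul_zero] at h1
  refine squeeze_zero_norm' ?_ h1
  filter_upwards [eventually_gt_atTop 0] with X hX
  rw [norm_mul, Complex.norm_cpow_eq_rpow_re_of_pos hX, Complex.neg_re]
  gcongr
  simpa using hC X

lemma pf_lt_one (m : ℕ) {a : ℝ} (ha : 0 < a) (ha1 : a < 1) : pf m a = bernoulliFun m a := by
  rw [pf, Int.fract_eq_self.2 ⟨ha.le, ha1⟩]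

lemma CC_up {a : ℝ} (ha : 0 < a) (ha1 : a < 1) (m : ℕ) (hm : m ≠ 0) {w : ℂ} (hw : 0 < w.re)
    (hwj : ∀ j ∈ range (m + 2), w ≠ j) (h : CC a m (w - 1)) : CC a (m + 1) w := by
  have hw0 : w ≠ 0 := by intro h; simp [h] at hw
  have h1 := ((tendsto_const_nhds (x := (pf (m + 1) a : ℂ) * a ^ (-w))).sub (bdry (m + 1) hw)).add
    (h.const_mul ((m : ℂ) + 1))
  have h2 := h1.const_mul w⁻¹
  refine (h2.congr' ?_).trans (le_of_eq ?_)
  · filter_upwards [eventually_gt_atTop 0] with X hX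
    have := pf_ibp m hm ha hX w
    have e : -(w - 1) - 1 = -w := by ring
    rw [e, ← this]
    field_simp
  · congr 1
    rw [pf_lt_one _ ha ha1]
    have e1 := Rr_rec ha m hwj
    have e2 := Ik_rec m hw0
    field_simp
    linear_combination e2 - e1

lemma CC_down {a : ℝ} (ha : 0 < a) (ha1 : a < 1) (m : ℕ) (hm : m ≠ 0) {w : ℂ} (hw : 0 < w.re)
    (hwj : ∀ j ∈ range (m + 2), w ≠ j) (h : CC a (m + 1) w) : CC a m (w - 1) := by
  have hw0 : w ≠ 0 := by intro h; simp [h] at hw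
  have h1 := ((h.const_mul w).sub (tendsto_const_nhds (x := (pf (m + 1) a : ℂ) * a ^ (-w)))).add
    (bdry (m + 1) hw)
  have h2 := h1.const_mul ((m : ℂ) + 1)⁻¹
  refine (h2.congr' ?_).trans (le_of_eq ?_)
  · filter_upwards [eventually_gt_atTop 0] with X hX
    have := pf_ibp m hm ha hX w
    have e : -(w - 1) - 1 = -w := by ring
    rw [e, this]
    field
  · congr 1
    rw [pf_lt_one _ ha ha1]
    have e1 := Rr_rec ha m hwj
    have e2 := Ik_rec m hw0
    field_simp
    linear_combination e1 - e2

end Rid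

namespace Rid

open MeasureTheory Filter Topology Set Complex

lemma pf_intOn (m : ℕ) {a : ℝ} (ha : 0 < a) {w : ℂ} (hw : 0 < w.re) :
    IntegrableOn (fun x : ℝ => (pf m x : ℂ) * (x : ℂ) ^ (-w - 1)) (Ioi a) := by
  obtain ⟨C, hC0, hC⟩ := pf_bdd m
  have h := integrableOn_Ioi_cpow_of_lt (a := -w - 1) (by simp; linarith) ha
  refine Integrable.bdd_mul (c := C) h
    ((measurable_ofReal.comp (pf_meas m)).aestronglyMeasurable) ?_
  filter_upwards with x
  simpa using hC x

noncomputable def Psi (a : ℝ) (m : ℕ) (w : ℂ) : ℂ :=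
  ∫ x in Ioi a, (pf m x : ℂ) * (x : ℂ) ^ (-w - 1)

lemma CC_iff (m : ℕ) {a : ℝ} (ha : 0 < a) {w : ℂ} (hw : 0 < w.re) :
    CC a m w ↔ Psi a m w = Rr a m w - Ik m w := by
  have h := intervalIntegral_tendsto_integral_Ioi a (pf_intOn m ha hw) tendsto_id
  constructor
  · intro h2; exact tendsto_nhds_unique h h2
  · intro h2; unfold CC; rw [← h2]; exact h

lemma zeta_floor {w : ℂ} (hw : 1 < w.re) :
    riemannZeta w = w * ∫ t in Ioi (1:ℝ), ((⌊t⌋ : ℤ) : ℂ) * (t : ℂ) ^ (-w - 1) := by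
  rw [← LSeries_one_eq_riemannZeta hw]
  have := LSeries_eq_mul_integral_of_nonneg (fun _ => 1) (r := 1) (by norm_num) (s := w) hw (by
    simpa using Asymptotics.isBigO_refl (fun n : ℕ => (n : ℝ)) atTop) (fun _ => by norm_num)
  have e : LSeries (1 : ℕ → ℂ) w = LSeries (fun n => (((fun _ => 1) n : ℝ) : ℂ)) w := by
    congr 1
  rw [e, this]
  congr 1
  refine setIntegral_congr_fun measurableSet_Ioi fun t ht => ?_
  have ht0 : 0 ≤ t := le_of_lt (lt_trans one_pos ht)
  have h1 : ((⌊t⌋₊ : ℕ) : ℂ) = ((⌊t⌋ : ℤ) : ℂ) := by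
    rw [← Int.natCast_floor_eq_floor ht0]; simp
  simp only [sum_const, Nat.card_Icc, nsmul_eq_mul]
  simp only [add_tsub_cancel_right, ofReal_one, mul_one]
  rw [h1, neg_add']

lemma CC_one {a : ℝ} (ha : 0 < a) (ha1 : a < 1) {w : ℂ} (hw : 1 < w.re) : CC a 1 w := by
  have hw0 : w ≠ 0 := by intro h; simp [h] at hw; linarith
  have hw1 : w - 1 ≠ 0 := by intro h; rw [sub_eq_zero] at h; simp [h] at hw
  rw [CC_iff 1 ha (by linarith)]
  have i0 := integrableOn_Ioi_cpow_of_lt (a := -w - 1) (by simp; linarith) ha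
  have i1 := integrableOn_Ioi_cpow_of_lt (a := -w) (by simp; linarith) ha
  have v0 := integral_Ioi_cpow_of_lt (a := -w - 1) (by simp; linarith) ha
  have v1 := integral_Ioi_cpow_of_lt (a := -w) (by simp; linarith) ha
  have ip := pf_intOn 1 ha (w := w) (by linarith)
  have efl : ∀ x ∈ Ioi a, ((⌊x⌋ : ℤ) : ℂ) * (x : ℂ) ^ (-w - 1) =
      (x : ℂ) ^ (-w) - 1 / 2 * (x : ℂ) ^ (-w - 1) - (pf 1 x : ℂ) * (x : ℂ) ^ (-w - 1) := by
    intro x hx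
    have hx0 : (x : ℂ) ≠ 0 := by exact_mod_cast (ha.trans hx).ne'
    have : (x : ℂ) ^ (-w) = (x : ℂ) ^ (-w - 1) * x := by
      rw [show -w = (-w - 1) + 1 by ring, cpow_add _ _ hx0, cpow_one]; ring_nf
    rw [this, pf, bernoulliFun_one, Int.fract]
    push_cast; ring
  have hfl : ∫ x in Ioi a, ((⌊x⌋ : ℤ) : ℂ) * (x : ℂ) ^ (-w - 1) =
      ∫ x in Ioi (1:ℝ), ((⌊x⌋ : ℤ) : ℂ) * (x : ℂ) ^ (-w - 1) := by
    rw [← integral_Ici_eq_integral_Ioi (x := (1:ℝ))]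
    refine setIntegral_eq_of_subset_of_forall_diff_eq_zero measurableSet_Ioi
      (fun x hx => lt_of_lt_of_le ha1 hx) fun x hx => ?_
    have : ⌊x⌋ = 0 := by
      rw [Int.floor_eq_zero_iff]
      exact ⟨(ha.trans hx.1).le, not_le.1 hx.2⟩
    simp [this]
  have hz := zeta_floor hw
  rw [← hfl, setIntegral_congr_fun measurableSet_Ioi efl,
    integral_sub (f := fun x : ℝ => (x : ℂ) ^ (-w) - 1 / 2 * (x : ℂ) ^ (-w - 1)) (i1.sub (i0.const_mul _)) ip, integral_sub i1 (i0.const_mul _),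
    MeasureTheory.integral_const_mul, v0, v1] at hz
  have hI : Ik 1 w = riemannZeta w / w := by simp [Ik]
  have hR : Rr a 1 w = -(1/2) * (a : ℂ) ^ (-w) / w + (a : ℂ) ^ (1 - w) / (w - 1) := by
    have b1 : (Polynomial.bernoulli 1) = Polynomial.X - Polynomial.C (1/2) := by
      simp [Polynomial.bernoulli_def, Finset.sum_range_succ]
      rw [sub_eq_add_neg, ← Polynomial.C_neg, ← Polynomial.C_mul_X_eq_monomial]
      simp [bernoulli_one]; norm_num [Polynomial.monomial_zero_left]
      ring
    simp only [Rr, b1, Finset.sum_range_succ, Finset.sum_range_zero]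
    simp [Polynomial.coeff_X, Polynomial.coeff_C]
  rw [hI, hR, hz, Psi]
  have e1 : -w - 1 + 1 = -w := by ring
  have e2 : -w + 1 = 1 - w := by ring
  rw [e1, e2]
  have hw2 : 1 - w ≠ 0 := by intro h; apply hw1; linear_combination -h
  rw [mul_div_cancel_left₀ _ hw0]
  have e3 : (a : ℂ) ^ (1 - w) / (w - 1) = - (a : ℂ) ^ (1 - w) / (1 - w) := by
    rw [← neg_sub w 1, div_neg, neg_div, neg_neg]
  rw [e3]
  field_simp
  ring

lemma CC_big {a : ℝ} (ha : 0 < a) (ha1 : a < 1) (m : ℕ) : ∀ {w : ℂ}, (m : ℝ) + 1 < w.re →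
    CC a (m + 1) w := by
  induction m with
  | zero => intro w hw; exact CC_one ha ha1 (by simpa using hw)
  | succ m ih =>
    intro w hw
    push_cast at hw
    refine CC_up ha ha1 (m + 1) (by omega) (by have : 0 ≤ m := Nat.cast_nonneg m; linarith) ?_ (ih (by simp; linarith))
    intro j hj h
    rw [h] at hw
    simp at hw hj
    have : (j : ℝ) ≤ m + 2 := mod_cast (by omega)
    linarith

lemma Psi_diff {a : ℝ} (ha : 0 < a) (m : ℕ) {w : ℂ} (hw : 0 < w.re) :
    DifferentiableAt ℂ (Psi a m) w := by
  have e : Psi a m = fun w => mellin ((Ioi a).indicator (fun x => (pf m x : ℂ))) (-w) := by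
    ext w
    rw [Psi, mellin, ← integral_indicator measurableSet_Ioi, ← integral_indicator measurableSet_Ioi]
    congr 1; ext x
    by_cases hx : x ∈ Ioi a
    · rw [indicator_of_mem hx, indicator_of_mem (show x ∈ Ioi 0 from ha.trans hx),
        indicator_of_mem hx, smul_eq_mul, mul_comm]
    · rw [indicator_of_notMem hx]
      simp only [indicator, hx, if_false, smul_zero, ite_self]
  rw [e]
  obtain ⟨C, hC0, hC⟩ := pf_bdd m
  have hb : ∀ x, ‖(Ioi a).indicator (fun x => (pf m x : ℂ)) x‖ ≤ C := by
    intro x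
    refine (norm_indicator_le_norm_self _ _).trans ?_
    simpa using hC x
  have hd := mellin_differentiableAt_of_isBigO_rpow (a := 0) (b := -w.re - 1) (s := -w)
    (f := (Ioi a).indicator (fun x => (pf m x : ℂ))) (by
      refine LocallyIntegrable.locallyIntegrableOn ?_ _
      refine (locallyIntegrable_const C).mono ?_ ?_
      · exact ((measurable_ofReal.comp (pf_meas m)).indicator measurableSet_Ioi).aestronglyMeasurable
      · filter_upwards with x
        simpa [abs_of_pos hC0] using hb x) (by
      refine Asymptotics.IsBigO.of_bound C ?_
      filter_upwards with x
      simpa using hb x) (by simpa using hw) (by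
      refine Asymptotics.IsBigO.of_bound 0 ?_
      filter_upwards [mem_nhdsWithin_of_mem_nhds (Iio_mem_nhds ha)] with x hx
      rw [indicator_of_notMem (by simpa using le_of_lt hx)]; simp) (by simp)
  exact DifferentiableAt.fun_comp' w hd differentiableAt_id.neg

noncomputable def zz : ℂ → ℂ := Function.update (fun z => (z - 1) * riemannZeta z) 1 1

lemma zz_diff : Differentiable ℂ zz := by
  rw [← differentiableOn_univ]
  have : DifferentiableOn ℂ zz (univ \ {1}) := by
    intro z hz
    have hz1 : z ≠ 1 := by simpa using hz
    refine DifferentiableAt.differentiableWithinAt ?_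
    have h2 : DifferentiableAt ℂ (fun z => (z - 1) * riemannZeta z) z :=
      (differentiableAt_id.sub_const 1).mul (differentiableAt_riemannZeta hz1)
    refine h2.congr_of_eventuallyEq ?_
    filter_upwards [isOpen_ne.mem_nhds hz1] with y hy
    exact Function.update_of_ne hy _ _
  refine (differentiableOn_compl_singleton_and_continuousAt_iff (c := 1) univ_mem).1 ⟨this, ?_⟩
  rw [zz, continuousAt_update_same]
  exact riemannZeta_residue_one

lemma CC_all {a : ℝ} (ha : 0 < a) (ha1 : a < 1) (m : ℕ) {w : ℂ} (hw : 0 < w.re)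
    (hwj : ∀ j ∈ range (m + 2), w ≠ j) : CC a (m + 1) w := by
  have hac : (a : ℂ) ≠ 0 := mod_cast ha.ne'
  rw [CC_iff _ ha hw]
  set A : ℂ → ℂ := fun w => ((m+1).factorial : ℂ) * zz (w - (m + 1 : ℕ) + 1) with hA
  set B : ℂ → ℂ := fun w => ∑ j ∈ range (m + 2), ((Polynomial.bernoulli (m+1)).coeff j : ℂ) *
      a ^ (j - w) * (∏ i ∈ (range (m + 2)).erase j, (w - i))
      - (∏ i ∈ range (m + 2), (w - i)) * Psi a (m + 1) w with hB
  have hU : IsOpen {w : ℂ | 0 < w.re} := isOpen_lt continuous_const continuous_re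
  have hUc : IsPreconnected {w : ℂ | 0 < w.re} := (convex_halfSpace_re_gt 0).isPreconnected
  have hAd : DifferentiableOn ℂ A {w : ℂ | 0 < w.re} := by
    refine Differentiable.differentiableOn ?_
    refine Differentiable.const_mul ?_ _
    exact zz_diff.comp ((differentiable_id.sub_const _).add_const _)
  have hBd : DifferentiableOn ℂ B {w : ℂ | 0 < w.re} := by
    intro w hw
    refine DifferentiableAt.differentiableWithinAt ?_
    have hpr : ∀ s : Finset ℕ, DifferentiableAt ℂ (fun w : ℂ => ∏ i ∈ s, (w - i)) w := by
      intro s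
      refine DifferentiableAt.fun_finset_prod fun i _ => differentiableAt_id.sub_const _
    refine DifferentiableAt.sub ?_ ((hpr _).mul (Psi_diff ha _ hw))
    refine DifferentiableAt.fun_sum fun j _ => ?_
    refine DifferentiableAt.mul (DifferentiableAt.const_mul ?_ _) (hpr _)
    exact DifferentiableAt.const_cpow ((differentiableAt_const _).sub differentiableAt_id) (Or.inl hac)
  -- relation between forms
  have hAI : ∀ w : ℂ, (∀ j ∈ range (m + 2), w ≠ j) →
      A w = (∏ i ∈ range (m + 2), (w - i)) * Ik (m + 1) w := by
    intro w hwj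
    have h1 : w - (m + 1 : ℕ) + 1 ≠ 1 := by
      intro h; apply hwj (m + 1) (by simp); linear_combination h
    have h2 : ∏ i ∈ range (m + 1), (w - i) ≠ 0 := by
      rw [prod_ne_zero_iff]
      intro i hi
      exact sub_ne_zero.2 (hwj i (by simp at hi ⊢; omega))
    simp only [hA, zz, Ik]
    rw [Function.update_of_ne h1, prod_range_succ]
    field_simp
    ring
  have hBR : ∀ w : ℂ, (∀ j ∈ range (m + 2), w ≠ j) →
      B w = (∏ i ∈ range (m + 2), (w - i)) * (Rr a (m + 1) w - Psi a (m + 1) w) := by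
    intro w hwj
    simp only [hB, Rr]
    rw [mul_sub, mul_sum]
    congr 1
    refine sum_congr rfl fun j hj => ?_
    rw [← Finset.mul_prod_erase _ _ hj]
    have : w - j ≠ 0 := sub_ne_zero.2 (hwj j hj)
    field_simp
  have hev : A =ᶠ[𝓝 ((m : ℂ) + 3)] B := by
    have : {w : ℂ | m + 2 < w.re} ∈ 𝓝 ((m : ℂ) + 3) := by
      refine (isOpen_lt continuous_const continuous_re).mem_nhds ?_
      simp; norm_num
    filter_upwards [this] with w hw
    have hw' : m + 2 < w.re := hw
    have hwj : ∀ j ∈ range (m + 2), w ≠ j := by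
      intro j hj h
      rw [h] at hw'
      simp at hw' hj
      have : (j : ℝ) ≤ m + 2 := mod_cast (by omega)
      linarith
    rw [hAI w hwj, hBR w hwj]
    have hmm : 0 ≤ m := Nat.cast_nonneg m
    rw [(CC_iff (m+1) ha (by linarith)).1 (CC_big ha ha1 m (by linarith))]
    ring
  have heq := (hAd.analyticOnNhd hU).eqOn_of_preconnected_of_eventuallyEq (hBd.analyticOnNhd hU) hUc
    (z₀ := m + 3) (by simp; positivity) hev hw
  rw [hAI w hwj, hBR w hwj] at heq
  have hp : ∏ i ∈ range (m + 2), (w - i) ≠ 0 := by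
    rw [prod_ne_zero_iff]
    intro i hi
    exact sub_ne_zero.2 (hwj i hi)
  have := mul_left_cancel₀ hp heq
  rw [this]; ring

lemma CC_imag {a : ℝ} (ha : 0 < a) (ha1 : a < 1) (k : ℕ) {s : ℂ} (hs : s.re = 0) (hs0 : s ≠ 0) :
    CC a (k + 1) s := by
  have him := fun h => hs0 (ext hs h)
  have hj : ∀ n : ℕ, ∀ j ∈ range n, s + 1 ≠ j := by
    intro n j _ h
    have := congrArg Complex.im h
    simp at this
    exact him this
  have h := CC_down ha ha1 (k + 1) (by omega) (w := s + 1) (by simp [hs]) (hj _)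
    (CC_all ha ha1 (k + 1) (by simp [hs]) (hj _))
  simpa using h

end Rid

namespace Rid

open MeasureTheory Filter Topology Set

lemma norm_int_le {F : ℝ → ℂ} {Φ Φ' : ℝ → ℝ} {u v : ℝ} (huv : u ≤ v)
    (hΦ : ∀ y ∈ Icc u v, HasDerivAt Φ (Φ' y) y) (hc : ContinuousOn Φ' (Icc u v))
    (hF : ∀ y ∈ Icc u v, ‖F y‖ ≤ Φ' y) : ‖∫ y in u..v, F y‖ ≤ Φ v - Φ u := by
  have hi : IntervalIntegrable Φ' volume u v := by
    apply ContinuousOn.intervalIntegrable; rwa [uIcc_of_le huv]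
  rw [← integral_eq_sub_of_hasDerivAt (f := Φ) (f' := Φ')
    (by rwa [uIcc_of_le huv]) hi]
  refine norm_integral_le_of_norm_le huv ?_ hi
  filter_upwards with y hy using hF y ⟨hy.1.le, hy.2⟩

lemma osc_basic {W W' φ φ1 Φ Φ' : ℝ → ℝ} {u v : ℝ} (huv : u ≤ v)
    (hφ : ∀ y ∈ Icc u v, HasDerivAt φ (φ1 y) y) (hφ1 : ContinuousOn φ1 (Icc u v))
    (hW : ∀ y ∈ Icc u v, HasDerivAt W (W' y) y) (hW' : ContinuousOn W' (Icc u v))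
    (hΦ : ∀ y ∈ Icc u v, HasDerivAt Φ (Φ' y) y) (hc : ContinuousOn Φ' (Icc u v))
    (hF : ∀ y ∈ Icc u v, |W' y| ≤ Φ' y) :
    ‖∫ y in u..v, (W y * φ1 y : ℂ) * Complex.exp (I * φ y)‖ ≤
      |W u| + |W v| + (Φ v - Φ u) := by
  have hφc : ContinuousOn φ (Icc u v) := fun y hy => (hφ y hy).continuousAt.continuousWithinAt
  have hec : ContinuousOn (fun y => Complex.exp (I * φ y)) (Icc u v) :=
    continuous_exp.comp_continuousOn
      (continuousOn_const.mul (continuous_ofReal.comp_continuousOn hφc))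
  have key := intervalIntegral.integral_mul_deriv_eq_deriv_mul (a := u) (b := v)
    (u := fun y => (W y : ℂ)) (u' := fun y => (W' y : ℂ))
    (v := fun y => Complex.exp (I * φ y))
    (v' := fun y => Complex.exp (I * φ y) * (I * φ1 y))
    (by rw [uIcc_of_le huv]; exact fun y hy => (hW y hy).ofReal_comp)
    (by
      rw [uIcc_of_le huv]; intro y hy
      exact ((hφ y hy).ofReal_comp.const_mul I).cexp)
    (by
      apply ContinuousOn.intervalIntegrable; rw [uIcc_of_le huv]
      exact continuous_ofReal.comp_continuousOn hW')
    (by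
      apply ContinuousOn.intervalIntegrable; rw [uIcc_of_le huv]
      exact hec.mul (continuousOn_const.mul (continuous_ofReal.comp_continuousOn hφ1)))
  have e : ∫ y in u..v, (W y : ℂ) * (Complex.exp (I * φ y) * (I * φ1 y)) =
      I * ∫ y in u..v, (W y * φ1 y : ℂ) * Complex.exp (I * φ y) := by
    rw [← intervalIntegral.integral_const_mul]; congr 1; ext y; ring
  rw [e] at key
  have hn : ∀ t : ℝ, ‖Complex.exp (I * t)‖ = 1 := fun t => by
    rw [mul_comm]; exact norm_exp_ofReal_mul_I t
  have h1 := norm_int_le (F := fun y => (W' y : ℂ) * Complex.exp (I * φ y)) huv hΦ hc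
    (fun y hy => by rw [norm_mul, hn, mul_one]; simpa using hF y hy)
  have h2 : ‖∫ y in u..v, (W y * φ1 y : ℂ) * Complex.exp (I * φ y)‖ =
      ‖I * ∫ y in u..v, (W y * φ1 y : ℂ) * Complex.exp (I * φ y)‖ := by simp
  rw [h2, key]
  refine (norm_sub_le _ _).trans ?_
  have h3 : ‖(W v : ℂ) * Complex.exp (I * φ v) - W u * Complex.exp (I * φ u)‖
      ≤ |W v| + |W u| := by
    refine (norm_sub_le _ _).trans ?_
    simp
  linarith

lemma osc1 {g g' : ℝ → ℝ} {u v r : ℝ} (huv : u ≤ v) (hr : r ≠ 0)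
    (hg : ∀ y ∈ Icc u v, HasDerivAt g (g' y) y) (hg' : ContinuousOn g' (Icc u v))
    (hneg : ∀ y ∈ Icc u v, g' y ≤ 0) (h0 : 0 ≤ g v) (h1 : g v ≤ g u) :
    ‖∫ y in u..v, (g y : ℂ) * Complex.exp (I * (r * y : ℝ))‖ ≤ 2 * g u / |r| := by
  have := osc_basic (W := fun y => g y / r) (W' := fun y => g' y / r) (φ := fun y => r * y)
    (φ1 := fun _ => r) (Φ := fun y => - g y / |r|) (Φ' := fun y => - g' y / |r|) huv
    (fun y _ => by simpa using (hasDerivAt_id y).const_mul r) continuousOn_const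
    (fun y hy => (hg y hy).div_const r) (hg'.div_const r)
    (fun y hy => (hg y hy).neg.div_const _) (hg'.neg.div_const _)
    (fun y hy => by rw [abs_div, abs_of_nonpos (hneg y hy)])
  have e : ∀ y : ℝ, ((g y / r : ℝ) * r) = (g y : ℂ) := fun y => by
    have : (r : ℂ) ≠ 0 := mod_cast hr
    push_cast; field_simp
  simp only [e] at this
  refine this.trans (le_of_eq ?_)
  rw [abs_div, abs_div, abs_of_nonneg h0, abs_of_nonneg (h0.trans h1)]
  field

lemma osc2 {g g' φ φ1 φ2 : ℝ → ℝ} {u v ν : ℝ} (huv : u ≤ v) (hν : 0 < ν)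
    (hg : ∀ y ∈ Icc u v, HasDerivAt g (g' y) y) (hg' : ContinuousOn g' (Icc u v))
    (hneg : ∀ y ∈ Icc u v, g' y ≤ 0) (h0 : ∀ y ∈ Icc u v, 0 ≤ g y) (h1 : ∀ y ∈ Icc u v, g y ≤ g u)
    (hφ : ∀ y ∈ Icc u v, HasDerivAt φ (φ1 y) y) (hφ1 : ∀ y ∈ Icc u v, HasDerivAt φ1 (φ2 y) y)
    (hφ2 : ContinuousOn φ2 (Icc u v)) (hφν : ∀ y ∈ Icc u v, ν ≤ φ2 y) :
    ‖∫ y in u..v, (g y : ℂ) * Complex.exp (I * φ y)‖ ≤ 8 * g u / √ν := by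
  have hs : 0 < √ν := sqrt_pos.2 hν
  have hss : √ν * √ν = ν := mul_self_sqrt hν.le
  have hφ1c : ContinuousOn φ1 (Icc u v) := fun y hy => (hφ1 y hy).continuousAt.continuousWithinAt
  have hφc : ContinuousOn φ (Icc u v) := fun y hy => (hφ y hy).continuousAt.continuousWithinAt
  have hgc : ContinuousOn g (Icc u v) := fun y hy => (hg y hy).continuousAt.continuousWithinAt
  have hgu : 0 ≤ g u := h0 u ⟨le_rfl, huv⟩
  have hpos : ∀ y, 0 < φ1 y ^ 2 + ν := fun y => by positivity
  have hh : ∀ t : ℝ, |t / (t ^ 2 + ν)| ≤ 1 / (2 * √ν) := fun t => by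
    rw [abs_div, abs_of_pos (by positivity : 0 < t ^ 2 + ν), div_le_div_iff₀ (by positivity) (by positivity)]
    nlinarith [sq_nonneg (|t| - √ν), sq_abs t]
  have hden : ContinuousOn (fun y => φ1 y ^ 2 + ν) (Icc u v) := (hφ1c.pow 2).add continuousOn_const
  -- arctan primitive
  have hat : ∀ y ∈ Icc u v, HasDerivAt (fun y => g u * (arctan (φ1 y / √ν) / √ν))
      (g u * (φ2 y / (φ1 y ^ 2 + ν))) y := by
    intro y hy
    have := ((((hφ1 y hy).div_const (√ν)).arctan).div_const (√ν)).const_mul (g u)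
    refine this.congr_deriv ?_
    have h2 : 1 + (φ1 y / √ν) ^ 2 = (φ1 y ^ 2 + ν) / ν := by
      rw [div_pow, sq_sqrt hν.le]; field_simp; ring
    rw [h2]
    have := hpos y
    field_simp
    rw [sq, hss]; ring
  have hatc : ContinuousOn (fun y => g u * (φ2 y / (φ1 y ^ 2 + ν))) (Icc u v) :=
    continuousOn_const.mul (hφ2.div hden fun y _ => (hpos y).ne')
  have hatb : g u * (arctan (φ1 v / √ν) / √ν) - g u * (arctan (φ1 u / √ν) / √ν)
      ≤ g u * (π / √ν) := by
    rw [← mul_sub, ← sub_div]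
    gcongr
    linarith [arctan_lt_pi_div_two (φ1 v / √ν), neg_pi_div_two_lt_arctan (φ1 u / √ν)]
  have hn : ∀ t : ℝ, ‖Complex.exp (I * t)‖ = 1 := fun t => by
    rw [mul_comm]; exact norm_exp_ofReal_mul_I t
  -- first piece
  have p1 := osc_basic (W := fun y => g y * (φ1 y / (φ1 y ^ 2 + ν)))
    (W' := fun y => g' y * (φ1 y / (φ1 y ^ 2 + ν)) +
      g y * ((φ2 y * (φ1 y ^ 2 + ν) - φ1 y * (2 * φ1 y * φ2 y)) / (φ1 y ^ 2 + ν) ^ 2))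
    (φ := φ) (φ1 := φ1) (Φ := fun y => -g y / (2 * √ν) + g u * (arctan (φ1 y / √ν) / √ν))
    (Φ' := fun y => -g' y / (2 * √ν) + g u * (φ2 y / (φ1 y ^ 2 + ν))) huv hφ hφ1c
    (fun y hy => by
      refine (hg y hy).mul ?_
      refine (hφ1 y hy).div ?_ (hpos y).ne'
      have := ((hφ1 y hy).pow 2).add_const ν
      refine this.congr_deriv ?_
      simp)
    (by
      refine (hg'.mul (hφ1c.div hden fun y _ => (hpos y).ne')).add (hgc.mul ?_)
      refine ContinuousOn.div ?_ (hden.pow 2) fun y _ => pow_ne_zero _ (hpos y).ne'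
      exact (hφ2.mul hden).sub (hφ1c.mul ((continuousOn_const.mul hφ1c).mul hφ2)))
    (fun y hy => ((hg y hy).neg.div_const _).add (hat y hy))
    ((hg'.neg.div_const _).add hatc)
    (fun y hy => by
      refine (abs_add_le _ _).trans (add_le_add ?_ ?_)
      · rw [abs_mul, abs_of_nonpos (hneg y hy), div_eq_mul_one_div (-g' y)]
        exact mul_le_mul_of_nonneg_left (hh _) (by linarith [hneg y hy])
      · rw [abs_mul, abs_of_nonneg (h0 y hy)]
        refine mul_le_mul (h1 y hy) ?_ (abs_nonneg _) hgu
        have hp := hpos y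
        have h2 : 0 < φ2 y := hν.trans_le (hφν y hy)
        rw [abs_div, abs_of_pos (by positivity : 0 < (φ1 y ^ 2 + ν) ^ 2), div_le_div_iff₀ (by positivity) hp]
        have : |φ2 y * (φ1 y ^ 2 + ν) - φ1 y * (2 * φ1 y * φ2 y)| ≤ φ2 y * (φ1 y ^ 2 + ν) := by
          rw [abs_le]; constructor <;> nlinarith [sq_nonneg (φ1 y), mul_nonneg h2.le (sq_nonneg (φ1 y)), mul_pos h2 hν]
        calc _ ≤ φ2 y * (φ1 y ^ 2 + ν) * (φ1 y ^ 2 + ν) := mul_le_mul_of_nonneg_right this hp.le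
          _ = _ := by ring)
  have p2 := norm_int_le (F := fun y => ((g y * (ν / (φ1 y ^ 2 + ν)) : ℝ) : ℂ) * Complex.exp (I * φ y))
    huv hat hatc (fun y hy => by
      have hp := hpos y
      rw [norm_mul, hn, mul_one, norm_real, norm_of_nonneg (by have := h0 y hy; positivity)]
      gcongr
      · exact h1 y hy
      · exact hφν y hy)
  have split : ∫ y in u..v, (g y : ℂ) * Complex.exp (I * φ y) =
      (∫ y in u..v, ((g y * (φ1 y / (φ1 y ^ 2 + ν)) : ℝ) * φ1 y : ℂ) * Complex.exp (I * φ y)) +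
      ∫ y in u..v, ((g y * (ν / (φ1 y ^ 2 + ν)) : ℝ) : ℂ) * Complex.exp (I * φ y) := by
    have hec : ContinuousOn (fun y => Complex.exp (I * φ y)) (Icc u v) :=
      continuous_exp.comp_continuousOn
        (continuousOn_const.mul (continuous_ofReal.comp_continuousOn hφc))
    rw [← intervalIntegral.integral_add]
    · congr 1; ext y
      have : ((φ1 y : ℂ) ^ 2 + ν) ≠ 0 := mod_cast (hpos y).ne'
      push_cast; field_simp
    · apply ContinuousOn.intervalIntegrable; rw [uIcc_of_le huv]
      exact ((continuous_ofReal.comp_continuousOn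
        (hgc.mul (hφ1c.div hden fun y _ => (hpos y).ne'))).mul
        (continuous_ofReal.comp_continuousOn hφ1c)).mul hec
    · apply ContinuousOn.intervalIntegrable; rw [uIcc_of_le huv]
      exact (continuous_ofReal.comp_continuousOn
        (hgc.mul (continuousOn_const.div hden fun y _ => (hpos y).ne'))).mul hec
  rw [split]
  refine (norm_add_le _ _).trans ?_
  have hWu : ∀ y ∈ Icc u v, |g y * (φ1 y / (φ1 y ^ 2 + ν))| ≤ g u * (1 / (2 * √ν)) := by
    intro y hy
    rw [abs_mul, abs_of_nonneg (h0 y hy)]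
    exact mul_le_mul (h1 y hy) (hh _) (abs_nonneg _) hgu
  have b1 := hWu u ⟨le_rfl, huv⟩
  have b2 := hWu v ⟨huv, le_rfl⟩
  have hgv : 0 ≤ g v := h0 v ⟨huv, le_rfl⟩
  have b3 : -g v / (2 * √ν) - (-g u / (2 * √ν)) ≤ g u * (1 / (2 * √ν)) := by
    have : 0 ≤ g v / (2 * √ν) := by positivity
    rw [neg_div, neg_div, mul_one_div]; linarith
  have hpi := pi_lt_d2
  have b4 : g u * (1 / (2 * √ν)) * 3 + 2 * (g u * (π / √ν)) ≤ 8 * g u / √ν := by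
    have : g u * (1 / (2 * √ν)) * 3 + 2 * (g u * (π / √ν)) = (3/2 + 2 * π) * g u / √ν := by
      field_simp
    rw [this]
    gcongr
    linarith
  linarith

end Rid

namespace Rid

open MeasureTheory Filter Topology Set

lemma sin_lb {y : ℝ} (h0 : 0 ≤ y) (h1 : y ≤ 1/2) : 2 * y ≤ sin (π * y) := by
  have hp := pi_pos
  have := mul_le_sin (x := π * y) (by positivity) (by nlinarith)
  refine le_trans (le_of_eq ?_) this
  field_simp

lemma sin_pos' {y : ℝ} (h0 : 0 < y) (h1 : y ≤ 1/2) : 0 < sin (π * y) := by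
  linarith [sin_lb h0.le h1]

lemma sinv_deriv {y : ℝ} (h0 : 0 < y) (h1 : y ≤ 1/2) :
    HasDerivAt (fun y => (sin (π * y))⁻¹)
      (-(cos (π * y) * π) / sin (π * y) ^ 2) y := by
  have h := ((hasDerivAt_id y).const_mul π).sin
  simp at h
  exact h.inv (sin_pos' h0 h1).ne'

lemma sinv_cont {u v : ℝ} (h0 : 0 < u) (h1 : v ≤ 1/2) :
    ContinuousOn (fun y => -(cos (π * y) * π) / sin (π * y) ^ 2) (Icc u v) := by
  refine ContinuousOn.div (by fun_prop) (by fun_prop) fun y hy => ?_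
  exact pow_ne_zero _ (sin_pos' (h0.trans_le hy.1) (hy.2.trans h1)).ne'

lemma sinv_neg {y : ℝ} (h0 : 0 < y) (h1 : y ≤ 1/2) :
    -(Real.cos (π * y) * π) / Real.sin (π * y) ^ 2 ≤ 0 := by
  have hp := Real.pi_pos
  have : 0 ≤ Real.cos (π * y) := cos_nonneg_of_neg_pi_div_two_le_of_le (by nlinarith) (by nlinarith)
  rw [neg_div]
  have := div_nonneg (mul_nonneg this hp.le) (sq_nonneg (sin (π * y)))
  linarith

lemma sinv_le {u y : ℝ} (h0 : 0 < u) (huy : u ≤ y) (h1 : y ≤ 1/2) :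
    (sin (π * y))⁻¹ ≤ (sin (π * u))⁻¹ := by
  have hp := pi_pos
  refine inv_anti₀ (sin_pos' h0 (huy.trans h1)) ?_
  exact sin_le_sin_of_le_of_le_pi_div_two (by nlinarith) (by nlinarith) (by nlinarith)

lemma sinv_ub {u : ℝ} (h0 : 0 < u) (h1 : u ≤ 1/2) : (sin (π * u))⁻¹ ≤ 1 / (2 * u) := by
  rw [one_div]; exact inv_anti₀ (by positivity) (sin_lb h0.le h1)

lemma sinv_nonneg {u : ℝ} (h0 : 0 < u) (h1 : u ≤ 1/2) : 0 ≤ (sin (π * u))⁻¹ :=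
  inv_nonneg.2 (sin_pos' h0 h1).le

lemma sinv_osc1 {u v r : ℝ} (h0 : 0 < u) (huv : u ≤ v) (h1 : v ≤ 1/2) (hr : r ≠ 0) :
    |∫ y in u..v, sin (r * y) / sin (π * y)| ≤ 1 / (|r| * u) := by
  have h := osc1 (g := fun y => (sin (π * y))⁻¹) huv hr
    (fun y hy => sinv_deriv (h0.trans_le hy.1) (hy.2.trans h1)) (sinv_cont h0 h1)
    (fun y hy => sinv_neg (h0.trans_le hy.1) (hy.2.trans h1)) (sinv_nonneg (h0.trans_le huv) h1)
    (sinv_le h0 huv h1)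
  have hint : IntervalIntegrable (fun y : ℝ => (((sin (π * y))⁻¹ : ℝ) : ℂ) *
      Complex.exp (I * (r * y : ℝ))) volume u v := by
    apply ContinuousOn.intervalIntegrable
    rw [uIcc_of_le huv]
    refine ContinuousOn.mul ?_ (by fun_prop)
    refine continuous_ofReal.comp_continuousOn ?_
    exact fun y hy => (sinv_deriv (h0.trans_le hy.1) (hy.2.trans h1)).continuousAt.continuousWithinAt
  have e : ∫ y in u..v, sin (r * y) / sin (π * y) =
      (∫ y in u..v, (((sin (π * y))⁻¹ : ℝ) : ℂ) * Complex.exp (I * (r * y : ℝ))).im := by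
    have := (Complex.imCLM.intervalIntegral_comp_comm hint)
    simp only [Complex.imCLM_apply] at this
    rw [← this]
    congr 1; ext y
    rw [Complex.im_ofReal_mul, mul_comm I, Complex.exp_ofReal_mul_I_im]
    rw [div_eq_inv_mul]
  rw [e]
  refine (abs_im_le_norm _).trans (h.trans ?_)
  have := sinv_ub h0 (huv.trans h1)
  have hr' := abs_pos.2 hr
  rw [div_le_div_iff₀ hr' (by positivity)]
  have h3 : 2 * (sin (π * u))⁻¹ * u ≤ 1 := by
    calc _ ≤ 2 * (1 / (2 * u)) * u := by gcongr
      _ = 1 := by field_simp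
  nlinarith

lemma sq_bd {r y : ℝ} (h0 : 0 < y) (h1 : y ≤ 1/2) :
    |sin (r * y) / sin (π * y)| ≤ |r| / 2 := by
  have hs := sin_lb h0.le h1
  rw [abs_div, abs_of_pos (sin_pos' h0 h1), div_le_div_iff₀ (sin_pos' h0 h1) (by norm_num)]
  have : |sin (r * y)| ≤ |r| * y := by
    have := abs_sin_le_abs (x := r * y)
    rwa [abs_mul, abs_of_pos h0] at this
  nlinarith [mul_le_mul_of_nonneg_left hs (abs_nonneg r)]

lemma sq_int {u v r : ℝ} (h0 : 0 ≤ u) (huv : u ≤ v) (h1 : v ≤ 1/2) :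
    IntervalIntegrable (fun y => sin (r * y) / sin (π * y)) volume u v := by
  rw [intervalIntegrable_iff_integrableOn_Ioc_of_le huv]
  refine Measure.integrableOn_of_bounded (M := |r| / 2) (by simp) ?_ ?_
  · exact ((measurable_sin.comp (measurable_id.const_mul r)).div
      (measurable_sin.comp (measurable_id.const_mul π))).aestronglyMeasurable
  · refine (ae_restrict_iff' measurableSet_Ioc).2 (Eventually.of_forall fun y hy => ?_)
    exact sq_bd (h0.trans_lt hy.1) (hy.2.trans h1)

lemma si_bdd {v r : ℝ} (h0 : 0 ≤ v) (h1 : v ≤ 1/2) :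
    |∫ y in (0:ℝ)..v, sin (r * y) / sin (π * y)| ≤ 3 / 2 := by
  have triv : ∀ w : ℝ, 0 ≤ w → w ≤ 1/2 → |r| * w ≤ 1 →
      |∫ y in 0..w, sin (r * y) / sin (π * y)| ≤ 1/2 := by
    intro w hw0 hw1 hw
    have := norm_integral_le_of_norm_le_const (a := 0) (b := w) (C := |r| / 2)
      (f := fun y => sin (r * y) / sin (π * y)) (fun y hy => by
        rw [uIoc_of_le hw0] at hy
        exact sq_bd hy.1 (hy.2.trans hw1))
    rw [norm_eq_abs, sub_zero, abs_of_nonneg hw0] at this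
    linarith
  by_cases h : |r| * v ≤ 1
  · grind
  · push Not at h
    have hr : r ≠ 0 := by rintro rfl; simp at h; linarith
    have hr' := abs_pos.2 hr
    have hu : 1 / |r| ≤ v := by rw [div_le_iff₀ hr']; nlinarith
    have hu0 : 0 < 1 / |r| := by positivity
    rw [← integral_add_adjacent_intervals (sq_int le_rfl hu0.le (hu.trans h1)) (sq_int hu0.le hu h1)]
    refine (abs_add_le _ _).trans ?_
    have a1 := triv (1 / |r|) hu0.le (hu.trans h1) (by field_simp; rfl)
    have a2 := sinv_osc1 hu0 hu h1 hr
    have : 1 / (|r| * (1 / |r|)) = 1 := by field_simp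
    linarith

noncomputable def DN (N : ℕ) (y : ℝ) : ℝ :=
  1 + 2 * ∑ n ∈ range N, cos (2 * π * (n + 1) * y)

noncomputable def DN' (N : ℕ) (y : ℝ) : ℝ :=
  2 * ∑ n ∈ range N, -(sin (2 * π * (n + 1) * y) * (2 * π * (n + 1)))

lemma DN_mul (N : ℕ) (y : ℝ) : DN N y * sin (π * y) = sin ((2 * N + 1) * π * y) := by
  induction N with
  | zero => simp [DN]
  | succ N ih =>
    have e : DN (N + 1) y = DN N y + 2 * cos (2 * π * (N + 1) * y) := by
      simp [DN, sum_range_succ]; ring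
    rw [e, add_mul, ih]
    have e1 : ((2 * (N + 1 : ℕ) + 1 : ℝ)) * π * y = 2 * π * (N + 1) * y + π * y := by
      push_cast; ring
    have e2 : ((2 * N + 1 : ℝ)) * π * y = 2 * π * (N + 1) * y - π * y := by ring
    rw [e1, e2, sin_add, sin_sub]; ring

lemma DN_eq (N : ℕ) {y : ℝ} (h0 : 0 < y) (h1 : y ≤ 1/2) :
    DN N y = sin ((2 * N + 1) * π * y) / sin (π * y) := by
  rw [eq_div_iff (sin_pos' h0 h1).ne', DN_mul]

lemma DN_hasDeriv (N : ℕ) (y : ℝ) : HasDerivAt (DN N) (DN' N y) y := by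
  refine HasDerivAt.const_add _ (HasDerivAt.const_mul _ ?_)
  refine HasDerivAt.fun_sum fun n _ => ?_
  have := ((hasDerivAt_id y).const_mul (2 * π * (n + 1))).cos
  simpa using this

lemma DN_cont (N : ℕ) : Continuous (DN N) := by unfold DN; fun_prop

lemma DN'_cont (N : ℕ) : Continuous (DN' N) := by unfold DN'; fun_prop

lemma DN_even (N : ℕ) (y : ℝ) : DN N (-y) = DN N y := by simp [DN]

lemma DN_abs (N : ℕ) (y : ℝ) : |DN N y| ≤ 2 * N + 1 := by
  unfold DN
  refine (abs_add_le _ _).trans ?_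
  rw [abs_mul]
  have := abs_sum_le_sum_abs (fun n : ℕ => cos (2 * π * (n + 1) * y)) (range N)
  have h2 : ∑ n ∈ Finset.range N, |cos (2 * π * (n + 1) * y)| ≤ ∑ n ∈ range N, 1 :=
    sum_le_sum fun n _ => abs_cos_le_one _
  simp at h2 ⊢
  linarith

lemma DN'_abs (N : ℕ) (y : ℝ) : |DN' N y| ≤ 14 * N ^ 2 := by
  unfold DN'
  have hp2 := pi_lt_d2
  rw [abs_mul]
  have := abs_sum_le_sum_abs (fun n : ℕ => -(sin (2 * π * (n + 1) * y) * (2 * π * (n + 1)))) (range N)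
  have h2 : ∑ n ∈ range N, |-(sin (2 * π * (n + 1) * y) * (2 * π * (n + 1)))| ≤ ∑ n ∈ range N, (7 * N : ℝ) := by
    refine sum_le_sum fun n hn => ?_
    rw [abs_neg, abs_mul, abs_of_pos (by positivity : 0 < 2 * π * (n + 1))]
    have h3 := abs_sin_le_one (2 * π * (n + 1) * y)
    have h4 : (n : ℝ) + 1 ≤ N := by exact_mod_cast mem_range.1 hn
    calc _ ≤ 1 * (2 * π * (n + 1)) := by gcongr
      _ ≤ 7 * N := by nlinarith
  rw [sum_const, card_range, nsmul_eq_mul] at h2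
  rw [abs_two]
  nlinarith

lemma DN'_bd {N : ℕ} (hN : 1 ≤ N) {y : ℝ} (h0 : 0 ≤ y) (h1 : y ≤ 1/2) :
    |DN' N y| ≤ 30 * N ^ 2 / (1 + N * y) := by
  have hN' := mod_cast hN
  have hp := pi_pos
  have hp2 := pi_lt_d2
  rw [le_div_iff₀ (by positivity)]
  have hA := DN'_abs N y
  by_cases hy : N * y ≤ 1
  · nlinarith [abs_nonneg (DN' N y)]
  · push Not at hy
    have hy0 : 0 < y := by
      rcases h0.eq_or_lt with h | h
      · rw [← h] at hy; simp at hy; linarith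
      · exact h
    have hs := sin_lb h0 h1
    have d1 := (DN_hasDeriv N y).mul (((hasDerivAt_id y).const_mul π).sin)
    have d2 := ((hasDerivAt_id y).const_mul ((2 * N + 1) * π)).sin
    have e : (DN N * fun y => sin (π * id y)) = fun y => sin ((2 * N + 1) * π * id y) := by
      ext y; exact DN_mul N y
    rw [e] at d1
    have := d1.unique d2
    simp at this
    have h3 : DN' N y * sin (π * y) =
      cos ((2 * N + 1) * π * y) * ((2 * N + 1) * π) - DN N y * (cos (π * y) * π) := by
      linarith
    have h4 : |DN' N y| * (2 * y) ≤ 2 * ((2 * N + 1) * π) := by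
      calc |DN' N y| * (2 * y) ≤ |DN' N y| * sin (π * y) := by gcongr
        _ = |DN' N y * sin (π * y)| := by rw [abs_mul, abs_of_pos (sin_pos' hy0 h1)]
        _ ≤ _ := by
          rw [h3]
          refine (abs_sub _ _).trans ?_
          rw [abs_mul _ ((2 * N + 1) * π), abs_mul (DN N y), abs_mul (cos (π * y)) π, abs_of_pos hp, abs_of_pos (by positivity : 0 < (2 * N + 1) * π)]
          have c1 := abs_cos_le_one ((2 * N + 1) * π * y)
          have c2 := abs_cos_le_one (π * y)
          have c3 := DN_abs N y
          have : |DN N y| * (|cos (π * y)| * π) ≤ (2 * N + 1) * (1 * π) := by gcongr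
          have : |cos ((2 * N + 1) * π * y)| * ((2 * N + 1) * π) ≤ 1 * ((2 * N + 1) * π) := by gcongr
          linarith
    have h5 : |DN' N y| * y ≤ 10 * N := by nlinarith
    nlinarith

noncomputable def JN (N : ℕ) (u : ℝ) : ℝ := ∫ y in u..(1/2), DN N y

lemma JN_deriv (N : ℕ) (u : ℝ) : HasDerivAt (JN N) (-DN N u) u :=
  intervalIntegral.integral_hasDerivAt_left ((DN_cont N).intervalIntegrable _ _)
    ((DN_cont N).stronglyMeasurableAtFilter _ _) (DN_cont N).continuousAt

lemma DN_int_eq (N : ℕ) {u v : ℝ} (h0 : 0 ≤ u) (huv : u ≤ v) (h1 : v ≤ 1/2) :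
    ∫ y in u..v, DN N y = ∫ y in u..v, sin ((2 * N + 1) * π * y) / sin (π * y) := by
  refine integral_congr_ae ?_
  filter_upwards with y hy
  rw [uIoc_of_le huv] at hy
  exact DN_eq N (h0.trans_lt hy.1) (hy.2.trans h1)

lemma JN_bd {N : ℕ} (hN : 1 ≤ N) {u : ℝ} (h0 : 0 ≤ u) (h1 : u ≤ 1/2) :
    |JN N u| ≤ 6 / (1 + N * u) := by
  have hp := pi_gt_three
  have hI : |JN N u| ≤ 3 := by
    have := integral_add_adjacent_intervals (a := 0) (b := u) (c := 1/2)
      ((DN_cont N).intervalIntegrable (μ := volume) _ _) ((DN_cont N).intervalIntegrable _ _)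
    have a1 := si_bdd (r := (2 * N + 1) * π) h0 h1
    have a2 := si_bdd (r := (2 * N + 1) * π) (v := 1/2) (by norm_num) le_rfl
    rw [← DN_int_eq N le_rfl h0 h1] at a1
    rw [← DN_int_eq N le_rfl (by norm_num) le_rfl] at a2
    rw [JN, eq_sub_of_add_eq' this]
    refine (abs_sub _ _).trans ?_
    linarith
  rw [le_div_iff₀ (by positivity)]
  by_cases hy : N * u ≤ 1
  · nlinarith [abs_nonneg (JN N u)]
  · push Not at hy
    have hu0 : 0 < u := by
      rcases h0.eq_or_lt with h | h
      · rw [← h] at hy; simp at hy; linarith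
      · exact h
    have hM : 0 < (2 * N + 1) * π := by positivity
    have a := sinv_osc1 (r := (2 * N + 1) * π) hu0 h1 le_rfl hM.ne'
    rw [← DN_int_eq N h0 h1 le_rfl, abs_of_pos hM, le_div_iff₀ (by positivity)] at a
    change |JN N u| * _ ≤ 1 at a
    have : |JN N u| * (1 + N * u) ≤ |JN N u| * ((2 * N + 1) * π * u) := by
      gcongr
      nlinarith
    linarith

lemma log_int {N : ℕ} (hN : 2 ≤ N) :
    IntervalIntegrable (fun y : ℝ => 1 / (1 + N * y)) volume 0 (1/2) ∧
    ∫ y in (0:ℝ)..(1/2), 1 / (1 + N * y) ≤ log N / N := by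
  have hN' : (2:ℝ) ≤ N := by exact_mod_cast hN
  have hN0 : (0:ℝ) < N := by linarith
  have hpos : ∀ y ∈ uIcc (0:ℝ) (1/2), 0 < 1 + N * y := by
    intro y hy
    rw [uIcc_of_le (by norm_num)] at hy
    have := hy.1
    positivity
  have hi : IntervalIntegrable (fun y : ℝ => 1 / (1 + N * y)) volume 0 (1/2) := by
    apply ContinuousOn.intervalIntegrable
    exact continuousOn_const.div (by fun_prop) fun y hy => (hpos y hy).ne'
  refine ⟨hi, ?_⟩
  rw [integral_eq_sub_of_hasDerivAt (f := fun y => log (1 + N * y) / N) ?_ hi]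
  · simp
    gcongr
    linarith
  · intro y hy
    have := ((((hasDerivAt_id y).const_mul (N:ℝ)).const_add 1).log (by simpa using (hpos y hy).ne')).div_const (N:ℝ)
    refine this.congr_deriv ?_
    have := hpos y hy
    simp; field_simp

lemma DN_total (N : ℕ) : ∫ y in (0:ℝ)..(1/2), DN N y = 1/2 := by
  have hd : ∀ y ∈ uIcc (0:ℝ) (1/2), HasDerivAt (fun y => y + 2 * ∑ n ∈ range N,
      sin (2 * π * (n + 1) * y) / (2 * π * (n + 1))) (DN N y) y := by
    intro y _
    refine (hasDerivAt_id y).add (HasDerivAt.const_mul _ (HasDerivAt.fun_sum fun n _ => ?_))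
    have hp : 2 * π * (n + 1) ≠ 0 := by have := pi_pos; positivity
    have := (((hasDerivAt_id y).const_mul (2 * π * (n + 1))).sin).div_const (2 * π * (n + 1))
    refine this.congr_deriv ?_
    simp only [id, mul_one]
    rw [mul_div_cancel_right₀ _ hp]
  rw [integral_eq_sub_of_hasDerivAt hd ((DN_cont N).intervalIntegrable _ _)]
  have : ∀ n : ℕ, sin (2 * π * (n + 1) * (1/2)) = 0 := fun n => by
    have := sin_nat_mul_pi (n + 1)
    rw [← this]; push_cast; congr 1; ring
  simp only [this]
  simp

end Rid

namespace Rid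

open MeasureTheory Filter Topology Set

lemma outer_freq {N : ℕ} (hN : 1 ≤ N) {lam ℓ κ δ : ℝ} (hκ : 0 < κ) (hlam : N / κ ≤ lam) (hℓ : ℓ ≠ 0)
    (hδ0 : 0 < δ) (hδ : δ ≤ 1/2) (hδN : 1 / (2 * δ) = √N) :
    ‖∫ y in δ..(1/2), Complex.exp (I * (lam * exp (ℓ * y) : ℝ)) * (DN N y : ℂ)‖ ≤
      8 / √(ℓ ^ 2 * exp (-|ℓ|) / κ) := by
  have hN' : (1:ℝ) ≤ N := mod_cast hN
  have hN0 : (0:ℝ) < N := by linarith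
  have hl0 : 0 < lam := lt_of_lt_of_le (by positivity) hlam
  have hℓ2 : 0 < ℓ ^ 2 := by positivity
  set c := ℓ ^ 2 * exp (-|ℓ|) / κ with hc
  have hc0 : 0 < c := by positivity
  have main : ∀ M : ℝ, ‖∫ y in δ..(1/2), (((sin (π * y))⁻¹ : ℝ) : ℂ) *
      Complex.exp (I * (lam * exp (ℓ * y) + M * y : ℝ))‖ ≤ 8 / √c := by
    intro M
    have h := osc2 (g := fun y => (sin (π * y))⁻¹) (ν := N * c)
      (φ := fun y => lam * exp (ℓ * y) + M * y)
      (φ1 := fun y => lam * (exp (ℓ * y) * ℓ) + M) (φ2 := fun y => lam * (exp (ℓ * y) * ℓ * ℓ))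
      hδ (by positivity)
      (fun y hy => sinv_deriv (hδ0.trans_le hy.1) hy.2) (sinv_cont hδ0 le_rfl)
      (fun y hy => sinv_neg (hδ0.trans_le hy.1) hy.2)
      (fun y hy => sinv_nonneg (hδ0.trans_le hy.1) hy.2)
      (fun y hy => sinv_le hδ0 hy.1 hy.2)
      (fun y _ => by
        have h1 := (((hasDerivAt_id y).const_mul ℓ).exp.const_mul lam).fun_add ((hasDerivAt_id y).const_mul M)
        simpa using h1)
      (fun y _ => by
        have h1 := ((((hasDerivAt_id y).const_mul ℓ).exp.mul_const ℓ).const_mul lam).add_const M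
        simpa using h1)
      (by fun_prop)
      (fun y hy => by
        have hy0 := hδ0.trans_le hy.1
        have e1 : exp (-|ℓ|) ≤ exp (ℓ * y) := by
          apply exp_le_exp.2
          have : |ℓ * y| ≤ |ℓ| := by
            rw [abs_mul, abs_of_pos hy0]
            nlinarith [abs_nonneg ℓ, hy.2]
          linarith [neg_abs_le (ℓ * y)]
        calc N * c = N / κ * (exp (-|ℓ|) * ℓ ^ 2) := by rw [hc]; ring
          _ ≤ lam * (exp (ℓ * y) * ℓ ^ 2) := by gcongr
          _ = _ := by ring)
    refine h.trans ?_
    have hs := sinv_ub hδ0 hδ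
    rw [hδN] at hs
    rw [sqrt_mul hN0.le]
    have hsN : 0 < √N := sqrt_pos.2 hN0
    calc _ ≤ 8 * √N / (√N * √c) := by gcongr
      _ = 8 / √c := by field_simp
  have p1 := main ((2 * N + 1) * π)
  have p2 := main (-((2 * N + 1) * π))
  have hci : ∀ M : ℝ, IntervalIntegrable (fun y : ℝ => (((sin (π * y))⁻¹ : ℝ) : ℂ) *
      Complex.exp (I * (lam * exp (ℓ * y) + M * y : ℝ))) volume δ (1/2) := by
    intro M
    apply ContinuousOn.intervalIntegrable
    rw [uIcc_of_le hδ]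
    refine ContinuousOn.mul ?_ (by fun_prop)
    refine continuous_ofReal.comp_continuousOn ?_
    exact fun y hy => (sinv_deriv (hδ0.trans_le hy.1) hy.2).continuousAt.continuousWithinAt
  have e : ∫ y in δ..(1/2), Complex.exp (I * (lam * exp (ℓ * y) : ℝ)) * (DN N y : ℂ) =
      (1 / (2 * I)) * ((∫ y in δ..(1/2), (((sin (π * y))⁻¹ : ℝ) : ℂ) *
      Complex.exp (I * (lam * exp (ℓ * y) + ((2 * N + 1) * π) * y : ℝ))) -
      ∫ y in δ..(1/2), (((sin (π * y))⁻¹ : ℝ) : ℂ) *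
      Complex.exp (I * (lam * exp (ℓ * y) + (-((2 * N + 1) * π)) * y : ℝ))) := by
    rw [← intervalIntegral.integral_sub (hci _) (hci _), ← intervalIntegral.integral_const_mul]
    refine integral_congr fun y hy => ?_
    rw [uIcc_of_le hδ] at hy
    beta_reduce
    rw [DN_eq N (hδ0.trans_le hy.1) hy.2, div_eq_mul_inv]
    have hsin : ((sin ((2 * N + 1) * π * y) : ℝ) : ℂ) =
        (Complex.exp (I * ((2 * N + 1) * π * y : ℝ)) -
          Complex.exp (I * (-((2 * N + 1) * π * y) : ℝ))) / (2 * I) := by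
      rw [Complex.ofReal_sin, Complex.sin, Complex.ofReal_neg, mul_comm I, mul_comm I,
        eq_div_iff (by simp)]
      generalize Complex.exp _ = u
      generalize Complex.exp _ = v
      linear_combination (u - v) * Complex.I_sq
    have x1 : Complex.exp (I * (lam * exp (ℓ * y) + ((2 * N + 1) * π) * y : ℝ)) =
        Complex.exp (I * (lam * exp (ℓ * y) : ℝ)) * Complex.exp (I * ((2 * N + 1) * π * y : ℝ)) := by
      rw [← Complex.exp_add]; congr 1; push_cast; ring
    have x2 : Complex.exp (I * (lam * exp (ℓ * y) + (-((2 * N + 1) * π)) * y : ℝ)) =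
        Complex.exp (I * (lam * exp (ℓ * y) : ℝ)) * Complex.exp (I * (-((2 * N + 1) * π * y) : ℝ)) := by
      rw [← Complex.exp_add]; congr 1; push_cast; ring
    rw [x1, x2, ofReal_mul (sin _), hsin]
    ring
  rw [e, norm_mul]
  have : ‖(1 / (2 * I) : ℂ)‖ = 1/2 := by simp
  rw [this]
  have := norm_sub_le (∫ y in δ..(1/2), (((sin (π * y))⁻¹ : ℝ) : ℂ) *
      Complex.exp (I * (lam * exp (ℓ * y) + ((2 * N + 1) * π) * y : ℝ)))
      (∫ y in δ..(1/2), (((sin (π * y))⁻¹ : ℝ) : ℂ) *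
      Complex.exp (I * (lam * exp (ℓ * y) + (-((2 * N + 1) * π)) * y : ℝ)))
  linarith

lemma exp_lin {x : ℝ} : |exp x - 1 - x| ≤ x ^ 2 * exp |x| := by
  have := Complex.norm_exp_sub_sum_le_norm_mul_exp x 2
  simp [sum_range_succ] at this
  have h2 : ‖Complex.exp x - (1 + x)‖ = |exp x - 1 - x| := by
    rw [← norm_eq_abs, ← norm_real]; push_cast; ring_nf
  rwa [h2] at this

lemma exp_lip (s t : ℝ) : ‖Complex.exp (I * s) - Complex.exp (I * t)‖ ≤ |s - t| := by
  have e : Complex.exp (I * s) - Complex.exp (I * t) =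
      Complex.exp (I * t) * (Complex.exp (I * (s - t : ℝ)) - 1) := by
    rw [mul_sub, ← Complex.exp_add]; push_cast; ring_nf
  rw [e, norm_mul, mul_comm I t, norm_exp_ofReal_mul_I, one_mul]
  simpa using norm_exp_I_mul_ofReal_sub_one_le (x := s - t)

lemma DN_abs2 (N : ℕ) {y : ℝ} (h0 : 0 < y) (h1 : y ≤ 1/2) : |DN N y| ≤ 1 / (2 * y) := by
  rw [DN_eq N h0 h1, abs_div, abs_of_pos (sin_pos' h0 h1)]
  exact div_le_div₀ zero_le_one (abs_sin_le_one _) (by positivity) (sin_lb h0.le h1)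

lemma inner_freq {N : ℕ} (hN : 1 ≤ N) {lam L κ δ : ℝ} (hκ : 0 < κ) (hl0 : 0 ≤ lam) (hlam : lam ≤ κ * N) (hL : 0 < L)
    (hδ0 : 0 < δ) (hδ : δ ≤ 1/2) (hδN : 4 * N * δ ^ 2 = 1) :
    ‖∫ y in (0:ℝ)..δ, (Complex.exp (I * (lam * exp (L * y) : ℝ)) +
      Complex.exp (I * (lam * exp (-L * y) : ℝ))) * (DN N y : ℂ)‖ ≤
      3 + κ * L ^ 2 * exp L := by
  have hN' : 1 ≤ N := by exact_mod_cast hN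
  set G : ℝ → ℝ → ℂ := fun ℓ y => Complex.exp (I * (lam * exp (ℓ * y) : ℝ)) with hG
  set K : ℝ → ℝ → ℂ := fun ℓ y => Complex.exp (I * (lam * (1 + ℓ * y) : ℝ)) with hK
  have hGK : ∀ ℓ y : ℝ, |ℓ| = L → 0 ≤ y → y ≤ 1 → ‖G ℓ y - K ℓ y‖ ≤ lam * (L ^ 2 * y ^ 2 * exp L) := by
    intro ℓ y hℓ hy0 hy1
    refine (exp_lip _ _).trans ?_
    rw [← mul_sub, abs_mul, abs_of_nonneg hl0]
    gcongr
    have := exp_lin (x := ℓ * y)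
    rw [abs_mul, hℓ, abs_of_nonneg hy0, mul_pow, ← sq_abs ℓ, hℓ] at this
    rw [sub_sub] at this
    refine this.trans ?_
    gcongr
    nlinarith
  have hc1 : Continuous fun y => (K L y + K (-L) y) * (DN N y : ℂ) := by
    have := DN_cont N
    simp only [hK]; fun_prop
  have hc2 : Continuous fun y => ((G L y - K L y) + (G (-L) y - K (-L) y)) * (DN N y : ℂ) := by
    have := DN_cont N
    simp only [hG, hK]; fun_prop
  have e : ∫ y in 0..δ, (G L y + G (-L) y) * (DN N y : ℂ) =
      (∫ y in 0..δ, (K L y + K (-L) y) * (DN N y : ℂ)) +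
      ∫ y in 0..δ, ((G L y - K L y) + (G (-L) y - K (-L) y)) * (DN N y : ℂ) := by
    rw [← integral_add (hc1.intervalIntegrable _ _) (hc2.intervalIntegrable _ _)]
    congr 1; ext y; ring
  have b2 : ‖∫ y in 0..δ, ((G L y - K L y) + (G (-L) y - K (-L) y)) * (DN N y : ℂ)‖ ≤
      κ * L ^ 2 * exp L := by
    have := norm_integral_le_of_norm_le_const (a := 0) (b := δ)
      (C := lam * L ^ 2 * exp L * δ)
      (f := fun y => ((G L y - K L y) + (G (-L) y - K (-L) y)) * (DN N y : ℂ)) (fun y hy => by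
        rw [uIoc_of_le hδ0.le] at hy
        have hy1 : y ≤ 1 := hy.2.trans (hδ.trans (by norm_num))
        have g1 := hGK L y (abs_of_pos hL) hy.1.le hy1
        have g2 := hGK (-L) y (by rw [abs_neg, abs_of_pos hL]) hy.1.le hy1
        have d := DN_abs2 N hy.1 (hy.2.trans hδ)
        have hy0 := hy.1
        rw [norm_mul, norm_real, norm_eq_abs]
        calc _ ≤ (2 * (lam * (L ^ 2 * y ^ 2 * exp L))) * (1 / (2 * y)) := by
              gcongr
              refine (norm_add_le _ _).trans ?_
              linarith
          _ = lam * L ^ 2 * exp L * y := by field_simp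
          _ ≤ _ := by gcongr; exact hy.2)
    refine this.trans ?_
    rw [sub_zero, abs_of_pos hδ0]
    have h1 : lam * δ ^ 2 ≤ κ := by
      have : lam * δ ^ 2 ≤ κ * N * δ ^ 2 := by gcongr
      nlinarith
    calc lam * L ^ 2 * exp L * δ * δ = (lam * δ ^ 2) * (L ^ 2 * exp L) := by ring
      _ ≤ κ * (L ^ 2 * exp L) := by gcongr
      _ = _ := by ring
  have b1 : ‖∫ y in 0..δ, (K L y + K (-L) y) * (DN N y : ℂ)‖ ≤ 3 := by
    have e1 : ∫ y in 0..δ, (K L y + K (-L) y) * (DN N y : ℂ) =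
        Complex.exp (I * lam) * (((∫ y in 0..δ, sin (((2 * N + 1) * π + lam * L) * y) / sin (π * y)) +
          ∫ y in 0..δ, sin (((2 * N + 1) * π - lam * L) * y) / sin (π * y) : ℝ) : ℂ) := by
      rw [← integral_add (sq_int le_rfl hδ0.le hδ) (sq_int le_rfl hδ0.le hδ),
        ← integral_ofReal, ← intervalIntegral.integral_const_mul]
      refine integral_congr_ae ?_
      filter_upwards with y hy
      rw [uIoc_of_le hδ0.le] at hy
      have e2 : K L y + K (-L) y = Complex.exp (I * lam) * (2 * cos (lam * L * y) : ℝ) := by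
        simp only [hK]
        push_cast
        rw [Complex.cos, mul_div_cancel₀ _ two_ne_zero, mul_add (Complex.exp _), ← Complex.exp_add, ← Complex.exp_add]
        ring_nf
      rw [e2, DN_eq N hy.1 (hy.2.trans hδ), mul_assoc, ← ofReal_mul]
      congr 2
      rw [← add_div, mul_div_assoc']
      congr 1
      rw [add_mul ((2 * N + 1) * π) (lam * L) y, sub_mul ((2 * N + 1) * π) (lam * L) y, sin_add, sin_sub]; ring
    rw [e1, norm_mul, mul_comm I lam, norm_exp_ofReal_mul_I, one_mul, norm_real, norm_eq_abs]
    refine (abs_add_le _ _).trans ?_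
    have := si_bdd (r := (2 * N + 1) * π + lam * L) hδ0.le hδ
    have := si_bdd (r := (2 * N + 1) * π - lam * L) hδ0.le hδ
    linarith
  rw [e]
  refine (norm_add_le _ _).trans ?_
  linarith

lemma fold {F : ℝ → ℂ} (hF : IntervalIntegrable F volume (-(1/2)) 0) (hF2 : IntervalIntegrable F volume 0 (1/2)) :
    ∫ y in (-(1/2:ℝ))..(1/2), F y = ∫ y in (0:ℝ)..(1/2), (F y + F (-y)) := by
  have hF' : IntervalIntegrable (fun y => F (-y)) volume 0 (1/2) := by
    have := (IntervalIntegrable.comp_sub_left hF 0)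
    simpa using this.symm
  rw [← integral_add_adjacent_intervals hF hF2,
    integral_add hF2 hF', integral_comp_neg]
  simp [add_comm]

lemma freq {L κ : ℝ} (hL : 0 < L) (hκ : 0 < κ) : ∃ C : ℝ, ∀ N : ℕ, 1 ≤ N → ∀ lam : ℝ,
    N / κ ≤ |lam| → |lam| ≤ κ * N →
    ‖∫ y in (-(1/2:ℝ))..(1/2), Complex.exp (I * (lam * exp (L * y) : ℝ)) * (DN N y : ℂ)‖ ≤ C := by
  refine ⟨3 + κ * L ^ 2 * exp L + 2 * (8 / √(L ^ 2 * exp (-L) / κ)), ?_⟩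
  intro N hN
  have hN' : (1:ℝ) ≤ N := mod_cast hN
  have hN0 : (0:ℝ) < N := by linarith
  have hcD := DN_cont N
  have pos : ∀ lam : ℝ, N / κ ≤ lam → lam ≤ κ * N →
    ‖∫ y in (-(1/2:ℝ))..(1/2), Complex.exp (I * (lam * exp (L * y) : ℝ)) * (DN N y : ℂ)‖ ≤
      3 + κ * L ^ 2 * exp L + 2 * (8 / √(L ^ 2 * exp (-L) / κ)) := by
    intro lam h1 h2
    have hl0 := lt_of_lt_of_le (by positivity) h1
    have hsN := sqrt_pos.2 hN0
    have hsN1 := one_le_sqrt.2 hN'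
    set δ := 1 / (2 * √N) with hδd
    have hδ0 : 0 < δ := by positivity
    have hδ : δ ≤ 1/2 := by
      rw [hδd]; apply one_div_le_one_div_of_le (by norm_num); linarith
    have hδN : 1 / (2 * δ) = √N := by rw [hδd]; field_simp
    have hδ2 : 4 * N * δ ^ 2 = 1 := by
      rw [hδd, div_pow, mul_pow, sq_sqrt hN0.le]; field_simp; norm_num
    have hcF : Continuous fun y : ℝ => Complex.exp (I * (lam * exp (L * y) : ℝ)) * (DN N y : ℂ) := by
      fun_prop
    have hcF2 : Continuous fun y : ℝ => (Complex.exp (I * (lam * exp (L * y) : ℝ)) +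
      Complex.exp (I * (lam * exp (-L * y) : ℝ))) * (DN N y : ℂ) := by
      fun_prop
    rw [fold (hcF.intervalIntegrable _ _) (hcF.intervalIntegrable _ _)]
    have e : ∀ y : ℝ, (Complex.exp (I * (lam * exp (L * y) : ℝ)) * (DN N y : ℂ) +
        Complex.exp (I * (lam * exp (L * (-y)) : ℝ)) * (DN N (-y) : ℂ)) =
        (Complex.exp (I * (lam * exp (L * y) : ℝ)) +
      Complex.exp (I * (lam * exp (-L * y) : ℝ))) * (DN N y : ℂ) := by
      intro y; rw [DN_even, add_mul, mul_neg, neg_mul]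
    simp only [e]
    rw [← integral_add_adjacent_intervals (b := δ) (hcF2.intervalIntegrable _ _) (hcF2.intervalIntegrable _ _)]
    refine (norm_add_le _ _).trans ?_
    have i1 := inner_freq hN hκ hl0.le h2 hL hδ0 hδ hδ2
    have o1 := outer_freq hN hκ h1 hL.ne' hδ0 hδ hδN
    have o2 := outer_freq hN hκ h1 (neg_ne_zero.2 hL.ne') hδ0 hδ hδN
    rw [abs_neg, neg_sq] at o2
    rw [abs_of_pos hL] at o1 o2
    have e3 : ∫ y in δ..(1/2), (Complex.exp (I * (lam * exp (L * y) : ℝ)) +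
      Complex.exp (I * (lam * exp (-L * y) : ℝ))) * (DN N y : ℂ) =
      (∫ y in δ..(1/2), Complex.exp (I * (lam * exp (L * y) : ℝ)) * (DN N y : ℂ)) +
      ∫ y in δ..(1/2), Complex.exp (I * (lam * exp (-L * y) : ℝ)) * (DN N y : ℂ) := by
      rw [← intervalIntegral.integral_add]
      · simp only [add_mul]
      · exact hcF.intervalIntegrable _ _
      · apply Continuous.intervalIntegrable; fun_prop
    rw [e3]
    have := norm_add_le (∫ y in δ..(1/2), Complex.exp (I * (lam * exp (L * y) : ℝ)) * (DN N y : ℂ))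
      (∫ y in δ..(1/2), Complex.exp (I * (lam * exp (-L * y) : ℝ)) * (DN N y : ℂ))
    linarith
  intro lam h1 h2
  rcases le_total 0 lam with h | h
  · rw [abs_of_nonneg h] at h1 h2
    exact pos lam h1 h2
  · rw [abs_of_nonpos h] at h1 h2
    have := pos (-lam) h1 h2
    refine le_trans (le_of_eq ?_) this
    rw [← RCLike.norm_conj, integral_of_le (by norm_num), ← integral_conj, integral_of_le (by norm_num)]
    congr 1
    refine integral_congr_ae (Eventually.of_forall fun y => ?_)
    simp only [map_mul, ← Complex.exp_conj, Complex.conj_I, Complex.conj_ofReal]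
    congr 2
    push_cast; ring

end Rid

namespace Rid

open MeasureTheory Filter Topology Set

lemma ibp_aux {q : ℝ → ℂ} (hqm : Measurable q) {B : ℝ} (hqb : ∀ x, ‖q x‖ ≤ B) {g : ℝ → ℂ} (hg : Continuous g)
    (A L a c : ℝ) : IntervalIntegrable (fun y => q (A * exp (L * y)) * g y) volume a c := by
  refine IntervalIntegrable.mono_fun (g := fun y => q (A * exp (L * y)) * g y)
    (f := fun y => (B * ‖g y‖ : ℝ)) ?_ ?_ ?_
  · apply Continuous.intervalIntegrable; fun_prop
  · have h1 : Measurable fun y : ℝ => A * exp (L * y) := by fun_prop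
    exact ((hqm.comp h1).mul hg.measurable).aestronglyMeasurable
  · refine Eventually.of_forall fun y => ?_
    simp only [norm_mul, norm_eq_abs, abs_norm]
    gcongr
    exact (hqb _).trans (le_abs_self B)

lemma ibp {Q q : ℝ → ℂ} (hQc : Continuous Q) (hQ : ∀ x, HasDerivWithinAt Q (q x) (Ioi x) x)
    (hqm : Measurable q) {B : ℝ} (hqb : ∀ x, ‖q x‖ ≤ B) {η : ℝ} (hη : ∀ x, ‖Q x‖ ≤ η)
    {w w' : ℝ → ℝ} (hw : ∀ y, HasDerivAt w (w' y) y) (hw' : Continuous w') {A L : ℝ} (hA : 0 < A) (hL : 0 < L) :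
    ‖∫ y in (-(1/2:ℝ))..(1/2), q (A * exp (L * y)) * (w y : ℂ)‖ ≤
      η * exp (L / 2) / (A * L) * (|w (1/2)| + |w (-(1/2))| + ∫ y in (-(1/2:ℝ))..(1/2), (|w' y| + L * |w y|)) := by
  have hwc : Continuous w := continuous_iff_continuousAt.2 fun y => (hw y).continuousAt
  have hη0 : 0 ≤ η := (norm_nonneg _).trans (hη 0)
  set u : ℝ → ℝ := fun y => w y * exp (-(L * y)) / (A * L) with hu
  set u' : ℝ → ℝ := fun y => (w' y - L * w y) * exp (-(L * y)) / (A * L) with hu'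
  have hud : ∀ y, HasDerivAt u (u' y) y := by
    intro y
    have h1 := ((hw y).mul (((hasDerivAt_id y).const_mul L).neg.exp)).div_const (A * L)
    refine (h1 : HasDerivAt u _ y).congr_deriv ?_
    simp only [hu', id, mul_one, Pi.neg_apply]; ring
  have huc : Continuous u := continuous_iff_continuousAt.2 fun y => (hud y).continuousAt
  have huc' : Continuous u' := by simp only [hu']; fun_prop
  have hvd : ∀ y, HasDerivWithinAt (Q ∘ fun y => A * exp (L * y))
      ((A * exp (L * y) * L : ℝ) • q (A * exp (L * y))) (Ioi y) y := by
    intro y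
    refine HasDerivWithinAt.scomp y (hQ _) ?_ ?_
    · have h1 := (((hasDerivAt_id y).const_mul L).exp.const_mul A).hasDerivWithinAt (s := Ioi y)
      refine h1.congr_deriv ?_
      simp; ring
    · intro z hz
      simp at *
      gcongr
  have key := integral_mul_deriv_eq_deriv_mul_of_hasDeriv_right
    (a := -(1/2:ℝ)) (b := 1/2) (u := fun y => (u y : ℂ)) (u' := fun y => (u' y : ℂ))
    (v := Q ∘ fun y => A * exp (L * y))
    (v' := fun y => ((A * exp (L * y) * L : ℝ) • q (A * exp (L * y))))
    (by fun_prop) (by fun_prop) (fun y _ => (hud y).ofReal_comp.hasDerivWithinAt) (fun y _ => hvd y)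
    (Continuous.intervalIntegrable (by fun_prop) _ _)
    (by
      have := ibp_aux hqm hqb (g := fun y => ((A * exp (L * y) * L : ℝ) : ℂ)) (by fun_prop) A L (-(1/2)) (1/2)
      refine this.congr ?_
      refine fun y _ => ?_
      simp; ring)
  have e : ∫ y in (-(1/2:ℝ))..(1/2), q (A * exp (L * y)) * (w y : ℂ) =
      ∫ y in (-(1/2:ℝ))..(1/2), (u y : ℂ) * ((A * exp (L * y) * L : ℝ) • q (A * exp (L * y))) := by
    refine integral_congr fun y _ => ?_
    beta_reduce
    have : u y * (A * exp (L * y) * L) = w y := by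
      simp only [hu]; rw [exp_neg]; field_simp
    rw [Complex.real_smul, ← mul_assoc, ← ofReal_mul, this, mul_comm]
  rw [e, key]
  set E := exp (L / 2) with hE
  have hexp : ∀ y ∈ Icc (-(1/2:ℝ)) (1/2), exp (-(L * y)) ≤ E := by
    intro y hy
    apply exp_le_exp.2
    nlinarith [hy.1]
  have hub : ∀ y ∈ Icc (-(1/2:ℝ)) (1/2), ‖(u y : ℂ) * Q (A * exp (L * y))‖ ≤ η * E / (A * L) * |w y| := by
    intro y hy
    rw [norm_mul, norm_real, norm_eq_abs, hu, abs_div, abs_mul, abs_of_pos (exp_pos _), abs_of_pos (by positivity : 0 < A * L)]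
    calc |w y| * exp (-(L * y)) / (A * L) * ‖Q (A * exp (L * y))‖ ≤ |w y| * E / (A * L) * η := by
          gcongr
          · exact hexp y hy
          · exact hη _
      _ = _ := by ring
  have b1 := hub (1/2) (by constructor <;> norm_num)
  have b2 := hub (-(1/2)) (by constructor <;> norm_num)
  have b3 : ‖∫ y in (-(1/2:ℝ))..(1/2), (u' y : ℂ) * (Q ∘ fun y => A * exp (L * y)) y‖ ≤
      ∫ y in (-(1/2:ℝ))..(1/2), η * E / (A * L) * (|w' y| + L * |w y|) := by
    refine norm_integral_le_of_norm_le (by norm_num) (Eventually.of_forall fun y hy => ?_)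
      (Continuous.intervalIntegrable (by fun_prop) _ _)
    rw [norm_mul, norm_real, norm_eq_abs, hu', abs_div, abs_mul, abs_of_pos (exp_pos _), abs_of_pos (by positivity : 0 < A * L)]
    calc |w' y - L * w y| * exp (-(L * y)) / (A * L) * ‖(Q ∘ fun y => A * exp (L * y)) y‖
        ≤ (|w' y| + L * |w y|) * E / (A * L) * η := by
          gcongr
          · refine (abs_sub _ _).trans ?_
            rw [abs_mul, abs_of_pos hL]
          · exact hexp y ⟨hy.1.le, hy.2⟩
          · exact hη _
      _ = _ := by ring
  rw [intervalIntegral.integral_const_mul] at b3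
  refine (norm_sub_le _ _).trans ?_
  have := norm_sub_le ((u (1/2) : ℂ) * (Q ∘ fun y => A * exp (L * y)) (1/2))
    ((u (-(1/2)) : ℂ) * (Q ∘ fun y => A * exp (L * y)) (-(1/2)))
  simp only [Function.comp] at this b3 ⊢
  linarith

lemma DN'_odd (N : ℕ) (y : ℝ) : |DN' N (-y)| = |DN' N y| := by
  have : DN' N (-y) = - DN' N y := by
    simp only [DN', mul_neg, sin_neg, neg_mul, sum_neg_distrib]
  rw [this, abs_neg]

lemma fold_re {F : ℝ → ℝ} (hF : Continuous F) :
    ∫ y in (-(1/2:ℝ))..(1/2), F y = ∫ y in (0:ℝ)..(1/2), (F y + F (-y)) := by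
  have hF' : Continuous fun y => F (-y) := by fun_prop
  rw [← integral_add_adjacent_intervals (b := 0) (hF.intervalIntegrable _ _) (hF.intervalIntegrable _ _),
    integral_add (hF.intervalIntegrable _ _) (hF'.intervalIntegrable _ _)]
  simp [add_comm]

lemma log_lb {N : ℕ} (hN : 2 ≤ N) : 1/2 ≤ log N := by
  have := log_two_gt_d9
  have : log 2 ≤ log N := log_le_log (by norm_num) (mod_cast hN)
  linarith

lemma DN_weight {N : ℕ} (hN : 2 ≤ N) {L : ℝ} (hL : 0 < L) :
    |DN N (1/2)| + |DN N (-(1/2))| + ∫ y in (-(1/2:ℝ))..(1/2), (|DN' N y| + L * |DN N y|) ≤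
      (72 + 6 * L) * (N * log N) := by
  have hl := log_lb hN
  have hN' : (2:ℝ) ≤ N := by exact_mod_cast hN
  have d1 := DN_abs N (1/2)
  have d2 := DN_abs N (-(1/2))
  have hc := DN_cont N
  have hc' := DN'_cont N
  obtain ⟨li, lb⟩ := log_int hN
  have i1 : ∫ y in (-(1/2:ℝ))..(1/2), |DN' N y| ≤ 60 * (N * log N) := by
    rw [fold_re (by fun_prop)]
    have : ∫ y in (0:ℝ)..(1/2), (|DN' N y| + |DN' N (-y)|) ≤ ∫ y in (0:ℝ)..(1/2), (60 * N ^ 2 : ℝ) * (1 / (1 + N * y)) := by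
      refine intervalIntegral.integral_mono_on (by norm_num) (Continuous.intervalIntegrable (by fun_prop) _ _) (li.const_mul _) ?_
      intro y hy
      rw [DN'_odd]
      have := DN'_bd (by omega : 1 ≤ N) hy.1 hy.2
      calc _ ≤ 2 * (30 * (N:ℝ) ^ 2 / (1 + N * y)) := by linarith
        _ = _ := by ring
    refine this.trans ?_
    rw [intervalIntegral.integral_const_mul]
    calc _ ≤ (60 * N ^ 2 : ℝ) * (log N / N) := by gcongr
      _ = _ := by field_simp
  have i2 : ∫ y in (-(1/2:ℝ))..(1/2), L * |DN N y| ≤ L * (2 * N + 1) := by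
    have : ∫ y in (-(1/2:ℝ))..(1/2), L * |DN N y| ≤ ∫ y in (-(1/2:ℝ))..(1/2), L * (2 * N + 1) := by
      refine intervalIntegral.integral_mono_on (by norm_num) (Continuous.intervalIntegrable (by fun_prop) _ _) (by simp) ?_
      intro y hy
      gcongr
      exact DN_abs N y
    refine this.trans (le_of_eq ?_)
    rw [intervalIntegral.integral_const]; norm_num
  rw [integral_add (Continuous.intervalIntegrable (by fun_prop) _ _) (Continuous.intervalIntegrable (by fun_prop) _ _)]
  have : (N:ℝ) ≤ 2 * (N * log N) := by nlinarith
  nlinarith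

lemma ibp_DN {Q q : ℝ → ℂ} (hQc : Continuous Q) (hQ : ∀ x, HasDerivWithinAt Q (q x) (Ioi x) x)
    (hqm : Measurable q) {B : ℝ} (hqb : ∀ x, ‖q x‖ ≤ B) {η : ℝ} (hη : ∀ x, ‖Q x‖ ≤ η)
    {A L : ℝ} (hA : 0 < A) (hL : 0 < L) {N : ℕ} (hN : 2 ≤ N) :
    ‖∫ y in (-(1/2:ℝ))..(1/2), q (A * exp (L * y)) * (DN N y : ℂ)‖ ≤
      η * (exp (L / 2) / L * (72 + 6 * L)) * (N / A * log N) := by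
  have h := ibp hQc hQ hqm hqb hη (DN_hasDeriv N) (DN'_cont N) hA hL
  have hη0 := (norm_nonneg _).trans (hη 0)
  refine h.trans ?_
  calc _ ≤ η * exp (L / 2) / (A * L) * ((72 + 6 * L) * (N * log N)) := by
        gcongr; exact DN_weight hN hL
    _ = _ := by field_simp

end Rid

namespace Rid

open MeasureTheory Filter Topology Set

noncomputable def TT (k : ℕ) (L : ℝ) (N : ℕ) (A : ℝ) : ℝ :=
  ∫ y in (-(1/2:ℝ))..(1/2), pf (k+1) (A * exp (L * y)) * DN N y

noncomputable def MM (k : ℕ) (L : ℝ) (A : ℝ) : ℝ :=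
  ∫ y in (-(1/2:ℝ))..(1/2), pf (k+1) (A * exp (L * y))

noncomputable def QF (k : ℕ) (x : ℝ) : ℝ := pf (k+2) x / (k+2)

lemma QF_deriv (k : ℕ) (x : ℝ) : HasDerivWithinAt (QF k) (pf (k+1) x) (Ioi x) x := by
  have := (pf_right (k+1) x).div_const (k+2)
  refine (this : HasDerivWithinAt (QF k) _ _ _).congr_deriv ?_
  push_cast; field

lemma QF_cont (k : ℕ) : Continuous (QF k) := by
  have := pf_cont (m := k+2) (by omega)
  unfold QF; fun_prop

lemma QF_bdd (k : ℕ) : ∃ C > 0, ∀ x, |QF k x| ≤ C := by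
  obtain ⟨C, hC, h⟩ := pf_bdd (k+2)
  refine ⟨C, hC, fun x => ?_⟩
  rw [QF, abs_div, abs_of_pos (by positivity : (0:ℝ) < k + 2)]
  refine (div_le_self (abs_nonneg _) ?_).trans (h x)
  linarith

lemma TT_norm (k : ℕ) (L : ℝ) (N : ℕ) (A : ℝ) : |TT k L N A| =
    ‖∫ y in (-(1/2:ℝ))..(1/2), (pf (k+1) (A * exp (L * y)) : ℂ) * (DN N y : ℂ)‖ := by
  rw [← norm_eq_abs, ← norm_real, TT, ← integral_ofReal]
  push_cast; rfl

lemma pfc_meas (m : ℕ) : Measurable fun x => (pf m x : ℂ) := measurable_ofReal.comp (pf_meas m)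

lemma TT_tail (k : ℕ) {L : ℝ} (hL : 0 < L) : ∃ C > 0, ∀ N : ℕ, 2 ≤ N → ∀ A > 0,
    |TT k L N A| ≤ C * (N / A * log N) := by
  obtain ⟨C, hC, h⟩ := QF_bdd k
  obtain ⟨B, hB, hb⟩ := pf_bdd (k+1)
  refine ⟨C * (exp (L / 2) / L * (72 + 6 * L)), by positivity, fun N hN A hA => ?_⟩
  rw [TT_norm]
  have hc := QF_cont k
  exact ibp_DN (Q := fun x => (QF k x : ℂ)) (q := fun x => (pf (k+1) x : ℂ)) (by fun_prop)
    (fun x => (QF_deriv k x).ofReal_comp) (pfc_meas _) (B := B) (fun x => by simpa using hb x)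
    (fun x => by simpa using h x) hA hL hN

lemma MM_bd (k : ℕ) {L : ℝ} (hL : 0 < L) : ∃ C > 0, ∀ A > 0, |MM k L A| ≤ C / A := by
  obtain ⟨C, hC, h⟩ := QF_bdd k
  obtain ⟨B, hB, hb⟩ := pf_bdd (k+1)
  refine ⟨C * exp (L / 2) / L * (2 + L), by positivity, fun A hA => ?_⟩
  have hc := QF_cont k
  have := ibp (Q := fun x => (QF k x : ℂ)) (q := fun x => (pf (k+1) x : ℂ)) (by fun_prop)
    (fun x => (QF_deriv k x).ofReal_comp) (pfc_meas _) (B := B) (fun x => by simpa using hb x)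
    (fun x => by simpa using h x) (w := fun _ => 1) (w' := fun _ => 0) (fun y => hasDerivAt_const _ _) (by fun_prop) hA hL
  have e : |MM k L A| = ‖∫ y in (-(1/2:ℝ))..(1/2), (pf (k+1) (A * exp (L * y)) : ℂ) * (1 : ℂ)‖ := by
    rw [← norm_eq_abs, ← norm_real, MM, ← integral_ofReal]
    simp
  rw [e]
  refine this.trans (le_of_eq ?_)
  simp
  field

lemma fourier_approx (k : ℕ) {ε : ℝ} (hε : 0 < ε) : ∃ (S : Finset ℤ) (c : ℤ → ℂ), ∀ x : ℝ,
    ‖(QF k x : ℂ) - ∑ n ∈ S, c n * Complex.exp (I * (2 * π * n * x : ℝ))‖ ≤ ε := by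
  set D : ℂ := -((k+2).factorial : ℂ) / (2 * π * I) ^ (k+2) / (k+2) with hD
  have hs : ∀ x : ℝ, HasSum (fun n : ℤ => D * (1 / (n:ℂ) ^ (k+2)) * Complex.exp (I * (2 * π * n * x : ℝ)))
      (QF k x : ℂ) := by
    intro x
    have h := (hasSum_one_div_pow_mul_fourier_mul_bernoulliFun (k := k+2) (by omega) (x := Int.fract x)
      ⟨Int.fract_nonneg x, (Int.fract_lt_one x).le⟩).mul_left D
    have e1 : (fun n : ℤ => D * (1 / n ^ (k+2)) * Complex.exp (I * (2 * π * n * x : ℝ))) =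
        fun n : ℤ => D * (1 / n ^ (k+2) * fourier n ((Int.fract x : ℝ) : UnitAddCircle)) := by
      funext n
      rw [fourier_coe_apply, mul_assoc]
      congr 2
      have : (x:ℂ) = ((⌊x⌋ : ℤ) : ℂ) + (Int.fract x : ℝ) := by
        exact_mod_cast (Int.floor_add_fract x).symm
      push_cast
      rw [this, Complex.exp_eq_exp_iff_exists_int]
      refine ⟨n * ⌊x⌋, ?_⟩
      push_cast; ring
    have e2 : (QF k x : ℂ) = D * (-(2 * π * I) ^ (k + 2) / (k + 2).factorial * (bernoulliFun (k + 2) (Int.fract x) : ℂ)) := by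
      have hf : ((k+2).factorial : ℂ) ≠ 0 := mod_cast (Nat.factorial_pos _).ne'
      rw [QF, hD]
      push_cast
      rw [pf]
      field_simp
    rw [e1, e2]; exact h
  have hsum : Summable fun n : ℤ => ‖D * (1 / n ^ (k+2))‖ := by
    simp
    apply Summable.mul_left
    have := (summable_one_div_int_pow (p := k+2)).2 (by omega)
    refine this.norm.congr fun n => ?_
    simp
  have ht := tendsto_tsum_compl_atTop_zero (fun n : ℤ => ‖D * (1 / n ^ (k+2))‖)
  obtain ⟨S, hS⟩ := ((tendsto_order.1 ht).2 ε hε).exists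
  refine ⟨S, fun n => D * (1 / n ^ (k+2)), fun x => ?_⟩
  have h2 := (hs x).summable.sum_add_tsum_subtype_compl S
  rw [(hs x).tsum_eq] at h2
  rw [← h2, add_sub_cancel_left]
  have hn : ∀ n : ℤ, ‖D * (1 / n ^ (k+2)) * Complex.exp (I * (2 * π * n * x : ℝ))‖ = ‖D * (1 / n ^ (k+2))‖ := by
    intro n
    rw [norm_mul, mul_comm I, norm_exp_ofReal_mul_I, mul_one]
  refine le_trans (norm_tsum_le_tsum_norm ?_) ?_
  · simp only [hn]; exact hsum.subtype _
  · simp only [hn]; exact hS.le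

lemma critical (k : ℕ) {L K ε : ℝ} (hL : 0 < L) (hK : 0 < K) (hε : 0 < ε) :
    ∃ N0 : ℕ, ∀ N ≥ N0, ∀ A : ℝ, N / K ≤ A → A ≤ K * N → |TT k L N A| ≤ ε * Real.log N := by
  set G := Real.exp (L / 2) / L * (72 + 6 * L) with hG
  have hG0 : 0 < G := by positivity
  obtain ⟨S, c, hS⟩ := fourier_approx k (ε := ε / (2 * (G * K))) (by positivity)
  obtain ⟨B, hB, hb⟩ := pf_bdd (k+1)
  set p : ℝ → ℂ := fun x => ∑ n ∈ S, c n * (Complex.exp (I * (2 * Real.pi * n * x : ℝ)) * (I * (2 * Real.pi * n : ℝ))) with hp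
  have hpd : ∀ x, HasDerivAt (fun x : ℝ => ∑ n ∈ S, c n * Complex.exp (I * (2 * Real.pi * n * x : ℝ))) (p x) x := by
    intro x
    apply HasDerivAt.fun_sum
    intro n _
    apply HasDerivAt.const_mul
    have h1 : HasDerivAt (fun x : ℝ => (2 * Real.pi * n * x : ℝ)) (2 * Real.pi * n) x := by
      simpa using (hasDerivAt_id x).const_mul (2 * Real.pi * n)
    exact (h1.ofReal_comp.const_mul I).cexp
  have hpc : Continuous p := by simp only [hp]; fun_prop
  have hpb : ∀ x, ‖p x‖ ≤ ∑ n ∈ S, ‖c n‖ * |2 * Real.pi * n| := by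
    intro x
    refine (norm_sum_le _ _).trans (sum_le_sum fun n _ => ?_)
    rw [norm_mul, norm_mul, norm_mul, mul_comm I, norm_exp_ofReal_mul_I, norm_I, norm_real,
      Real.norm_eq_abs, one_mul, one_mul]
  have hfr : ∀ n : ℤ, ∃ C : ℝ, 0 ≤ C ∧ ∀ N : ℕ, 1 ≤ N → ∀ A : ℝ, N / K ≤ A → A ≤ K * N →
      ‖∫ y in (-(1/2:ℝ))..(1/2), c n * (Complex.exp (I * (2 * Real.pi * n * (A * Real.exp (L * y)) : ℝ)) * (I * (2 * Real.pi * n : ℝ))) * (DN N y : ℂ)‖ ≤ C := by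
    intro n
    rcases eq_or_ne n 0 with rfl | hn
    · exact ⟨0, le_rfl, fun N hN A _ _ => by simp⟩
    have hn1 : (1:ℝ) ≤ |(n:ℝ)| := by exact_mod_cast Int.one_le_abs hn
    have h2 : 1 ≤ 2 * Real.pi * |(n:ℝ)| := by nlinarith [Real.pi_gt_three]
    obtain ⟨C, hC⟩ := freq (κ := 2 * Real.pi * |(n:ℝ)| * K) hL (by positivity)
    have hC0 : ∀ N : ℕ, 1 ≤ N → ∀ A : ℝ, N / K ≤ A → A ≤ K * N → ‖∫ y in (-(1/2:ℝ))..(1/2), c n * (Complex.exp (I * (2 * Real.pi * n * (A * Real.exp (L * y)) : ℝ)) * (I * (2 * Real.pi * n : ℝ))) * (DN N y : ℂ)‖ ≤ ‖c n‖ * |2 * Real.pi * n| * |C| := by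
      intro N hN A h3 h4
      have hA0 : 0 ≤ A := le_trans (by positivity) h3
      have := hC N hN (2 * Real.pi * n * A) (by
          rw [abs_mul, abs_mul, abs_of_pos Real.two_pi_pos, abs_of_nonneg hA0]
          calc (N:ℝ) / (2 * Real.pi * |(n:ℝ)| * K) = N / K / (2 * Real.pi * |(n:ℝ)|) := by field_simp
            _ ≤ N / K := div_le_self (by positivity) h2
            _ ≤ A := h3
            _ ≤ _ := le_mul_of_one_le_left hA0 h2) (by
          rw [abs_mul, abs_mul, abs_of_pos Real.two_pi_pos, abs_of_nonneg hA0, mul_assoc _ K]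
          gcongr)
      have e : ∫ y in (-(1/2:ℝ))..(1/2), c n * (Complex.exp (I * (2 * Real.pi * n * (A * Real.exp (L * y)) : ℝ)) * (I * (2 * Real.pi * n : ℝ))) * (DN N y : ℂ)
         = (c n * (I * (2 * Real.pi * n : ℝ))) * ∫ y in (-(1/2:ℝ))..(1/2), Complex.exp (I * (2 * Real.pi * n * A * Real.exp (L * y) : ℝ)) * (DN N y : ℂ) := by
        rw [← intervalIntegral.integral_const_mul]
        refine integral_congr fun y _ => ?_
        beta_reduce
        rw [mul_assoc (2 * Real.pi * (n:ℝ)) A]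
        ring
      rw [e, norm_mul, norm_mul, norm_mul, norm_I, one_mul, norm_real, Real.norm_eq_abs]
      gcongr
      exact this.trans (le_abs_self C)
    exact ⟨_, by positivity, hC0⟩
  choose C hC0 hC using hfr
  have hlog : Tendsto (fun N : ℕ => ε / 2 * Real.log N) atTop atTop :=
    (Real.tendsto_log_atTop.comp tendsto_natCast_atTop_atTop).const_mul_atTop (by positivity)
  obtain ⟨N0, hN0⟩ := eventually_atTop.1 (hlog.eventually_ge_atTop (∑ n ∈ S, C n))
  refine ⟨max N0 2, fun N hN A h1 h2 => ?_⟩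
  have hN2 : 2 ≤ N := le_trans (le_max_right _ _) hN
  have hN' : (2:ℝ) ≤ N := by exact_mod_cast hN2
  have hl := log_lb hN2
  have hA : 0 < A := lt_of_lt_of_le (by positivity) h1
  have hQc := QF_cont k
  have hDc := DN_cont N
  have i1 := ibp_DN (Q := fun x => (QF k x : ℂ) - ∑ n ∈ S, c n * Complex.exp (I * (2 * Real.pi * n * x : ℝ)))
    (q := fun x => (pf (k+1) x : ℂ) - p x) (by fun_prop)
    (fun x => (QF_deriv k x).ofReal_comp.fun_sub (hpd x).hasDerivWithinAt) ((pfc_meas _).sub hpc.measurable)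
    (B := B + ∑ n ∈ S, ‖c n‖ * |2 * Real.pi * n|) (fun x => (norm_sub_le _ _).trans (add_le_add (by simpa using hb x) (hpb x)))
    hS hA hL hN2
  rw [TT_norm]
  have e : ∫ y in (-(1/2:ℝ))..(1/2), (pf (k+1) (A * Real.exp (L * y)) : ℂ) * (DN N y : ℂ) =
      (∫ y in (-(1/2:ℝ))..(1/2), ((pf (k+1) (A * Real.exp (L * y)) : ℂ) - p (A * Real.exp (L * y))) * (DN N y : ℂ)) +
      ∑ n ∈ S, ∫ y in (-(1/2:ℝ))..(1/2), c n * (Complex.exp (I * (2 * Real.pi * n * (A * Real.exp (L * y)) : ℝ)) * (I * (2 * Real.pi * n : ℝ))) * (DN N y : ℂ) := by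
    rw [← intervalIntegral.integral_finset_sum (fun n _ => Continuous.intervalIntegrable (by fun_prop) _ _),
      ← intervalIntegral.integral_add]
    · refine intervalIntegral.integral_congr fun y _ => ?_
      simp only [hp, ← sum_mul]; ring
    · simp only [sub_mul]
      refine IntervalIntegrable.sub (ibp_aux (pfc_meas (k+1)) (B := B) (fun x => by simpa using hb x) (by fun_prop) _ _ _ _) ?_
      exact Continuous.intervalIntegrable (by fun_prop) _ _
    · exact Continuous.intervalIntegrable (by fun_prop) _ _
  rw [e]
  refine (norm_add_le _ _).trans ?_
  have i2 : ‖∑ n ∈ S, ∫ y in (-(1/2:ℝ))..(1/2), c n * (Complex.exp (I * (2 * Real.pi * n * (A * Real.exp (L * y)) : ℝ)) * (I * (2 * Real.pi * n : ℝ))) * (DN N y : ℂ)‖ ≤ ε / 2 * Real.log N := by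
    refine (norm_sum_le _ _).trans (le_trans ?_ (hN0 N (le_trans (le_max_left _ _) hN)))
    exact sum_le_sum fun n _ => hC n N (by omega) A h1 h2
  have i3 : ε / (2 * (G * K)) * G * (N / A * Real.log N) ≤ ε / 2 * Real.log N := by
    have : (N:ℝ) / A ≤ K := by
      rw [div_le_iff₀ hA]; rw [div_le_iff₀ hK] at h1; linarith
    calc _ ≤ ε / (2 * (G * K)) * G * (K * Real.log N) := by gcongr
      _ = _ := by field_simp
  linarith

end Rid

namespace Rid

open MeasureTheory Filter Topology Set

lemma bi {s g : ℝ → ℝ} (hs : Measurable s) {B : ℝ} (hb : ∀ x, |s x| ≤ B) (hg : Continuous g) (a c : ℝ) :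
    IntervalIntegrable (fun y => s y * g y) volume a c := by
  refine IntervalIntegrable.mono_fun (f := fun y => (B * ‖g y‖ : ℝ)) ?_ (hs.mul hg.measurable).aestronglyMeasurable ?_
  · apply Continuous.intervalIntegrable; fun_prop
  · refine Eventually.of_forall fun y => ?_
    simp only [norm_eq_abs, abs_mul, abs_abs]
    exact mul_le_mul_of_nonneg_right ((hb y).trans (le_abs_self B)) (abs_nonneg _)

lemma lip_half {φ φ' : ℝ → ℝ} (hφc : Continuous φ) (hφ : ∀ x, HasDerivWithinAt φ (φ' x) (Ioi x) x)
    (hm : Measurable φ') {B : ℝ} (hb : ∀ x, |φ' x| ≤ B) {A L : ℝ} (hA : 0 < A) (hL : 0 < L) {N : ℕ}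
    {a c : ℝ} (hac : a ≤ c) (hc : c ≤ 1/2) {V m : ℝ → ℝ} (hV : ∀ y, HasDerivAt V (DN N y) y)
    (h0 : (φ (A * exp (L * c)) - φ A) * V c = 0) (h1 : (φ (A * exp (L * a)) - φ A) * V a = 0)
    (hVm : ∀ y ∈ Icc a c, |V y| ≤ m y) (hmi : IntervalIntegrable m volume a c) :
    |∫ y in a..c, (φ (A * exp (L * y)) - φ A) * DN N y| ≤ B * (A * exp (L / 2) * L) * ∫ y in a..c, m y := by
  have hVc : Continuous V := continuous_iff_continuousAt.2 fun y => (hV y).continuousAt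
  have hDc := DN_cont N
  have hB0 : 0 ≤ B := (abs_nonneg _).trans (hb 0)
  have hvd : ∀ y, HasDerivWithinAt (fun y => φ (A * exp (L * y)) - φ A)
      (φ' (A * exp (L * y)) * (A * exp (L * y) * L)) (Ioi y) y := by
    intro y
    have : HasDerivWithinAt (φ ∘ fun y => A * exp (L * y))
      ((A * exp (L * y) * L) • φ' (A * exp (L * y))) (Ioi y) y := by
      refine HasDerivWithinAt.scomp y (hφ _) ?_ ?_
      · have h1 := (((hasDerivAt_id y).const_mul L).exp.const_mul A).hasDerivWithinAt (s := Ioi y)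
        refine h1.congr_deriv ?_
        simp only [id, mul_one]; ring
      · intro z hz
        simp only [mem_Ioi] at *
        gcongr
    exact (this.sub_const (φ A)).congr_deriv (by rw [smul_eq_mul, mul_comm])
  have key := integral_mul_deriv_eq_deriv_mul_of_hasDeriv_right
    (a := a) (b := c) (u := fun y => φ (A * exp (L * y)) - φ A)
    (u' := fun y => φ' (A * exp (L * y)) * (A * exp (L * y) * L)) (v := V) (v' := DN N)
    (by fun_prop) (by fun_prop) (fun y _ => hvd y) (fun y _ => (hV y).hasDerivWithinAt)
    (bi (s := fun y => φ' (A * exp (L * y))) (hm.comp (by fun_prop)) (fun x => hb _) (by fun_prop) _ _)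
    (hDc.intervalIntegrable _ _)
  rw [key, h0, h1, sub_zero, zero_sub, abs_neg, ← intervalIntegral.integral_const_mul, ← norm_eq_abs]
  refine norm_integral_le_of_norm_le hac (Eventually.of_forall fun y hy => ?_) (hmi.const_mul _)
  rw [norm_eq_abs, abs_mul, abs_mul, abs_of_pos (by positivity : 0 < A * exp (L * y) * L)]
  have : exp (L * y) ≤ exp (L / 2) := exp_le_exp.2 (by nlinarith [hy.2])
  gcongr
  · exact hb _
  · exact hVm y ⟨hy.1.le, hy.2⟩

lemma JN_half (N : ℕ) : JN N (1/2) = 0 := by simp [JN]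

lemma lipJ {φ φ' : ℝ → ℝ} (hφc : Continuous φ) (hφ : ∀ x, HasDerivWithinAt φ (φ' x) (Ioi x) x)
    (hm : Measurable φ') {B : ℝ} (hb : ∀ x, |φ' x| ≤ B) {A L : ℝ} (hA : 0 < A) (hL : 0 < L) {N : ℕ} (hN : 2 ≤ N) :
    |∫ y in (-(1/2:ℝ))..(1/2), (φ (A * exp (L * y)) - φ A) * DN N y| ≤
      12 * B * exp (L / 2) * L * (A / N * log N) := by
  have hDc := DN_cont N
  have hB0 := (abs_nonneg _).trans (hb 0)
  obtain ⟨li, lb⟩ := log_int hN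
  have h1 := lip_half hφc hφ hm hb hA hL (N := N) (a := 0) (c := 1/2) (V := fun y => -JN N y) (m := fun y => 6 * (1 / (1 + N * y)))
    (by norm_num) le_rfl (fun y => by simpa using (JN_deriv N y).fun_neg) (by rw [JN_half]; simp) (by simp)
    (fun y hy => by
      rw [abs_neg, mul_one_div]; exact JN_bd (by omega) hy.1 hy.2) (li.const_mul _)
  have lin : IntervalIntegrable (fun y : ℝ => 6 * (1 / (1 + N * (-y)))) volume (-(1/2)) 0 := by
    have := (IntervalIntegrable.comp_sub_left (li.const_mul 6) 0)
    simp only [zero_sub, sub_zero] at this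
    exact this.symm
  have h2 := lip_half hφc hφ hm hb hA hL (N := N) (a := -(1/2)) (c := 0) (V := fun y => JN N (-y)) (m := fun y => 6 * (1 / (1 + N * (-y))))
    (by norm_num) (by norm_num) (fun y => by
      have := (JN_deriv N (-y)).scomp y (hasDerivAt_neg y)
      refine (this : HasDerivAt (fun y => JN N (-y)) _ y).congr_deriv ?_
      rw [DN_even]; simp) (by simp) (by rw [neg_neg, JN_half]; simp)
    (fun y hy => by
      rw [mul_one_div]; exact JN_bd (by omega) (by linarith [hy.2]) (by linarith [hy.1])) lin
  have e : ∫ y in (-(1/2:ℝ))..0, 6 * (1 / (1 + N * (-y))) = ∫ y in 0..(1/2), 6 * (1 / (1 + N * y)) := by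
    rw [integral_comp_neg (fun y => 6 * (1 / (1 + N * y)))]; simp
  rw [e] at h2
  rw [intervalIntegral.integral_const_mul] at h1 h2
  have hc : Continuous fun y => (φ (A * exp (L * y)) - φ A) * DN N y := by fun_prop
  rw [← integral_add_adjacent_intervals (b := 0) (hc.intervalIntegrable _ _) (hc.intervalIntegrable _ _)]
  refine (abs_add_le _ _).trans ?_
  have h3 : B * (A * exp (L / 2) * L) * (6 * ∫ y in 0..(1/2), 1 / (1 + N * y)) ≤
      B * (A * exp (L / 2) * L) * (6 * (log N / N)) := by gcongr
  calc _ ≤ 2 * (B * (A * exp (L / 2) * L) * (6 * (log N / N))) := by linarith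
    _ = _ := by ring

lemma jump {N : ℕ} (hN : 1 ≤ N) (θ : ℝ) :
    |∫ y in (-(1/2:ℝ))..(1/2), ((if θ ≤ y then 1 else 0) - (if θ ≤ 0 then 1 else 0) : ℝ) * DN N y| ≤ 6 / (1 + N * |θ|) := by
  have hDc := DN_cont N
  have hne : ∀ᵐ y : ℝ, y ≠ θ := by simp [ae_iff]
  have hint : ∀ a c : ℝ, IntervalIntegrable (fun y => ((if θ ≤ y then 1 else 0) - (if θ ≤ 0 then 1 else 0) : ℝ) * DN N y) volume a c := by
    intro a c
    refine bi (B := 1) ?_ ?_ hDc a c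
    · exact (Measurable.ite measurableSet_Ici measurable_const measurable_const).sub_const _
    · intro x; split_ifs <;> norm_num
  by_cases ha : |θ| ≤ 1/2
  · obtain ⟨h1, h2⟩ := abs_le.1 ha
    rw [← integral_add_adjacent_intervals (hint _ θ) (hint θ _)]
    have i1 : ∫ y in (-(1/2:ℝ))..θ, ((if θ ≤ y then 1 else 0) - (if θ ≤ 0 then 1 else 0) : ℝ) * DN N y =
        ∫ y in (-(1/2:ℝ))..θ, (-(if θ ≤ 0 then 1 else 0) : ℝ) * DN N y := by
      refine integral_congr_ae ?_
      filter_upwards [hne] with y hy hy2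
      rw [uIoc_of_le h1] at hy2
      rw [if_neg (by push Not; exact lt_of_le_of_ne hy2.2 hy), zero_sub]
    have i2 : ∫ y in θ..(1/2), ((if θ ≤ y then 1 else 0) - (if θ ≤ 0 then 1 else 0) : ℝ) * DN N y =
        ∫ y in θ..(1/2), (1 - (if θ ≤ 0 then 1 else 0) : ℝ) * DN N y := by
      refine integral_congr_ae (Eventually.of_forall fun y hy2 => ?_)
      rw [uIoc_of_le h2] at hy2
      rw [if_pos hy2.1.le]
    rw [i1, i2, intervalIntegral.integral_const_mul, intervalIntegral.integral_const_mul]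
    by_cases h0 : θ ≤ 0
    · have e : ∫ y in (-(1/2:ℝ))..θ, DN N y = JN N (-θ) := by
        have := integral_comp_neg (fun y => DN N y) (a := -(1/2)) (b := θ)
        simp only [DN_even, neg_neg] at this
        rw [this, JN]
      have := JN_bd hN (u := -θ) (by linarith) (by linarith)
      simp only [h0, if_true, sub_self, zero_mul, add_zero, e]
      rw [abs_of_nonpos h0, neg_mul, one_mul, abs_neg]; exact this
    · push Not at h0
      have := JN_bd hN (u := θ) h0.le h2
      simp only [not_le.2 h0, if_false, neg_zero, zero_mul, zero_add, sub_zero, one_mul]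
      rw [abs_of_pos h0]; exact this
  · have : ∫ y in (-(1/2:ℝ))..(1/2), ((if θ ≤ y then 1 else 0) - (if θ ≤ 0 then 1 else 0) : ℝ) * DN N y =
        ∫ y in (-(1/2:ℝ))..(1/2), 0 := by
      refine integral_congr_ae (Eventually.of_forall fun y hy => ?_)
      rw [uIoc_of_le (by norm_num)] at hy
      rcases lt_abs.1 (not_le.1 ha) with h | h
      · rw [if_neg (by linarith [hy.2]), if_neg (by linarith)]; simp
      · rw [if_pos (by linarith [hy.1]), if_pos (by linarith)]; simp
    rw [this]; simp; positivity

lemma floor_sum {x : ℝ} (hx : 0 ≤ x) {M : ℕ} (hM : ⌊x⌋₊ ≤ M) :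
    (⌊x⌋₊ : ℝ) = ∑ i ∈ range M, if ((i:ℝ) + 1) ≤ x then (1:ℝ) else 0 := by
  rw [sum_boole]
  have : (range M).filter (fun i : ℕ => (i + 1) ≤ x) = range ⌊x⌋₊ := by
    ext i
    have : (i + 1 ≤ x) ↔ i + 1 ≤ ⌊x⌋₊ := by
      rw [Nat.le_floor_iff hx]; push_cast; rfl
    simp only [Finset.mem_filter, Finset.mem_range, this]; omega
  rw [this, card_range]

lemma harm_le (t : ℕ) : ∑ x ∈ range t, (1 / ((x:ℝ) + 1)) ≤ 1 + log t := by
  have := harmonic_le_one_add_log t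
  refine le_trans (le_of_eq ?_) this
  simp [harmonic]

lemma near_sum {A d R : ℝ} (hA : 0 < A) (hR : 0 < R) (hd : 0 < d) (hdp : ∀ p : ℤ, d ≤ |A - p|) {M : ℕ}
    (hM : ⌊A⌋₊ ≤ M) :
    ∑ i ∈ range M, 1 / (1 + R * |((i:ℝ) + 1) - A|) ≤ 2 / (1 + R * d) + 2 / R * (1 + log M) := by
  set n0 := ⌊A⌋₊ with hn0
  have hf1 : n0 ≤ A := Nat.floor_le hA.le
  have hf2 : A < n0 + 1 := Nat.lt_floor_add_one A
  have pt : ∀ i : ℕ, 1 / (1 + R * |(i + 1) - A|) ≤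
      ((if i + 1 = n0 then 1 / (1 + R * d) else 0) + (if i = n0 then 1 / (1 + R * d) else 0)) +
      (1 / R * (1 / ((n0 - 1 - i : ℕ) : ℝ)) + 1 / R * (1 / ((i - n0 : ℕ) : ℝ))) := by
    intro i
    have hdi : d ≤ |(i + 1) - A| := by
      have := hdp (i + 1)
      rw [abs_sub_comm] at this
      push_cast at this; exact this
    have hb : 1 / (1 + R * |(i + 1) - A|) ≤ 1 / (1 + R * d) := by gcongr
    have hp : 0 ≤ 1 / (1 + R * d) := by positivity
    have hq1 : 0 ≤ 1 / R * (1 / ((n0 - 1 - i : ℕ) : ℝ)) := by positivity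
    have hq2 : 0 ≤ 1 / R * (1 / ((i - n0 : ℕ) : ℝ)) := by positivity
    have far : ∀ z : ℝ, 0 < z → z ≤ |(i + 1) - A| → 1 / (1 + R * |(i + 1) - A|) ≤ 1 / R * (1 / z) := by
      intro z hz hz2
      rw [one_div_mul_one_div]
      apply one_div_le_one_div_of_le (by positivity)
      nlinarith
    rcases lt_trichotomy i n0 with h | h | h
    · rw [if_neg (by omega : ¬ i = n0)]
      by_cases h' : i + 1 = n0
      · rw [if_pos h']; linarith
      · rw [if_neg h']
        have h3 : ((n0 - 1 - i : ℕ) : ℝ) = n0 - 1 - i := by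
          rw [Nat.cast_sub (by omega), Nat.cast_sub (by omega)]; simp
        have h4 : 0 < ((n0 - 1 - i : ℕ) : ℝ) := by exact_mod_cast (by omega : 0 < n0 - 1 - i)
        have := far _ h4 (by rw [abs_sub_comm, h3]; exact le_trans (by linarith) (le_abs_self _))
        linarith
    · rw [if_pos h, if_neg (by omega)]; linarith
    · rw [if_neg (by omega : ¬ i = n0), if_neg (by omega)]
      have h3 : ((i - n0 : ℕ) : ℝ) = (i:ℝ) - n0 := Nat.cast_sub h.le
      have h4 : (0:ℝ) < ((i - n0 : ℕ) : ℝ) := by exact_mod_cast (by omega : 0 < i - n0)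
      have := far _ h4 (by rw [h3]; exact le_trans (by linarith) (le_abs_self _))
      linarith
  have hlogmono : ∀ t : ℕ, t ≤ M → ∑ x ∈ range t, (1 / ((x:ℝ) + 1)) ≤ 1 + log M := by
    intro t ht
    refine le_trans ?_ (harm_le M)
    exact sum_le_sum_of_subset_of_nonneg (range_mono ht) (fun _ _ _ => by positivity)
  have s1 : ∑ i ∈ range M, (if i + 1 = n0 then 1 / (1 + R * d) else 0) ≤ 1 / (1 + R * d) := by
    rcases Nat.eq_zero_or_pos n0 with h | h
    · simp [h]; positivity
    · have : ∀ i, (i + 1 = n0) = (i = n0 - 1) := fun i => by apply propext; omega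
      simp only [this, sum_ite_eq']
      split_ifs
      · exact le_rfl
      · positivity
  have s2 : ∑ i ∈ range M, (if i = n0 then 1 / (1 + R * d) else 0) ≤ 1 / (1 + R * d) := by
    simp only [sum_ite_eq']
    split_ifs
    · exact le_rfl
    · positivity
  have s3 : ∑ i ∈ range M, (1 / ((n0 - 1 - i : ℕ) : ℝ)) ≤ 1 + log M := by
    have e : M = (n0 - 1) + (M - (n0 - 1)) := by omega
    rw [e, sum_range_add]
    have z : ∑ x ∈ range (M - (n0 - 1)), (1 / ((n0 - 1 - (n0 - 1 + x) : ℕ) : ℝ)) = 0 :=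
      sum_eq_zero fun x _ => by
        rw [show n0 - 1 - (n0 - 1 + x) = 0 by omega]; simp
    rw [z, add_zero, ← e, ← Finset.sum_range_reflect]
    refine le_trans (le_of_eq ?_) (hlogmono (n0 - 1) (by omega))
    refine sum_congr rfl fun x hx => ?_
    rw [Finset.mem_range] at hx
    rw [show n0 - 1 - (n0 - 1 - 1 - x) = x + 1 by omega]; push_cast; rfl
  have s4 : ∑ i ∈ range M, (1 / ((i - n0 : ℕ) : ℝ)) ≤ 1 + log M := by
    have hz : ∀ x, x < n0 + 1 → (1 / ((x - n0 : ℕ) : ℝ)) = 0 := fun x hx => by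
        rw [show x - n0 = 0 by omega]; simp
    rcases Nat.lt_or_ge M (n0 + 1) with h | h
    · rw [Finset.sum_eq_zero (fun x hx => hz x (by rw [Finset.mem_range] at hx; omega))]
      have := hlogmono 0 (Nat.zero_le _); simpa using this
    · have e : M = (n0 + 1) + (M - (n0 + 1)) := by omega
      rw [e, Finset.sum_range_add, Finset.sum_eq_zero (fun x hx => hz x (by rw [Finset.mem_range] at hx; omega)), zero_add, ← e]
      refine le_trans (le_of_eq ?_) (hlogmono (M - (n0+1)) (by omega))
      refine Finset.sum_congr rfl fun x hx => ?_
      rw [show n0 + 1 + x - n0 = x + 1 by omega]; push_cast; rfl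
  refine (Finset.sum_le_sum fun i _ => pt i).trans ?_
  rw [Finset.sum_add_distrib, Finset.sum_add_distrib, Finset.sum_add_distrib, ← Finset.mul_sum, ← Finset.mul_sum]
  have hR' : 0 ≤ 1 / R := by positivity
  have m1 := mul_le_mul_of_nonneg_left s3 hR'
  have m2 := mul_le_mul_of_nonneg_left s4 hR'
  calc _ ≤ (1 / (1 + R * d) + 1 / (1 + R * d)) + (1 / R * (1 + log M) + 1 / R * (1 + log M)) := by linarith
    _ = _ := by ring

end Rid

namespace Rid

open MeasureTheory Filter Topology Set

lemma DN_one (N : ℕ) : ∫ y in (-(1/2:ℝ))..(1/2), DN N y = 1 := by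
  rw [fold_re (DN_cont N)]
  simp only [DN_even]
  have hc := (DN_cont N).intervalIntegrable (μ := volume) 0 (1/2)
  rw [integral_add hc hc, DN_total]; norm_num

lemma pfg_meas (m : ℕ) (A L : ℝ) : Measurable fun y : ℝ => pf m (A * exp (L * y)) :=
  (pf_meas m).comp (by fun_prop)

lemma TT_sub (k : ℕ) (L : ℝ) (N : ℕ) (A : ℝ) : TT k L N A - pf (k+1) A =
    ∫ y in (-(1/2:ℝ))..(1/2), (pf (k+1) (A * exp (L * y)) - pf (k+1) A) * DN N y := by
  obtain ⟨B, hB, hb⟩ := pf_bdd (k+1)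
  simp only [sub_mul]
  rw [intervalIntegral.integral_sub, intervalIntegral.integral_const_mul, DN_one, mul_one, TT]
  · exact bi (pfg_meas _ _ _) (fun _ => hb _) (DN_cont N) _ _
  · exact ((DN_cont N).intervalIntegrable _ _).const_mul _

lemma pf_one {x : ℝ} (hx : 0 ≤ x) : pf 1 x = x - ⌊x⌋₊ - 1/2 := by
  have h := natCast_floor_eq_intCast_floor (R := ℝ) hx
  rw [h, pf, bernoulliFun_one, Int.fract]

lemma log_abs_lb {r E : ℝ} (hr : 0 < r) (hE : 1 ≤ E) (hrE : r ≤ E) : |r - 1| / E ≤ |log r| := by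
  have hE0 : 0 < E := by linarith
  rcases le_total 1 r with h | h
  · rw [abs_of_nonneg (by linarith), abs_of_nonneg (log_nonneg h)]
    have := one_sub_inv_le_log_of_pos hr
    refine le_trans ?_ this
    rw [div_le_iff₀ hE0]
    have : (1 - r⁻¹) * r = r - 1 := by field_simp
    nlinarith
  · rw [abs_of_nonpos (by linarith), abs_of_nonpos (log_nonpos hr.le h)]
    have := log_le_sub_one_of_pos hr
    refine (div_le_self (by linarith) hE).trans ?_
    linarith

lemma floor_part {L : ℝ} (hL : 0 < L) : ∃ C > 0, ∀ N : ℕ, 2 ≤ N → ∀ A : ℝ, 0 < A → A ≤ N → ∀ d > 0, (∀ p : ℤ, d ≤ |A - p|) →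
    |∫ y in (-(1/2:ℝ))..(1/2), ((⌊A * Real.exp (L * y)⌋₊ : ℝ) - ⌊A⌋₊) * DN N y| ≤
      C * (1 / (1 + N * d / A) + A / N * Real.log N) := by
  set E := Real.exp (L / 2) with hE
  have hE1 : 1 ≤ E := Real.one_le_exp (by positivity)
  set G := max 1 (L * E) with hG
  have hG1 : 1 ≤ G := le_max_left _ _
  have hG2 : L * E ≤ G := le_max_right _ _
  refine ⟨12 * G + 12 * (L * E) * (3 + L), by positivity, fun N hN A hA hAN d hd hdp => ?_⟩
  have hl := log_lb hN
  have hN' : 2 ≤ N := by exact_mod_cast hN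
  set M := ⌊A * E⌋₊ with hM
  set R := N / (L * A * E) with hR
  have hR0 : 0 < R := by positivity
  set θ : ℕ → ℝ := fun i => Real.log ((i + 1) / A) / L with hθ
  have hi0 : ∀ i : ℕ, 0 < (i + 1) / A := fun i => by positivity
  have hle : ∀ (i : ℕ) y, (i + 1 ≤ A * Real.exp (L * y)) = (θ i ≤ y) := by
    intro i y
    apply propext
    rw [hθ]
    simp only
    rw [div_le_iff₀ hL, Real.log_le_iff_le_exp (hi0 i), div_le_iff₀ hA, mul_comm y L, mul_comm A]
  have e : ∫ y in (-(1/2:ℝ))..(1/2), ((⌊A * Real.exp (L * y)⌋₊ : ℝ) - ⌊A⌋₊) * DN N y =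
      ∑ i ∈ Finset.range M, ∫ y in (-(1/2:ℝ))..(1/2), ((if θ i ≤ y then 1 else 0) - (if θ i ≤ 0 then 1 else 0) : ℝ) * DN N y := by
    rw [← intervalIntegral.integral_finset_sum]
    · refine integral_congr fun y hy => ?_
      rw [uIcc_of_le (by norm_num)] at hy
      beta_reduce
      have h1 : Real.exp (L * y) ≤ E := Real.exp_le_exp.2 (by nlinarith [hy.2])
      have f1 : ⌊A * Real.exp (L * y)⌋₊ ≤ M := Nat.floor_le_floor (by gcongr)
      have f2 : ⌊A * Real.exp (L * 0)⌋₊ ≤ M := Nat.floor_le_floor (by simp; nlinarith)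
      have s1 := floor_sum (by positivity) f1
      have s2 := floor_sum (by positivity) f2
      simp only [hle] at s1 s2
      have s3 : (⌊A⌋₊ : ℝ) = ∑ i ∈ Finset.range M, if θ i ≤ 0 then 1 else 0 := by
        rw [← s2]; simp
      rw [s1, s3, ← Finset.sum_sub_distrib, Finset.sum_mul]
    · intro i _
      refine bi (B := 1) ?_ ?_ (DN_cont N) _ _
      · exact (Measurable.ite measurableSet_Ici measurable_const measurable_const).sub_const _
      · intro x; split_ifs <;> norm_num
  rw [e]
  have b1 : ∀ i ∈ Finset.range M, |∫ y in (-(1/2:ℝ))..(1/2), ((if θ i ≤ y then 1 else 0) - (if θ i ≤ 0 then 1 else 0) : ℝ) * DN N y| ≤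
      6 * (1 / (1 + R * |(i + 1) - A|)) := by
    intro i hi
    refine (jump (by omega) (θ i)).trans ?_
    rw [mul_one_div]
    gcongr 6 / (1 + ?_)
    rw [Finset.mem_range] at hi
    have h1 : (i + 1) ≤ A * E := by
      have : i + 1 ≤ ⌊A * E⌋₊ := hi
      rw [Nat.le_floor_iff (by positivity)] at this
      exact_mod_cast this
    have h2 := log_abs_lb (hi0 i) hE1 (by rw [div_le_iff₀ hA]; linarith)
    have h3 : |(i + 1) / A - 1| = |(i + 1) - A| / A := by
      rw [← abs_of_pos hA, ← abs_div, abs_of_pos hA]; congr 1; field_simp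
    rw [h3] at h2
    rw [hθ, hR]; simp only
    rw [abs_div, abs_of_pos hL]
    calc N / (L * A * E) * |(i + 1) - A| = N * ((|(i + 1) - A| / A / E) / L) := by field_simp
      _ ≤ _ := by gcongr
  refine (Finset.abs_sum_le_sum_abs _ _).trans ((Finset.sum_le_sum b1).trans ?_)
  rw [← Finset.mul_sum]
  have ns := near_sum hA hR0 hd hdp (M := M) (Nat.floor_le_floor (by nlinarith))
  have hlogM : 1 + Real.log M ≤ (3 + L) * Real.log N := by
    have : Real.log M ≤ Real.log N + L / 2 := by
      rcases Nat.eq_zero_or_pos M with h | h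
      · rw [h]; simp; linarith
      · have hM2 : M ≤ N * E := (Nat.floor_le (by positivity)).trans (by gcongr)
        have := Real.log_le_log (by exact_mod_cast h) hM2
        rwa [Real.log_mul (by positivity) (by positivity), hE, Real.log_exp] at this
    nlinarith
  have t1 : 1 / (1 + R * d) ≤ G * (1 / (1 + N * d / A)) := by
    rw [mul_one_div, div_le_div_iff₀ (by positivity) (by positivity)]
    have : N * d / A = (R * d) * (L * E) := by rw [hR]; field_simp
    rw [this]
    have : (R * d) * (L * E) ≤ (R * d) * G := by gcongr
    nlinarith
  have t2 : 1 / R * (1 + Real.log M) ≤ (L * E) * (3 + L) * (A / N * Real.log N) := by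
    calc 1 / R * (1 + Real.log M) ≤ 1 / R * ((3 + L) * Real.log N) := by gcongr
      _ = _ := by rw [hR]; field_simp
  have p1 : 0 ≤ 1 / (1 + N * d / A) := by positivity
  have p2 : 0 ≤ A / N * Real.log N := by positivity
  have q1 : 0 ≤ G * (A / N * Real.log N) := by positivity
  have q2 : 0 ≤ (L * E) * (3 + L) * (1 / (1 + N * d / A)) := by positivity
  have ns' : ∑ i ∈ Finset.range M, 1 / (1 + R * |(i + 1) - A|) ≤ 2 * (1 / (1 + R * d)) + 2 * (1 / R * (1 + Real.log M)) := by
    refine ns.trans (le_of_eq ?_); ring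
  nlinarith

lemma small (k : ℕ) {L : ℝ} (hL : 0 < L) : ∃ C > 0, ∀ N : ℕ, 2 ≤ N → ∀ A : ℝ, 0 < A → A ≤ N → ∀ d > 0, (∀ p : ℤ, d ≤ |A - p|) →
    |TT k L N A - pf (k+1) A| ≤ C * (1 / (1 + N * d / A) + A / N * log N) := by
  rcases Nat.eq_zero_or_pos k with rfl | hk
  · obtain ⟨C, hC, h⟩ := floor_part hL
    refine ⟨12 * 1 * exp (L / 2) * L + C, by positivity, fun N hN A hA hAN d hd hdp => ?_⟩
    have h1 := h N hN A hA hAN d hd hdp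
    have h2 := lipJ (φ := fun x => x) (φ' := fun _ => 1) (by fun_prop) (fun x => hasDerivWithinAt_id _ _) measurable_const (B := 1) (by simp) hA hL hN
    rw [TT_sub]
    have e : ∫ y in (-(1/2:ℝ))..(1/2), (pf (0+1) (A * exp (L * y)) - pf (0+1) A) * DN N y =
       (∫ y in (-(1/2:ℝ))..(1/2), (A * exp (L * y) - A) * DN N y) -
       ∫ y in (-(1/2:ℝ))..(1/2), ((⌊A * exp (L * y)⌋₊ : ℝ) - ⌊A⌋₊) * DN N y := by
      have hDc := DN_cont N
      rw [← integral_sub (Continuous.intervalIntegrable (by fun_prop) _ _)]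
      · refine integral_congr fun y hy => ?_
        rw [pf_one hA.le, pf_one (by positivity)]; ring
      · obtain ⟨B, hB, hb⟩ := pf_bdd 1
        have i1 : IntervalIntegrable (fun y => (A * exp (L * y) - A) * DN N y - (pf 1 (A * exp (L * y)) - pf 1 A) * DN N y) volume (-(1/2)) (1/2) := by
          refine (Continuous.intervalIntegrable (by fun_prop) _ _).sub (bi ((pfg_meas _ _ _).sub_const _) (B := B + B) (fun y => (abs_sub _ _).trans (add_le_add (hb _) (hb _))) hDc _ _)
        refine i1.congr fun y _ => ?_
        beta_reduce
        rw [pf_one hA.le, pf_one (by positivity)]; ring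
    rw [e]
    refine (abs_sub _ _).trans ((add_le_add h2 h1).trans ?_)
    have : 0 ≤ 12 * 1 * exp (L / 2) * L * (1 / (1 + N * d / A)) := by positivity
    linarith
  · obtain ⟨B, hB, hb⟩ := pf_bdd k
    refine ⟨12 * ((k+1) * B) * exp (L / 2) * L, by positivity, fun N hN A hA hAN d hd hdp => ?_⟩
    have h2 := lipJ (φ := pf (k+1)) (φ' := fun x => (k+1) * pf k x) (pf_cont (by omega)) (pf_right k) ((pf_meas k).const_mul _)
      (B := (k+1) * B) (fun x => by
        rw [abs_mul, abs_of_pos (by positivity : (0:ℝ) < k + 1)]; gcongr; exact hb x) hA hL hN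
    rw [TT_sub]
    refine h2.trans ?_
    have : 0 ≤ 1 / (1 + N * d / A) := by positivity
    gcongr
    linarith

end Rid

namespace Rid

open MeasureTheory Filter Topology Set

section asm

variable {β a0 : ℝ}

lemma cnt (hβ : 1 < β) (ha : 0 < a0) {u v : ℝ} (hu : 0 < u) (huv : u ≤ v) (H : ℕ) :
    ∑ i ∈ range H, (if u < a0 * β ^ i ∧ a0 * β ^ i ≤ v then (1:ℝ) else 0) ≤ log (v / u) / log β + 1 := by
  have hL := log_pos hβ
  have hβ0 : 0 < β := by linarith
  have hv : 0 < v := by linarith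
  rw [sum_boole]
  set p := log (u / a0) / log β with hp
  set q := log (v / a0) / log β with hq
  have hsub : ((range H).filter (fun i : ℕ => u < a0 * β ^ i ∧ a0 * β ^ i ≤ v)).card ≤ (Finset.Ioc ⌊p⌋ ⌊q⌋).card := by
    refine Finset.card_le_card_of_injOn (fun i : ℕ => i) ?_ (fun a _ c _ h => by simpa using h)
    intro i hi
    simp at hi
    obtain ⟨_, h1, h2⟩ := hi
    simp
    constructor
    · rw [Int.floor_lt, hp, div_lt_iff₀ hL]
      have : log (u / a0) < log (β ^ i) := log_lt_log (by positivity) (by rw [div_lt_iff₀ ha]; linarith)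
      rwa [log_pow] at this
    · rw [Int.le_floor, hq, le_div_iff₀ hL]
      have : log (β ^ i) ≤ log (v / a0) := log_le_log (by positivity) (by rw [le_div_iff₀ ha]; linarith)
      rwa [log_pow] at this
  have hqp : q - p = log (v / u) / log β := by
    rw [hp, hq, ← sub_div, ← log_div (by positivity) (by positivity)]
    congr 2; field_simp
  have hqp0 : 0 ≤ q - p := by
    rw [hqp]; exact div_nonneg (log_nonneg (by rw [le_div_iff₀ hu]; linarith)) hL.le
  have hcard : ((Finset.Ioc ⌊p⌋ ⌊q⌋).card : ℝ) ≤ q - p + 1 := by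
    rw [Int.card_Ioc]
    have h1 : ((((⌊q⌋ - ⌊p⌋).toNat : ℕ) : ℤ) : ℝ) = ((max (⌊q⌋ - ⌊p⌋) 0 : ℤ) : ℝ) := by rw [Int.toNat_eq_max]
    rw [Int.cast_natCast] at h1
    rw [h1]; push_cast
    have := Int.floor_le q
    have := Int.lt_floor_add_one p
    exact max_le (by linarith) (by linarith)
  rw [← hqp]
  exact le_trans (mod_cast hsub) hcard

lemma geo_up (hβ : 1 < β) (ha : 0 < a0) {Y : ℝ} (hY : 0 < Y) (H : ℕ) :
    ∑ i ∈ range H, (if a0 * β ^ i ≤ Y then a0 * β ^ i else 0) ≤ β / (β - 1) * Y := by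
  have hb1 : 0 < β - 1 := by linarith
  set z : ℕ → ℝ := fun i => min (a0 * β ^ i) (β * Y) with hz
  have pt : ∀ i ∈ range H, (if a0 * β ^ i ≤ Y then a0 * β ^ i else 0) ≤ 1 / (β - 1) * (z (i+1) - z i) := by
    intro i _
    have hs : a0 * β ^ (i+1) = β * (a0 * β ^ i) := by ring
    simp only [hz, hs]
    split_ifs with h
    · rw [min_eq_left (by gcongr), min_eq_left (by nlinarith)]
      apply le_of_eq; field_simp
    · apply mul_nonneg (by positivity)
      rw [sub_nonneg]
      exact min_le_min_right _ (by nlinarith)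
  refine (sum_le_sum pt).trans ?_
  rw [← mul_sum, Finset.sum_range_sub]
  have h1 : z H ≤ β * Y := min_le_right _ _
  have h2 : 0 ≤ z 0 := by simp only [hz]; positivity
  calc 1 / (β - 1) * (z H - z 0) ≤ 1 / (β - 1) * (β * Y) := by gcongr; linarith
    _ = _ := by ring

lemma geo_dn (hβ : 1 < β) (ha : 0 < a0) {Y : ℝ} (hY : 0 < Y) (H : ℕ) :
    ∑ i ∈ range H, (if Y < a0 * β ^ i then 1 / (a0 * β ^ i) else 0) ≤ β / (β - 1) / Y := by
  have hb1 : 0 < β - 1 := by linarith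
  set z : ℕ → ℝ := fun i => min (1 / (a0 * β ^ i)) (1 / Y) with hz
  have pt : ∀ i ∈ range H, (if Y < a0 * β ^ i then 1 / (a0 * β ^ i) else 0) ≤ β / (β - 1) * (z i - z (i+1)) := by
    intro i _
    have hx : 0 < a0 * β ^ i := by positivity
    have hs : a0 * β ^ (i+1) = β * (a0 * β ^ i) := by ring
    simp only [hz, hs]
    have hxx : a0 * β ^ i ≤ β * (a0 * β ^ i) := by nlinarith
    split_ifs with h
    · rw [min_eq_left (one_div_le_one_div_of_le hY h.le), min_eq_left (one_div_le_one_div_of_le hY (by linarith))]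
      apply le_of_eq; field_simp
    · apply mul_nonneg (by positivity)
      rw [sub_nonneg]
      exact min_le_min_right _ (one_div_le_one_div_of_le hx hxx)
  refine (sum_le_sum pt).trans ?_
  rw [← mul_sum, Finset.sum_range_sub']
  have h1 : z 0 ≤ 1 / Y := min_le_right _ _
  have h2 : 0 ≤ z H := by simp only [hz]; positivity
  calc β / (β - 1) * (z 0 - z H) ≤ β / (β - 1) * (1 / Y) := by gcongr; linarith
    _ = _ := by ring

set_option maxHeartbeats 1000000 in
lemma assembly (hβ : 1 < β) (ha : 0 < a0) {T : ℕ → ℕ → ℝ} {f : ℕ → ℝ} {C c1 : ℝ} (hC : 0 < C) (hc1 : 0 < c1)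
    (hs : ∀ N : ℕ, 2 ≤ N → ∀ i, a0 * β ^ i ≤ N → |T N i - f i| ≤ C * (1 + a0 * β ^ i / N * log N))
    (hr : ∀ δ : ℝ, 0 < δ → ∀ η > 0, ∃ N0 : ℕ, ∀ N ≥ N0, ∀ i, a0 * β ^ i ≤ (N:ℝ) ^ (1 - δ) → |T N i - f i| ≤ η)
    (hcr : ∀ K > 0, ∀ η > 0, ∃ N0 : ℕ, ∀ N ≥ N0, ∀ i, N / K ≤ a0 * β ^ i → a0 * β ^ i ≤ K * N → |T N i| ≤ η * log N)
    (ht : ∀ N : ℕ, 2 ≤ N → ∀ i, |T N i| ≤ C * (N / (a0 * β ^ i) * log N))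
    (hf : ∀ i, |f i| ≤ C) {ε : ℝ} (hε : 0 < ε) :
    ∃ N0 : ℕ, ∀ N ≥ N0, ∀ H : ℕ, ∑ i ∈ range H, |T N i - if a0 * β ^ i < c1 * N then f i else 0| ≤ ε * log N := by
  have hL : 0 < log β := log_pos hβ
  have hβ0 : 0 < β := by linarith
  have hb1 : 0 < β - 1 := by linarith
  set L := log β with hLd
  set g := C * (β / (β - 1)) with hg
  have hg0 : 0 < g := by positivity
  obtain ⟨K, hK1, hK2, hK3, hK4⟩ : ∃ K : ℝ, 1 ≤ K ∧ c1 ≤ K ∧ 2 / c1 ≤ K ∧ 8 * g / ε ≤ K :=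
    ⟨max (max 1 c1) (max (2 / c1) (8 * g / ε)), by simp, by simp, by simp, by simp⟩
  have hK0 : 0 < K := by linarith
  set c4 := 2 * log K / L + 1 with hc4
  have hc40 : 0 < c4 := by have := log_nonneg hK1; positivity
  set δ := min (1/2) (ε * L / (8 * C)) with hδ
  have hδ0 : 0 < δ := by positivity
  have hδ1 : δ ≤ 1/2 := min_le_left _ _
  have hδ2 : C * δ / L ≤ ε / 8 := by
    have : δ ≤ ε * L / (8 * C) := min_le_right _ _
    calc C * δ / L ≤ C * (ε * L / (8 * C)) / L := by gcongr
      _ = _ := by field_simp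
  set η := ε / (8 * (1 / L + c4)) with hη
  have hη0 : 0 < η := by positivity
  have hη1 : η * (1 / L + c4) = ε / 8 := by rw [hη]; field_simp
  set c3 := |log (2 / a0)| / L + 1 with hc3
  obtain ⟨N1, hN1⟩ := hr δ hδ0 η hη0
  obtain ⟨N2, hN2⟩ := hcr K hK0 η hη0
  have hlog : Tendsto (fun N : ℕ => ε / 4 * log N) atTop atTop :=
    (tendsto_log_atTop.comp tendsto_natCast_atTop_atTop).const_mul_atTop (by positivity)
  obtain ⟨N3, hN3⟩ := eventually_atTop.1 (hlog.eventually_ge_atTop (η * c3 + C + C * c4))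
  obtain ⟨N4, hN4⟩ := eventually_atTop.1 (tendsto_natCast_atTop_atTop (R := ℝ) |>.eventually_ge_atTop a0)
  refine ⟨max (max N1 N2) (max N3 (max N4 2)), fun N hN H => ?_⟩
  simp only [ge_iff_le, max_le_iff] at hN
  obtain ⟨⟨hNa, hNb⟩, hNc, hNd, hNe⟩ := hN
  have hl := log_lb hNe
  have hN' : (2:ℝ) ≤ N := by exact_mod_cast hNe
  have hNp : (0:ℝ) < N := by linarith
  have hNa0 := hN4 N hNd
  set x : ℕ → ℝ := fun i => a0 * β ^ i with hx
  have hx0 : ∀ i, 0 < x i := fun i => by simp only [hx]; positivity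
  have hxa : ∀ i, a0 ≤ x i := fun i => le_mul_of_one_le_right ha.le (one_le_pow₀ hβ.le)
  set lN := log N with hlN
  have pt : ∀ i ∈ range H, |T N i - if x i < c1 * N then f i else 0| ≤
      η * (if a0 / 2 < x i ∧ x i ≤ N then 1 else 0) + C * (if N ^ (1 - δ) < x i ∧ x i ≤ N then 1 else 0)
      + C * (lN / N) * (if x i ≤ N / K then x i else 0)
      + (η * lN + C) * (if N / K < x i ∧ x i ≤ K * N then 1 else 0)
      + C * (N * lN) * (if K * N < x i then 1 / x i else 0) := by
    intro i _
    have q1 : 0 ≤ η * (if a0 / 2 < x i ∧ x i ≤ N then 1 else 0) := by split_ifs <;> simp [hη0.le]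
    have q2 : 0 ≤ C * (if N ^ (1 - δ) < x i ∧ x i ≤ N then 1 else 0) := by split_ifs <;> simp [hC.le]
    have q3 : 0 ≤ C * (lN / N) * (if x i ≤ N / K then x i else 0) := by
      have := hx0 i; split_ifs <;> positivity
    have q4 : 0 ≤ (η * lN + C) * (if N / K < x i ∧ x i ≤ K * N then 1 else 0) := by split_ifs <;> positivity
    have q5 : 0 ≤ C * (N * lN) * (if K * N < x i then 1 / x i else 0) := by have := hx0 i; split_ifs <;> positivity
    rcases le_or_gt (x i) (N / K) with h1 | h1
    · have h2 : x i ≤ N := h1.trans (div_le_self hNp.le hK1)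
      have h3 : x i < c1 * N := by
        refine lt_of_le_of_lt h1 ?_
        rw [div_lt_iff₀ hK0]
        have : 2 ≤ c1 * K := by rw [div_le_iff₀ hc1] at hK3; linarith
        nlinarith
      rw [if_pos h3]
      rcases le_or_gt (x i) (N ^ (1 - δ)) with h4 | h4
      · have := hN1 N hNa i h4
        rw [if_pos (⟨by linarith [hxa i], h2⟩ : a0 / 2 < x i ∧ x i ≤ N)] at *
        linarith
      · have := hs N hNe i h2
        rw [if_pos (⟨h4, h2⟩ : N ^ (1 - δ) < x i ∧ x i ≤ N)] at *
        rw [if_pos h1] at *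
        have e : C * (1 + x i / N * lN) = C * 1 + C * (lN / N) * x i := by ring
        change _ ≤ C * (1 + x i / N * lN) at this
        linarith
    · rcases le_or_gt (x i) (K * N) with h2 | h2
      · have h3 := hN2 N hNb i h1.le h2
        have h4 : |if x i < c1 * N then f i else 0| ≤ C := by
          split_ifs
          · exact hf i
          · simpa using hC.le
        have := abs_sub (T N i) (if x i < c1 * N then f i else 0)
        rw [if_pos (⟨h1, h2⟩ : N / K < x i ∧ x i ≤ K * N)] at *
        linarith
      · have h3 := ht N hNe i
        rw [if_neg (by push Not; nlinarith), sub_zero]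
        rw [if_pos h2] at *
        have e : C * (N / x i * lN) = C * (N * lN) * (1 / x i) := by ring
        change _ ≤ C * (N / x i * lN) at h3
        linarith
  refine (sum_le_sum pt).trans ?_
  simp only [sum_add_distrib, ← mul_sum]
  have s1 : ∑ i ∈ range H, (if a0 / 2 < x i ∧ x i ≤ N then 1 else 0) ≤ lN / L + c3 := by
    refine (cnt hβ ha (u := a0 / 2) (v := N) (by positivity) (by linarith) H).trans ?_
    rw [show N / (a0 / 2) = N * (2 / a0) by field_simp, log_mul (by positivity) (by positivity), add_div, hc3, add_assoc]
    gcongr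
    exact le_abs_self _
  have s2 : ∑ i ∈ range H, (if N ^ (1 - δ) < x i ∧ x i ≤ N then 1 else 0) ≤ δ * lN / L + 1 := by
    refine (cnt hβ ha (u := N ^ (1 - δ)) (v := N) (by positivity) ?_ H).trans ?_
    · calc N ^ (1 - δ) ≤ (N:ℝ) ^ 1 := rpow_le_rpow_of_exponent_le (by linarith) (by linarith)
        _ = N := rpow_one _
    · rw [log_div (by positivity) (by positivity), log_rpow hNp]
      apply le_of_eq; ring
  have s3 := geo_up hβ ha (Y := N / K) (by positivity) H
  have s4 : ∑ i ∈ range H, (if N / K < x i ∧ x i ≤ K * N then 1 else 0) ≤ c4 := by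
    refine (cnt hβ ha (u := N / K) (v := K * N) (by positivity) ?_ H).trans ?_
    · exact (div_le_self hNp.le hK1).trans (le_mul_of_one_le_left hNp.le hK1)
    · rw [show K * N / (N / K) = K ^ 2 by field_simp, log_pow]; push_cast; exact le_rfl
  have s5 := geo_dn hβ ha (Y := K * N) (by positivity) H
  have t1 := mul_le_mul_of_nonneg_left s1 hη0.le
  have t2 := mul_le_mul_of_nonneg_left s2 hC.le
  have t3 := mul_le_mul_of_nonneg_left s3 (by positivity : 0 ≤ C * (lN / N))
  have t4 := mul_le_mul_of_nonneg_left s4 (by positivity : 0 ≤ η * lN + C)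
  have t5 := mul_le_mul_of_nonneg_left s5 (by positivity : 0 ≤ C * (N * lN))
  have hgK : g / K ≤ ε / 8 := by
    rw [div_le_iff₀ hε] at hK4
    rw [div_le_iff₀ hK0]; linarith
  have e3 : C * (lN / N) * (β / (β - 1) * (N / K)) = g / K * lN := by rw [hg]; field_simp
  have e5 : C * (N * lN) * (β / (β - 1) / (K * N)) = g / K * lN := by rw [hg]; field_simp
  rw [e3] at t3
  rw [e5] at t5
  have hgl := mul_le_mul_of_nonneg_right hgK (by linarith : 0 ≤ lN)
  have hdl := mul_le_mul_of_nonneg_right hδ2 (by linarith : 0 ≤ lN)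
  have h3 := hN3 N hNc
  have e1 : η * (lN / L + c3) + (η * lN + C) * c4 = (η * (1 / L + c4)) * lN + η * c3 + C * c4 := by ring
  rw [hη1] at e1
  have e2 : C * (δ * lN / L + 1) = C * δ / L * lN + C := by ring
  have hll : 0 ≤ ε * lN := by positivity
  change η * c3 + C + C * c4 ≤ ε / 4 * lN at h3
  linarith

end asm

end Rid

namespace Rid

open MeasureTheory Filter Topology Set

section fin

variable {α : ℝ} {b : ℕ}

lemma irrA (hirr : Irrational α) (hb : 2 ≤ b) (m i : ℕ) : Irrational (α / (b:ℝ) ^ m * (b:ℝ) ^ i) := by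
  have h1 := (hirr.div_natCast (m := b ^ m) (by positivity)).mul_natCast (m := b ^ i) (by positivity)
  simpa using h1

lemma dist_int {x : ℝ} (hx : Irrational x) : ∃ d > 0, ∀ p : ℤ, d ≤ |x - p| :=
  ⟨|x - round x|, abs_pos.mpr (sub_ne_zero.mpr (hx.ne_int _)), fun p => round_le x p⟩

lemma sepA (halg : IsAlgebraic ℚ α) (hirr : Irrational α) (hb : 2 ≤ b) (m : ℕ) {γ : ℝ} (hγ : 0 < γ) :
    ∃ c > 0, ∀ i : ℕ, ∀ p : ℤ, c * (b:ℝ) ^ (-(γ * i)) ≤ |α / (b:ℝ) ^ m * (b:ℝ) ^ i - p| := by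
  have hb1 : (1:ℝ) ≤ b := mod_cast (by omega : 1 ≤ b)
  obtain ⟨H0, h0⟩ := ridout halg hirr hb hγ
  have fi : ∀ M : ℕ, ∃ c > 0, c ≤ 1 ∧ ∀ i < M, ∀ p : ℤ, c ≤ |α / b ^ m * b ^ i - p| := by
    intro M
    induction M with
    | zero => exact ⟨1, by norm_num, le_rfl, fun i hi => by omega⟩
    | succ M ih =>
      obtain ⟨c, hc, hc1, h⟩ := ih
      obtain ⟨d, hd, h'⟩ := dist_int (irrA hirr hb m M)
      refine ⟨min c d, lt_min hc hd, (min_le_left _ _).trans hc1, fun i hi p => ?_⟩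
      rcases Nat.lt_succ_iff_lt_or_eq.mp hi with hi | rfl
      · grind
      · exact (min_le_right _ _).trans (h' p)
  obtain ⟨c, hc, hc1, h⟩ := fi (H0 + m)
  refine ⟨c, hc, fun i p => ?_⟩
  rcases lt_or_ge i (H0 + m) with hi | hi
  · refine le_trans ?_ (h i hi p)
    have : (b:ℝ) ^ (-(γ * i)) ≤ 1 := rpow_le_one_of_one_le_of_nonpos hb1 (by simp; positivity)
    nlinarith
  · obtain ⟨j, rfl⟩ := Nat.exists_eq_add_of_le (show m ≤ i by omega)
    have h1 := h0 j (by omega) p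
    have e : α / b ^ m * b ^ (m + j) = b ^ j * α := by rw [pow_add]; field_simp
    rw [e]
    refine le_trans ?_ h1
    have h2 : b ^ (-(γ * ((m + j : ℕ) : ℝ))) ≤ (b:ℝ) ^ (-(γ * j)) := by
      apply rpow_le_rpow_of_exponent_le hb1
      push_cast; nlinarith
    have h3 : 0 < (b:ℝ) ^ (-(γ * ((m + j : ℕ) : ℝ))) := by positivity
    nlinarith

set_option maxHeartbeats 1000000 in
lemma asmT (hα : 0 < α) (halg : IsAlgebraic ℚ α) (hirr : Irrational α) (hb : 2 ≤ b) (k m : ℕ) {ε : ℝ} (hε : 0 < ε) :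
    ∃ N0 : ℕ, ∀ N ≥ N0, ∀ H : ℕ, ∑ i ∈ Finset.range H, |TT k (Real.log b) N (α / (b:ℝ) ^ m * (b:ℝ) ^ i)
      - if α / (b:ℝ) ^ m * (b:ℝ) ^ i < α * N then pf (k+1) (α / (b:ℝ) ^ m * (b:ℝ) ^ i) else 0| ≤ ε * Real.log N := by
  have hb1 : (1:ℝ) < b := by exact_mod_cast (by omega : 1 < b)
  have hb0 : (0:ℝ) < b := by linarith
  have hL : 0 < Real.log b := Real.log_pos hb1
  have ha0 : 0 < α / (b:ℝ) ^ m := by positivity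
  obtain ⟨C1, hC1, h1⟩ := small k hL
  obtain ⟨C2, hC2, h2⟩ := TT_tail k hL
  obtain ⟨C3, hC3, h3⟩ := pf_bdd (k+1)
  have hCa : C1 ≤ max C1 (max C2 C3) := le_max_left _ _
  have hCb : C2 ≤ max C1 (max C2 C3) := (le_max_left _ _).trans (le_max_right _ _)
  have hCc : C3 ≤ max C1 (max C2 C3) := (le_max_right _ _).trans (le_max_right _ _)
  refine assembly (β := b) (a0 := α / (b:ℝ) ^ m) (T := fun N i => TT k (Real.log b) N (α / (b:ℝ) ^ m * (b:ℝ) ^ i))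
    (f := fun i => pf (k+1) (α / (b:ℝ) ^ m * (b:ℝ) ^ i)) (C := max C1 (max C2 C3)) hb1 ha0 (lt_max_of_lt_left hC1) hα ?_ ?_ ?_ ?_ (fun i => (h3 _).trans hCc) hε
  · intro N hN i hi
    obtain ⟨d, hd, hdp⟩ := dist_int (irrA hirr hb m i)
    have hA : 0 < α / (b:ℝ) ^ m * (b:ℝ) ^ i := by positivity
    have hN2 : (2:ℝ) ≤ N := by exact_mod_cast hN
    have hlog : 0 ≤ Real.log N := Real.log_nonneg (by linarith)
    refine (h1 N hN _ hA hi d hd hdp).trans ?_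
    refine mul_le_mul hCa ?_ (by positivity) (by positivity)
    have : 1 / (1 + N * d / (α / (b:ℝ) ^ m * (b:ℝ) ^ i)) ≤ 1 := by
      rw [div_le_one (by positivity)]
      have : 0 ≤ N * d / (α / (b:ℝ) ^ m * (b:ℝ) ^ i) := by positivity
      linarith
    linarith
  · intro δ hδ η hη
    obtain ⟨c, hc, hs⟩ := sepA halg hirr hb m (half_pos hδ)
    set q : ℝ := (b:ℝ) ^ m / α with hq
    have hq0 : 0 < q := by positivity
    set c' := c * q ^ (-(δ/2)) with hc'
    have hc'0 : 0 < c' := by positivity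
    have lim : Tendsto (fun N : ℕ => C1 * ((N:ℝ) ^ (-(δ/2)) / c' + Real.log N / (N:ℝ) ^ δ)) atTop (𝓝 (C1 * (0 / c' + 0))) := by
      have l1 : Tendsto (fun N : ℕ => (N:ℝ) ^ (-(δ/2))) atTop (𝓝 0) :=
        (tendsto_rpow_neg_atTop (half_pos hδ)).comp tendsto_natCast_atTop_atTop
      have l2 : Tendsto (fun N : ℕ => Real.log N / (N:ℝ) ^ δ) atTop (𝓝 0) :=
        ((isLittleO_log_rpow_atTop hδ).tendsto_div_nhds_zero).comp tendsto_natCast_atTop_atTop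
      exact ((l1.div_const c').add l2).const_mul C1
    rw [zero_div, add_zero, mul_zero] at lim
    obtain ⟨N0, hN0⟩ := eventually_atTop.mp (lim.eventually (gt_mem_nhds hη))
    refine ⟨max N0 2, fun N hN i hi => ?_⟩
    have hN2 : 2 ≤ N := (le_max_right _ _).trans hN
    have hN2' : (2:ℝ) ≤ N := by exact_mod_cast hN2
    have hNp : (0:ℝ) < N := by linarith
    have hlog : 0 ≤ Real.log N := Real.log_nonneg (by linarith)
    have hA : 0 < α / (b:ℝ) ^ m * (b:ℝ) ^ i := by positivity
    have hAN : α / (b:ℝ) ^ m * (b:ℝ) ^ i ≤ N := hi.trans <| by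
      calc (N:ℝ) ^ (1 - δ) ≤ (N:ℝ) ^ (1:ℝ) := Real.rpow_le_rpow_of_exponent_le (by linarith) (by linarith)
        _ = N := Real.rpow_one _
    have hbi : (b:ℝ) ^ i ≤ q * N := by
      calc (b:ℝ) ^ i = q * (α / (b:ℝ) ^ m * (b:ℝ) ^ i) := by rw [hq]; field_simp
        _ ≤ q * N := by gcongr
    have hdd : c' * (N:ℝ) ^ (-(δ/2)) ≤ c * (b:ℝ) ^ (-(δ/2 * i)) := by
      have e1 : (b:ℝ) ^ (-(δ/2 * i)) = ((b:ℝ) ^ i) ^ (-(δ/2)) := by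
        rw [← Real.rpow_natCast, ← Real.rpow_mul hb0.le]; congr 1; ring
      rw [e1, hc', mul_assoc, ← Real.mul_rpow hq0.le hNp.le]
      refine mul_le_mul_of_nonneg_left ?_ hc.le
      exact Real.rpow_le_rpow_of_nonpos (pow_pos hb0 i) hbi (by linarith)
    set A := α / (b:ℝ) ^ m * (b:ℝ) ^ i with hAdef
    refine (h1 N hN2 A hA hAN (c' * (N:ℝ) ^ (-(δ/2))) (by positivity) (fun p => hdd.trans (hs i p))).trans ?_
    refine le_trans ?_ (hN0 N ((le_max_left _ _).trans hN)).le
    have e2 : A / N ≤ (N:ℝ) ^ (-δ) := by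
      rw [div_le_iff₀ hNp, ← Real.rpow_add_one hNp.ne']
      exact hi.trans_eq (by congr 1; ring)
    refine mul_le_mul_of_nonneg_left (add_le_add ?_ ?_) hC1.le
    · calc 1 / (1 + N * (c' * (N:ℝ) ^ (-(δ/2))) / A) ≤ 1 / (N * (c' * (N:ℝ) ^ (-(δ/2))) / A) := by
            apply one_div_le_one_div_of_le (by positivity); linarith
        _ = A / N * (1 / (c' * (N:ℝ) ^ (-(δ/2)))) := by field_simp
        _ ≤ (N:ℝ) ^ (-δ) * (1 / (c' * (N:ℝ) ^ (-(δ/2)))) := by gcongr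
        _ = (N:ℝ) ^ (-(δ/2)) / c' := by
            rw [show -δ = -(δ/2) + -(δ/2) by ring, Real.rpow_add hNp]; field_simp
    · rw [Real.rpow_neg hNp.le] at e2
      calc A / N * Real.log N ≤ ((N:ℝ) ^ δ)⁻¹ * Real.log N := by gcongr
        _ = _ := by ring
  · intro K hK η hη
    obtain ⟨N0, h⟩ := critical k hL hK hη
    exact ⟨N0, fun N hN i => h N hN _⟩
  · intro N hN i
    have hN2 : (2:ℝ) ≤ N := by exact_mod_cast hN
    have hlog : 0 ≤ Real.log N := Real.log_nonneg (by linarith)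
    refine (h2 N hN _ (by positivity)).trans ?_
    gcongr

end fin

end Rid

namespace Rid

open MeasureTheory Filter Topology Set

lemma piece (m : ℕ) {A L : ℝ} (hA : 0 < A) (hL : 0 < L) (s : ℂ) :
    ∫ x in (A * Real.exp (L * (-(1/2))))..(A * Real.exp (L * (1/2))), (pf m x : ℂ) * (x : ℂ) ^ (-s - 1)
      = L * Complex.exp (-(s * Real.log A)) * ∫ y in (-(1/2:ℝ))..(1/2), (pf m (A * Real.exp (L * y)) : ℂ) * Complex.exp (-(s * L * y)) := by
  have hmono : StrictMono (fun y : ℝ => A * Real.exp (L * y)) := by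
    intro x y h
    have : L * x < L * y := by nlinarith
    have := Real.exp_lt_exp.mpr this
    beta_reduce; nlinarith
  have him : (fun y : ℝ => A * Real.exp (L * y)) '' Ioc (-(1/2)) (1/2) = Ioc (A * Real.exp (L * (-(1/2)))) (A * Real.exp (L * (1/2))) := by
    ext x
    simp only [mem_image, mem_Ioc]
    constructor
    · rintro ⟨y, ⟨h1, h2⟩, rfl⟩
      exact ⟨hmono h1, hmono.monotone h2⟩
    · rintro ⟨h1, h2⟩
      have hx : 0 < x := lt_trans (by positivity) h1
      have e : A * Real.exp (L * (Real.log (x / A) / L)) = x := by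
        rw [mul_div_cancel₀ _ hL.ne', Real.exp_log (by positivity)]; field_simp
      rw [← e] at h1 h2
      exact ⟨_, ⟨hmono.lt_iff_lt.mp h1, hmono.le_iff_le.mp h2⟩, e⟩
  have hle : A * Real.exp (L * (-(1/2))) ≤ A * Real.exp (L * (1/2)) := hmono.monotone (by norm_num)
  rw [intervalIntegral.integral_of_le hle, ← him,
    integral_image_eq_integral_abs_deriv_smul (f' := fun y => A * (Real.exp (L * y) * L)) measurableSet_Ioc ?_ hmono.injective.injOn,
    intervalIntegral.integral_of_le (by norm_num), ← MeasureTheory.integral_const_mul]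
  · congr 1; ext y
    have hx : 0 < A * Real.exp (L * y) := by positivity
    rw [abs_of_pos (by positivity), Complex.real_smul, Complex.cpow_def_of_ne_zero (by exact_mod_cast hx.ne'),
      ← Complex.ofReal_log hx.le, Real.log_mul hA.ne' (Real.exp_pos _).ne', Real.log_exp]
    have e1 : ((A * (Real.exp (L * y) * L) : ℝ) : ℂ) = L * Complex.exp (Real.log A + L * y) := by
      rw [Complex.exp_add, ← Complex.ofReal_exp, Real.exp_log hA]; push_cast; ring
    rw [e1]
    have e2 : Complex.exp (Real.log A + L * y) * Complex.exp (((Real.log A + L * y : ℝ) : ℂ) * (-s - 1))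
        = Complex.exp (-(s * Real.log A)) * Complex.exp (-(s * L * y)) := by
      rw [← Complex.exp_add, ← Complex.exp_add]; congr 1; push_cast; ring
    linear_combination (L * (pf m (A * Real.exp (L * y)) : ℂ)) * e2
  · intro y _
    have := ((((hasDerivAt_id y).const_mul L).exp).const_mul A).hasDerivWithinAt (s := Ioc (-(1/2)) (1/2))
    simpa using this

section pr

variable {α L : ℝ} {β : ℝ}

lemma pieces (m0 : ℕ) {a0 : ℝ} (ha : 0 < a0) (hL : 0 < L) (s : ℂ)
    (hs : ∀ i : ℕ, Complex.exp (s * (log α - log (a0 * exp L ^ i))) = 1) (H : ℕ) :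
    Complex.exp (s * log α) * ∫ x in (a0 * exp (-(L/2)))..(a0 * exp L ^ H * exp (-(L/2))), (pf m0 x : ℂ) * (x : ℂ) ^ (-s - 1)
      = L * ∑ i ∈ range H, ∫ y in (-(1/2:ℝ))..(1/2), (pf m0 (a0 * exp L ^ i * exp (L * y)) : ℂ) * Complex.exp (-(s * L * y)) := by
  set X : ℕ → ℝ := fun i => a0 * exp L ^ i * exp (-(L/2)) with hX
  have hX0 : ∀ i, 0 < X i := fun i => by simp only [hX]; positivity
  have h0 : a0 * exp (-(L/2)) = X 0 := by simp [hX]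
  have hint : ∀ i < H, IntervalIntegrable (fun x : ℝ => (pf m0 x : ℂ) * x ^ (-s - 1)) volume (X i) (X (i+1)) := by
    intro i _
    refine pf_int m0 (fun x : ℝ => x ^ (-s - 1)) fun x hx => ContinuousAt.continuousWithinAt ?_
    have hx0 := lt_of_lt_of_le (lt_min (hX0 _) (hX0 _)) hx.1
    exact (continuousAt_cpow_const (Or.inl (by simpa using hx0))).comp continuous_ofReal.continuousAt
  rw [h0, show a0 * exp L ^ H * exp (-(L/2)) = X H from rfl,
    ← intervalIntegral.sum_integral_adjacent_intervals hint, mul_sum, mul_sum]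
  refine sum_congr rfl fun i _ => ?_
  have hA : 0 < a0 * exp L ^ i := by positivity
  have e1 : X i = a0 * exp L ^ i * exp (L * (-(1/2))) := by simp only [hX]; congr 2; ring
  have e2 : X (i+1) = a0 * exp L ^ i * exp (L * (1/2)) := by
    simp only [hX]
    rw [pow_succ, mul_assoc, mul_assoc, mul_assoc, ← exp_add]; congr 3; ring
  rw [e1, e2, piece m0 hA hL]
  have e3 : Complex.exp (s * log α) * Complex.exp (-(s * log (a0 * exp L ^ i))) = 1 := by
    rw [← hs i, ← Complex.exp_add]; congr 1; ring
  linear_combination (L * ∫ y in (-(1/2:ℝ))..(1/2), (pf m0 (a0 * exp L ^ i * exp (L * y)) : ℂ) * Complex.exp (-(s * L * y))) * e3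

end pr

lemma expone {α L : ℝ} (hα : 0 < α) (hL : 0 < L) (m i : ℕ) (n : ℤ) :
    Complex.exp (2 * π * I * n / L * (log α - log (α / exp L ^ m * exp L ^ i))) = 1 := by
  rw [Complex.exp_eq_one_iff]
  refine ⟨n * (m - i), ?_⟩
  have : log (α / exp L ^ m * exp L ^ i) = log α - m * L + i * L := by
    rw [log_mul (by positivity) (by positivity), log_div (by positivity) (by positivity), log_pow, log_pow, log_exp]
  rw [this]
  have : (L:ℂ) ≠ 0 := mod_cast hL.ne'
  push_cast; field

noncomputable def sn (L : ℝ) (n : ℤ) : ℂ := 2 * π * I * n / L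

lemma pairsum {α L : ℝ} (hα : 0 < α) (hL : 0 < L) (k m N H : ℕ) :
    ∑ n ∈ range N, (
      Complex.exp (sn L (n+1) * log α) * (∫ x in (α / exp L ^ m * exp (-(L/2)))..(α / Real.exp L ^ m * exp L ^ H * exp (-(L/2))), (pf (k+1) x : ℂ) * (x : ℂ) ^ (-(sn L (n+1)) - 1))
      + Complex.exp (sn L (-(n+1)) * Real.log α) * (∫ x in (α / Real.exp L ^ m * Real.exp (-(L/2)))..(α / Real.exp L ^ m * Real.exp L ^ H * Real.exp (-(L/2))), (pf (k+1) x : ℂ) * (x : ℂ) ^ (-(sn L (-(n+1))) - 1)))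
    = ((L * ∑ i ∈ range H, (TT k L N (α / Real.exp L ^ m * Real.exp L ^ i) - MM k L (α / Real.exp L ^ m * Real.exp L ^ i)) : ℝ) : ℂ) := by
  have ha0 : 0 < α / Real.exp L ^ m := by positivity
  have hLc : (L:ℂ) ≠ 0 := mod_cast hL.ne'
  have hs : ∀ n : ℤ, _ := fun n => pieces (α := α) (k+1) ha0 hL (sn L n) (fun i => expone hα hL m i n) H
  simp only [hs, ← mul_add, ← mul_sum, ← sum_add_distrib]
  push_cast
  congr 1
  rw [sum_comm]
  refine sum_congr rfl fun i _ => ?_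
  set A := α / Real.exp L ^ m * Real.exp L ^ i
  obtain ⟨C, hC, hCb⟩ := pf_bdd (k+1)
  have ii : ∀ (g : ℝ → ℝ), Continuous g → IntervalIntegrable (fun y => pf (k+1) (A * Real.exp (L * y)) * g y) volume (-(1/2)) (1/2) :=
    fun g hg => bi (pfg_meas (k+1) A L) (fun x => hCb _) hg _ _
  have key : ∀ n : ℕ, (∫ y in (-(1/2:ℝ))..(1/2), (pf (k+1) (A * Real.exp (L * y)) : ℂ) * Complex.exp (-(sn L (n+1) * L * y)))
      + (∫ y in (-(1/2:ℝ))..(1/2), (pf (k+1) (A * Real.exp (L * y)) : ℂ) * Complex.exp (-(sn L (-(n+1)) * L * y)))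
      = ((∫ y in (-(1/2:ℝ))..(1/2), pf (k+1) (A * Real.exp (L * y)) * (2 * Real.cos (2 * π * (n+1) * y)) : ℝ) : ℂ) := by
    intro n
    have jj : ∀ z : ℂ, IntervalIntegrable (fun y : ℝ => (pf (k+1) (A * Real.exp (L * y)) : ℂ) * Complex.exp (-(z * L * y))) volume (-(1/2)) (1/2) := by
      intro z
      have h1 : IntervalIntegrable (fun y : ℝ => Complex.exp (-(z * L * y))) volume (-(1/2)) (1/2) :=
        (by fun_prop : Continuous fun y : ℝ => Complex.exp (-(z * L * y))).intervalIntegrable _ _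
      rw [intervalIntegrable_iff] at h1 ⊢
      exact h1.bdd_mul (c := C) ((measurable_ofReal.comp (pfg_meas (k+1) A L)).aestronglyMeasurable)
        (by filter_upwards with x; simpa using hCb _)
    rw [← integral_add (jj _) (jj _), ← integral_ofReal]
    congr 1; ext y
    push_cast
    rw [← mul_add, Complex.two_cos]
    have e1 : -(sn L (n+1) * L * y) = -(2 * π * (n+1) * y) * I := by
      simp only [sn]; push_cast; field_simp
    have e2 : -(sn L (-(n+1)) * L * y) = (2 * π * (n+1) * y) * I := by
      simp only [sn]; push_cast; field_simp
    rw [e1, e2, add_comm (Complex.exp _)]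
  simp only [key]
  rw [← ofReal_sum, ← ofReal_sub]
  congr 1
  rw [← intervalIntegral.integral_finsetSum (fun n _ => ii _ (by fun_prop)), TT, MM]
  have := ii (fun _ => 1) continuous_const
  rw [← integral_sub (ii _ (DN_cont N)) (by simpa using this)]
  congr 1; ext y
  simp only [DN, ← mul_sum]
  ring

end Rid

namespace Rid

open MeasureTheory Filter Topology Set

lemma gam1 {t : ℝ} (ht : 0 < t) : ‖Gamma (1 + t * I)‖ ^ 2 * sinh (π * t) = π * t := by
  have h1 := Complex.Gamma_mul_Gamma_one_sub (t * I)
  have hz : (t * I : ℂ) ≠ 0 := mul_ne_zero (by exact_mod_cast ht.ne') Complex.I_ne_zero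
  have h2 := Gamma_add_one _ hz
  have h3 : Gamma (1 - t * I) = (starRingEnd ℂ) (Complex.Gamma (1 + t * Complex.I)) := by
    rw [← Complex.Gamma_conj]; congr 1; simp [sub_eq_add_neg]
  have h4 : Complex.Gamma (1 + t * Complex.I) * Complex.Gamma (1 - t * Complex.I) = t * Complex.I * (π / Complex.sin (π * (t * Complex.I))) := by
    rw [← h1, add_comm, h2]; ring
  have hsinh : 0 < sinh (π * t) := sinh_pos_iff.mpr (by positivity)
  rw [h3, Complex.mul_conj, ← mul_assoc, Complex.sin_mul_I, Complex.normSq_eq_norm_sq, ← Complex.ofReal_mul, ← Complex.ofReal_sinh] at h4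
  have hc : (sinh (π * t) : ℂ) ≠ 0 := by exact_mod_cast hsinh.ne'
  have hI := Complex.I_ne_zero
  have : ((‖Complex.Gamma (1 + t * Complex.I)‖ ^ 2 * sinh (π * t) : ℝ) : ℂ) = ((π * t : ℝ) : ℂ) := by
    rw [Complex.ofReal_mul, h4, Complex.ofReal_mul]; generalize (sinh (π * t) : ℂ) = z at hc; field_simp
  exact_mod_cast this

lemma gam2 {t0 : ℝ} (h0 : 0 < t0) : ∃ C > 0, ∀ t : ℝ, t0 ≤ t → ‖Gamma (1 + t * I)‖ * exp (π * t / 2) ≤ C * t ^ (1/2:ℝ) := by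
  set q := 1 - exp (-(2 * π * t0)) with hq
  have hq0 : 0 < q := by
    have : exp (-(2 * π * t0)) < 1 := by rw [exp_lt_one_iff]; have := pi_pos; nlinarith
    linarith
  refine ⟨sqrt (2 * π / q), by have := pi_pos; positivity, fun t ht => ?_⟩
  have htp : 0 < t := by linarith
  have hpi := pi_pos
  have h := gam1 htp
  rw [← sqrt_eq_rpow, ← sqrt_mul (by positivity)]
  apply le_sqrt_of_sq_le
  have e1 : exp (π * t / 2) ^ 2 = exp (π * t) := by rw [← exp_nat_mul]; congr 1; ring
  rw [mul_pow, e1]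
  have e2 : exp (π * t) * q ≤ 2 * sinh (π * t) := by
    rw [sinh_eq]
    have : exp (-(π * t)) ≤ exp (π * t) * exp (-(2 * π * t0)) := by
      rw [← exp_add]; apply exp_le_exp.mpr; nlinarith
    rw [hq]; linarith
  rw [div_mul_eq_mul_div, le_div_iff₀ hq0]
  nlinarith

lemma gam3 {t0 : ℝ} (h0 : 0 < t0) (k : ℕ) : ∃ C > 0, ∀ t : ℝ, t0 ≤ t →
    ‖Gamma (k + 1 + t * I)‖ * exp (π * t / 2) ≤ C * t ^ ((k:ℝ) + 1/2) := by
  induction k with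
  | zero => simpa using gam2 h0
  | succ k ih =>
    obtain ⟨C, hC, h⟩ := ih
    refine ⟨C * ((k + 1) / t0 + 1), by positivity, fun t ht => ?_⟩
    have htp : 0 < t := by linarith
    have hz : (k + 1 + t * I : ℂ) ≠ 0 := by
      intro h; have := congrArg Complex.im h; simp at this; linarith
    have e := Gamma_add_one _ hz
    have e1 : ((k + 1 : ℕ) : ℂ) + 1 + t * I = k + 1 + t * I + 1 := by push_cast; ring
    rw [e1, e, norm_mul]
    have hn : ‖(k + 1 + t * I : ℂ)‖ ≤ ((k + 1) / t0 + 1) * t := by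
      have h1 : ‖(k + 1 + t * Complex.I : ℂ)‖ ≤ (k + 1) + t := by
        refine (norm_add_le _ _).trans ?_
        have : ‖(k + 1 : ℂ)‖ = k + 1 := by exact_mod_cast Complex.norm_natCast (k+1)
        rw [this]; simp [abs_of_pos htp]
      have : (k + 1 : ℝ) ≤ (k + 1) / t0 * t := by
        rw [div_mul_eq_mul_div, le_div_iff₀ h0]; gcongr
      linarith
    calc _ = ‖(k + 1 + t * I : ℂ)‖ * (‖Gamma (k + 1 + t * I)‖ * exp (π * t / 2)) := by ring
      _ ≤ ((k + 1) / t0 + 1) * t * (C * t ^ ((k:ℝ) + 1/2)) := mul_le_mul hn (h t ht) (by positivity) (by positivity)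
      _ = C * ((k + 1) / t0 + 1) * (t ^ ((k:ℝ) + 1/2) * t) := by ring
      _ = _ := by rw [← rpow_add_one htp.ne']; congr 2; push_cast; ring

lemma zbd {k : ℕ} (hk : 1 ≤ k) : ∃ C > 0, ∀ w : ℂ, w.re = k + 1 → ‖riemannZeta w‖ ≤ C := by
  have hk' : (1:ℝ) ≤ k := by exact_mod_cast hk
  have hs : Summable (fun n : ℕ => 1 / (n:ℝ) ^ ((k:ℝ) + 1)) := summable_one_div_nat_rpow.mpr (by linarith)
  refine ⟨∑' n : ℕ, 1 / (n:ℝ) ^ ((k:ℝ) + 1) + 1, by positivity, fun w hw => ?_⟩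
  rw [zeta_eq_tsum_one_div_nat_cpow (by rw [hw]; linarith)]
  refine le_trans (tsum_of_norm_bounded hs.hasSum fun n => ?_) (by linarith)
  rcases Nat.eq_zero_or_pos n with rfl | hn
  · rw [Nat.cast_zero, Complex.zero_cpow (by intro h; rw [h] at hw; simp at hw; linarith)]; simp
    positivity
  · rw [norm_div, norm_one, Complex.norm_natCast_cpow_of_pos hn, hw]

lemma cosb {k : ℕ} {t : ℝ} (ht : 0 < t) : ‖Complex.cos (π * (k + 1 + t * I) / 2)‖ ≤ exp (π * t / 2) := by
  have h1 : ∀ z : ℂ, ‖Complex.cos z‖ ≤ exp |z.im| := by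
    intro z
    rw [Complex.cos, norm_div]
    have a1 : ‖Complex.exp (z * I)‖ ≤ exp |z.im| := by
      rw [norm_exp]; apply exp_le_exp.mpr; simp; exact neg_le_abs _
    have a2 : ‖Complex.exp (-z * I)‖ ≤ exp |z.im| := by
      rw [norm_exp]; apply exp_le_exp.mpr; simp; exact le_abs_self _
    have := (norm_add_le (Complex.exp (z * I)) (Complex.exp (-z * I)))
    rw [Complex.norm_ofNat, div_le_iff₀ (by norm_num)]; linarith
  refine (h1 _).trans_eq ?_
  have : (π * (k + 1 + t * I) / 2 : ℂ).im = π * t / 2 := by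
    rw [show (π * (k + 1 + t * I) / 2 : ℂ) = ((π * (k+1) / 2 : ℝ) : ℂ) + ((π * t / 2 : ℝ) : ℂ) * I by push_cast; ring]
    simp
  rw [this, abs_of_pos (by have := pi_pos; positivity)]

lemma zeta_up {t0 : ℝ} (h0 : 0 < t0) {k : ℕ} (hk : 1 ≤ k) : ∃ C > 0, ∀ t : ℝ, t0 ≤ t →
    ‖riemannZeta (-(k:ℂ) - t * I)‖ ≤ C * t ^ ((k:ℝ) + 1/2) := by
  obtain ⟨C1, hC1, h1⟩ := gam3 h0 k
  obtain ⟨C2, hC2, h2⟩ := zbd hk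
  refine ⟨2 * C1 * C2, by positivity, fun t ht => ?_⟩
  have htp : 0 < t := by linarith
  set w : ℂ := k + 1 + t * I with hw
  have him : w.im = t := by simp [hw]
  have hre : w.re = k + 1 := by simp [hw]
  rw [show -k - t * I = 1 - w by rw [hw]; ring, riemannZeta_one_sub]
  · rw [norm_mul, norm_mul, norm_mul, norm_mul, Complex.norm_ofNat]
    have e1 : ‖(2 * (π:ℂ)) ^ (-w)‖ ≤ 1 := by
      have hp : 0 < 2 * π := by have := pi_pos; positivity
      rw [show (2 * π) = ((2 * π : ℝ) : ℂ) by push_cast; ring, Complex.norm_cpow_eq_rpow_re_of_pos hp, Complex.neg_re, hre]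
      exact rpow_le_one_of_one_le_of_nonpos (by linarith [pi_gt_three]) (by linarith)
    have e2 := cosb (k := k) htp
    have e3 := h1 t ht
    have e4 := h2 w hre
    calc _ ≤ 2 * 1 * ‖Gamma w‖ * exp (π * t / 2) * C2 := by gcongr
      _ = 2 * (‖Gamma w‖ * exp (π * t / 2)) * C2 := by ring
      _ ≤ 2 * (C1 * t ^ ((k:ℝ) + 1/2)) * C2 := by gcongr
      _ = _ := by ring
  · intro n h; rw [h] at him; simp at him; linarith
  · intro h; rw [h] at him; simp at him; linarith

lemma zeta_both {t0 : ℝ} (h0 : 0 < t0) {k : ℕ} (hk : 1 ≤ k) : ∃ C > 0, ∀ t : ℝ, t0 ≤ |t| →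
    ‖riemannZeta (-(k:ℂ) + t * I)‖ ≤ C * |t| ^ ((k:ℝ) + 1/2) := by
  obtain ⟨C, hC, h⟩ := zeta_up h0 hk
  refine ⟨C, hC, fun t ht => ?_⟩
  have h' := h _ ht
  rcases le_total 0 t with h1 | h1
  · rw [abs_of_nonneg h1] at h' ⊢
    have := riemannZeta_conj (-k + t * I)
    rw [← Complex.norm_conj, ← this]
    convert h' using 3
    simp [sub_eq_add_neg]
  · rw [abs_of_nonpos h1] at h' ⊢
    convert h' using 3
    push_cast; ring

end Rid

namespace Rid

open MeasureTheory Filter Topology Set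

lemma norm_sub_nat {s : ℂ} (hs : s.re = 0) (j : ℕ) : ‖s‖ ≤ ‖s - j‖ := by
  have h1 : ‖s‖ = |s.im| := by
    rw [show s = (s.im : ℂ) * I from ext (by simp [hs]) (by simp)]; simp
  rw [h1]
  have := abs_im_le_norm (s - j)
  simpa using this

lemma prod_inv (m : ℕ) : ∃ c : ℝ, 0 ≤ c ∧ (m ≤ 1 → c = 0) ∧ ∀ s : ℂ, s.re = 0 → s ≠ 0 →
    ‖1 / ∏ j ∈ range m, (s - j) - 1 / s ^ m‖ ≤ c / ‖s‖ ^ (m + 1) := by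
  induction m with
  | zero => exact ⟨0, le_rfl, fun _ => rfl, fun s _ _ => by simp⟩
  | succ m ih =>
    obtain ⟨c, hc, hc1, h⟩ := ih
    refine ⟨c + m, by positivity, fun hm => ?_, fun s hs hs0 => ?_⟩
    · have : m = 0 := by omega
      subst this; simp [hc1]
    have hn := norm_sub_nat hs m
    have hp := norm_pos_iff.mpr hs0
    have hsm := norm_pos_iff.mp (hp.trans_le hn)
    rw [prod_range_succ]
    have e : 1 / ((∏ j ∈ range m, (s - j)) * (s - m)) - 1 / s ^ (m+1)
        = (1 / ∏ j ∈ range m, (s - j) - 1 / s ^ m) / (s - m) + m / (s ^ m * s * (s - m)) := by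
      rw [← div_div, sub_div]
      have : 1 / s ^ (m+1) = 1 / s ^ m / (s - m) - m / (s ^ m * s * (s - m)) := by rw [pow_succ]; field_simp
      rw [this]; ring
    rw [e]
    refine (norm_add_le _ _).trans ?_
    rw [norm_div, norm_div, norm_mul, norm_mul, norm_pow, Complex.norm_natCast, add_div]
    refine add_le_add ?_ ?_
    · calc _ ≤ (c / ‖s‖ ^ (m+1)) / ‖s‖ := div_le_div₀ (by positivity) (h s hs hs0) hp hn
        _ = _ := by rw [pow_succ _ (m+1)]; field_simp
    · calc _ ≤ m / (‖s‖ ^ m * ‖s‖ * ‖s‖) := by gcongr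
        _ = _ := by rw [pow_succ, pow_succ]

lemma sn_facts {L : ℝ} (hL : 0 < L) (n : ℤ) : (sn L n).re = 0 ∧ ‖sn L n‖ = 2 * π / L * |(n:ℝ)| ∧ sn L n = ((2 * π * n / L : ℝ) : ℂ) * I := by
  have e : sn L n = ((2 * π * n / L : ℝ) : ℂ) * I := by simp only [sn]; push_cast; ring
  refine ⟨by rw [e]; simp, ?_, e⟩
  rw [e, norm_mul, norm_I, norm_real, norm_eq_abs, abs_div, abs_mul, abs_of_pos hL, abs_of_pos (by have := pi_pos; positivity)]
  ring

lemma Rpair {α L : ℝ} (hα : 0 < α) (hL : 0 < L) (k m : ℕ) : ∃ K > 0, ∀ n : ℕ,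
    ‖Complex.exp (sn L (n+1) * log α) * Rr (α / exp L ^ m * exp (-(L/2))) (k+1) (sn L (n+1))
      + Complex.exp (sn L (-(n+1)) * log α) * Rr (α / exp L ^ m * exp (-(L/2))) (k+1) (sn L (-(n+1)))‖ ≤ K / ((n:ℝ)+1) ^ 2 := by
  set a := α / exp L ^ m * exp (-(L/2)) with ha
  have ha0 : 0 < a := by positivity
  have hpi := pi_pos
  have hLc : (L:ℂ) ≠ 0 := by exact_mod_cast hL.ne'
  set K := (∑ j ∈ range (k+1+1), ‖((Polynomial.bernoulli (k+1)).coeff j : ℂ)‖ * a ^ j * (2 * j)) / (2 * π / L) ^ 2 with hK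
  have hK0 : 0 ≤ K := by positivity
  refine ⟨K + 1, by positivity, fun n => ?_⟩
  obtain ⟨f1, f2, f3⟩ := sn_facts hL (n+1)
  set s := sn L (n+1) with hs
  have hneg : sn L (-(n+1)) = -s := by rw [hs]; simp only [sn]; push_cast; ring
  have hnp : (0:ℝ) < (n:ℝ) + 1 := by positivity
  have f2' : ‖s‖ = 2 * π / L * ((n:ℝ)+1) := by rw [f2]; push_cast; rw [abs_of_pos hnp]
  have hsp : 0 < ‖s‖ := by rw [f2']; positivity
  rw [hneg]
  have hlog : log a = log α - L * m - L / 2 := by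
    rw [ha, log_mul (by positivity) (by positivity), log_div (by positivity) (by positivity), log_pow, log_exp, log_exp]; ring
  set z := Complex.exp (s * (log α - log a)) with hz
  have hz1 : z * z = 1 := by
    rw [hz, ← Complex.exp_add, Complex.exp_eq_one_iff]
    refine ⟨(n+1) * (2 * m + 1), ?_⟩
    rw [hlog, hs]; simp only [sn]; push_cast; field_simp; ring
  have hzn : ‖z‖ = 1 := by
    have := congrArg norm hz1
    rw [norm_mul, norm_one] at this
    nlinarith [norm_nonneg z]
  have hz2 : Complex.exp (-s * (log α - log a)) = z := by
    have h1 : Complex.exp (-s * (log α - log a)) * z = 1 := by rw [hz, ← Complex.exp_add]; ring_nf; simp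
    have h2 : z ≠ 0 := Complex.exp_ne_zero _
    exact mul_right_cancel₀ h2 (h1.trans hz1.symm)
  have hpow : ∀ (w : ℂ) (j : ℕ), Complex.exp (w * log α) * (a:ℂ) ^ ((j:ℂ) - w) = a ^ j * Complex.exp (w * (log α - log a)) := by
    intro w j
    have hac : (a:ℂ) ≠ 0 := by exact_mod_cast ha0.ne'
    rw [Complex.cpow_sub _ _ hac, Complex.cpow_natCast, Complex.cpow_def_of_ne_zero hac, ← Complex.ofReal_log ha0.le, mul_sub, Complex.exp_sub, mul_comm (log a : ℂ)]
    field_simp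
  have hterm : Complex.exp (s * log α) * Rr a (k+1) s + Complex.exp (-s * log α) * Rr a (k+1) (-s)
      = ∑ j ∈ range (k+1+1), ((Polynomial.bernoulli (k+1)).coeff j : ℂ) * a ^ j * (z * (2 * j / ((s - j) * (s + j)))) := by
    rw [Rr, Rr, mul_sum, mul_sum, ← sum_add_distrib]
    refine sum_congr rfl fun j _ => ?_
    have n1 := norm_sub_nat f1 j
    have n2 := norm_sub_nat (s := -s) (by simp [f1]) j
    rw [norm_neg] at n2
    have d1 : s - j ≠ 0 := norm_pos_iff.mp (hsp.trans_le n1)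
    have d2 : -s - j ≠ 0 := norm_pos_iff.mp (hsp.trans_le n2)
    have d3 : s + j ≠ 0 := by intro h; apply d2; linear_combination -h
    have p1 := hpow s j
    have p2 := hpow (-s) j
    rw [hz2] at p2
    rw [← hz] at p1
    have d4 : (1:ℂ) / (-s - j) = - (1 / (s + j)) := by rw [← neg_add', one_div, one_div, inv_neg]
    have d5 : (1:ℂ) / (s - j) - 1 / (s + j) = 2 * j / ((s - j) * (s + j)) := by field_simp; ring
    rw [← d5]
    linear_combination ((Polynomial.bernoulli (k+1)).coeff j : ℂ) * (1 / (s - j)) * p1 + ((Polynomial.bernoulli (k+1)).coeff j : ℂ) * (1 / (-s - j)) * p2 + ((Polynomial.bernoulli (k+1)).coeff j : ℂ) * (a ^ j * z) * d4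
  rw [hterm]
  refine (norm_sum_le _ _).trans ?_
  have : ∑ j ∈ range (k+1+1), ‖((Polynomial.bernoulli (k+1)).coeff j : ℂ) * a ^ j * (z * (2 * j / ((s - j) * (s + j))))‖
      ≤ ∑ j ∈ range (k+1+1), ‖((Polynomial.bernoulli (k+1)).coeff j : ℂ)‖ * a ^ j * (2 * j) / ‖s‖ ^ 2 := by
    refine sum_le_sum fun j _ => ?_
    have n1 := norm_sub_nat f1 j
    have n2 := norm_sub_nat (s := -s) (by simp [f1]) j
    rw [norm_neg, ← neg_add', norm_neg] at n2
    rw [norm_mul, norm_mul, norm_mul, hzn, one_mul, norm_div, norm_mul, norm_mul, norm_pow, Complex.norm_natCast, Complex.norm_ofNat, Complex.norm_real, norm_eq_abs, abs_of_pos ha0, sq, mul_div_assoc _ (2 * (j:ℝ)) (‖s‖ * ‖s‖)]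
    gcongr
  refine this.trans ?_
  rw [← sum_div, f2', mul_pow, ← div_div, ← hK]
  gcongr; linarith

end Rid

namespace Rid

open MeasureTheory Filter Topology Set

lemma sumpair (f : ℤ → ℂ) (N : ℕ) : ∑ n ∈ (Finset.Icc (-(N:ℤ)) N).erase 0, f n
    = ∑ n ∈ range N, (f (n+1) + f (-(n+1))) := by
  induction N with
  | zero => simp
  | succ N ih =>
    rw [sum_range_succ, ← ih]
    have e : (Finset.Icc (-((N+1 : ℕ):ℤ)) ((N+1 : ℕ):ℤ)).erase 0 = insert ((N:ℤ)+1) (insert (-((N:ℤ)+1)) ((Finset.Icc (-(N:ℤ)) N).erase 0)) := by grind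
    rw [e, sum_insert, sum_insert]
    · ring
    · simp
    · simp only [Finset.mem_erase, Finset.mem_Icc, Finset.mem_insert]; omega

lemma err {L : ℝ} (hL : 0 < L) (k : ℕ) : ∃ C > 0, ∀ n : ℤ, n ≠ 0 →
    ‖((k+1).factorial : ℂ) * riemannZeta (-(k:ℂ) + sn L n) / sn L n ^ (k+1) - Ik (k+1) (sn L n)‖ ≤ C / |(n:ℝ)| ^ (3/2:ℝ) := by
  obtain ⟨c, hc, hc1, h⟩ := prod_inv (k+1)
  have hpi := pi_pos
  set t0 := 2 * π / L with ht0
  have ht0p : 0 < t0 := by positivity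
  have hn1 : ∀ n : ℤ, n ≠ 0 → 1 ≤ |(n:ℝ)| := fun n hn => by
    exact_mod_cast Int.one_le_abs hn
  have key : ∀ n : ℤ, n ≠ 0 → ‖((k+1).factorial : ℂ) * riemannZeta (-k + sn L n) / sn L n ^ (k+1) - Ik (k+1) (sn L n)‖
      ≤ (k+1).factorial * ‖riemannZeta (-k + sn L n)‖ * (c / ‖sn L n‖ ^ (k+1+1)) := by
    intro n hn
    obtain ⟨f1, f2, f3⟩ := sn_facts hL n
    have hs0 : sn L n ≠ 0 := norm_pos_iff.mp (by rw [f2]; have := hn1 n hn; positivity)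
    have e : ((k+1).factorial : ℂ) * riemannZeta (-(k:ℂ) + sn L n) / sn L n ^ (k+1) - Ik (k+1) (sn L n)
        = -(((k+1).factorial : ℂ) * riemannZeta (-k + sn L n) * (1 / ∏ j ∈ range (k+1), (sn L n - j) - 1 / sn L n ^ (k+1))) := by
      rw [Ik, show sn L n - ((k+1 : ℕ):ℂ) + 1 = -k + sn L n by push_cast; ring]; ring
    rw [e, norm_neg, norm_mul, norm_mul, Complex.norm_natCast]
    exact mul_le_mul_of_nonneg_left (h _ f1 hs0) (by positivity)
  rcases Nat.eq_zero_or_pos k with rfl | hk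
  · refine ⟨1, one_pos, fun n hn => (key n hn).trans ?_⟩
    rw [hc1 le_rfl]; simp; positivity
  · obtain ⟨Z, hZ, hz⟩ := zeta_both ht0p hk
    refine ⟨(k+1).factorial * Z * c * t0 ^ (-(3/2:ℝ)) + 1, by positivity, fun n hn => (key n hn).trans ?_⟩
    obtain ⟨f1, f2, f3⟩ := sn_facts hL n
    have hn1' := hn1 n hn
    have hT : |2 * π * n / L| = ‖sn L n‖ := by rw [f3, norm_mul, Complex.norm_I, mul_one, Complex.norm_real, norm_eq_abs]
    have hTp : 0 < ‖sn L n‖ := by rw [f2]; positivity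
    have hz' := hz (2 * π * n / L) (by rw [hT, f2]; nlinarith)
    rw [← f3, hT] at hz'
    have e1 : ‖sn L n‖ ^ ((k:ℝ) + 1/2) / ‖sn L n‖ ^ (k+1+1) = ‖sn L n‖ ^ (-(3/2:ℝ)) := by
      rw [← rpow_natCast, ← rpow_sub hTp]; congr 1; push_cast; ring
    calc _ ≤ (k+1).factorial * (Z * ‖sn L n‖ ^ ((k:ℝ) + 1/2)) * (c / ‖sn L n‖ ^ (k+1+1)) := by gcongr
      _ = (k+1).factorial * Z * c * (‖sn L n‖ ^ ((k:ℝ) + 1/2) / ‖sn L n‖ ^ (k+1+1)) := by ring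
      _ = (k+1).factorial * Z * c * t0 ^ (-(3/2:ℝ)) / |(n:ℝ)| ^ (3/2:ℝ) := by
        rw [e1, f2, mul_rpow ht0p.le (by positivity), rpow_neg (abs_nonneg (n:ℝ)) (3/2)]
        ring
      _ ≤ _ := by gcongr; linarith

lemma window {α : ℝ} {b : ℕ} (hα : 0 < α) (hb : 2 ≤ b) (k m : ℕ) : ∃ C > 0, ∀ N : ℕ, 1 ≤ N → ∀ᶠ H : ℕ in atTop,
    |∑ i ∈ range H, (if α / (b:ℝ) ^ m * (b:ℝ) ^ i < α * N then pf (k+1) (α / (b:ℝ) ^ m * (b:ℝ) ^ i) else 0)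
      - ∑ h ∈ Finset.Ioo (0:ℤ) ⌈log N / log b⌉, pf (k+1) ((b:ℝ) ^ h * α)| ≤ C := by
  have hb1 : (1:ℝ) < b := by exact_mod_cast (by omega : 1 < b)
  have hb0 : (0:ℝ) < b := by linarith
  have hL : 0 < log b := log_pos hb1
  obtain ⟨C, hC, h⟩ := pf_bdd (k+1)
  refine ⟨(m+1) * C, by positivity, fun N hN => ?_⟩
  have hNp : (0:ℝ) < N := by exact_mod_cast hN
  set c := ⌈log N / log b⌉ with hc
  filter_upwards [eventually_ge_atTop (m + 1 + c.toNat)] with H hH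
  obtain ⟨H', rfl⟩ := Nat.exists_eq_add_of_le (show m + 1 ≤ H by omega)
  have hH' : c.toNat ≤ H' := by omega
  rw [sum_range_add]
  have e : ∑ j ∈ range H', (if α / (b:ℝ) ^ m * (b:ℝ) ^ (m + 1 + j) < α * N then pf (k+1) (α / (b:ℝ) ^ m * (b:ℝ) ^ (m + 1 + j)) else 0)
      = ∑ h ∈ Finset.Ioo 0 c, pf (k+1) (b ^ h * α) := by
    have e1 : ∀ j : ℕ, α / (b:ℝ) ^ m * (b:ℝ) ^ (m + 1 + j) = (b:ℝ) ^ ((j:ℤ)+1) * α := by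
      intro j
      rw [show ((j:ℤ)+1) = ((j+1 : ℕ) : ℤ) by push_cast; ring, zpow_natCast, show m + 1 + j = m + (j + 1) by ring, pow_add]
      field_simp
    have e2 : ∀ j : ℕ, (b:ℝ) ^ ((j:ℤ)+1) * α < α * N ↔ (j:ℤ) + 1 < c := by
      intro j
      rw [mul_comm, mul_lt_mul_iff_right₀ hα, hc, Int.lt_ceil, lt_div_iff₀ hL, ← log_zpow]
      exact (log_lt_log_iff (by positivity) hNp).symm
    simp only [e1, e2]
    rw [← Finset.sum_filter]
    refine Finset.sum_nbij (fun j : ℕ => (j:ℤ) + 1) ?_ ?_ ?_ (fun j _ => rfl)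
    · intro j hj; simp only [Finset.mem_filter, Finset.mem_range] at hj; simp only [Finset.mem_Ioo]; omega
    · intro j _ l _ hjl; simpa using hjl
    · intro h hh
      simp only [Finset.coe_Ioo, mem_Ioo] at hh
      refine ⟨(h-1).toNat, ?_, ?_⟩
      · simp only [Finset.coe_filter, Finset.mem_range, mem_setOf_eq]; omega
      · beta_reduce; omega
  rw [e, add_sub_cancel_right]
  refine (Finset.abs_sum_le_sum_abs _ _).trans ?_
  calc _ ≤ ∑ i ∈ range (m+1), C := by
        refine sum_le_sum fun i _ => ?_
        split_ifs
        · exact h _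
        · simpa using hC.le
    _ = _ := by simp

lemma MMsum {α : ℝ} {b : ℕ} (hα : 0 < α) (hb : 2 ≤ b) (k m : ℕ) : ∃ C > 0, ∀ H : ℕ,
    |∑ i ∈ range H, MM k (log b) (α / (b:ℝ) ^ m * (b:ℝ) ^ i)| ≤ C := by
  have hb1 : (1:ℝ) < b := mod_cast (by omega : 1 < b)
  have hL := log_pos hb1
  have ha0 : 0 < α / (b:ℝ) ^ m := by positivity
  obtain ⟨C, hC, h⟩ := MM_bd k hL
  refine ⟨C * (b / (b - 1) / (α / b ^ m / 2)), by positivity, fun H => ?_⟩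
  have hg := geo_dn hb1 ha0 (Y := α / b ^ m / 2) (by positivity) H
  refine (abs_sum_le_sum_abs _ _).trans ?_
  refine le_trans ?_ (mul_le_mul_of_nonneg_left hg hC.le)
  rw [mul_sum]
  refine sum_le_sum fun i _ => ?_
  have h1 : (1:ℝ) ≤ (b:ℝ) ^ i := one_le_pow₀ hb1.le
  rw [if_pos (by nlinarith), mul_one_div]
  exact h _ (by positivity)

end Rid

namespace Rid

open MeasureTheory Filter Topology Set

lemma psi_pf (k : ℕ) {x : ℝ} (hx : Irrational x) : psiB k x = pf k x := by
  unfold psiB pf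
  split_ifs with h1 h2
  · exact absurd (Int.fract_eq_zero_iff.mp h2) (fun ⟨z, hz⟩ => hx.ne_int z hz.symm)
  · subst h1; rw [bernoulliFun_one]
  · rw [bernoulliFun, Polynomial.eval_map_algebraMap]

lemma sum_bd {f : ℕ → ℂ} {K p : ℝ} (hp : 1 < p) (hK : 0 ≤ K) (hf : ∀ n, ‖f n‖ ≤ K / ((n:ℝ)+1) ^ p) :
    ∃ C > 0, ∀ N : ℕ, ‖∑ n ∈ range N, f n‖ ≤ C := by
  have hs : Summable (fun n : ℕ => K / (n+1) ^ p) := by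
    have := ((summable_nat_add_iff 1).mpr (summable_one_div_nat_rpow.mpr hp)).mul_left K
    refine this.congr fun n => ?_
    push_cast; ring
  refine ⟨∑' n : ℕ, K / (n+1) ^ p + 1, add_pos_of_nonneg_of_pos (tsum_nonneg fun n => by positivity) one_pos, fun N => ?_⟩
  refine (norm_sum_le _ _).trans ((sum_le_sum fun n _ => hf n).trans ?_)
  have := hs.sum_le_tsum (range N) (fun n _ => by positivity)
  linarith

set_option maxHeartbeats 1000000 in
lemma Sbound {α : ℝ} {b : ℕ} (hα : 0 < α) (halg : IsAlgebraic ℚ α) (hirr : Irrational α) (hb : 2 ≤ b) (k : ℕ) :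
    ∃ C > 0, ∀ ε > 0, ∃ N0 : ℕ, ∀ N ≥ N0,
    ‖∑ n ∈ range N, (Complex.exp (sn (log b) (n+1) * log α) * Ik (k+1) (sn (log b) (n+1))
        + Complex.exp (sn (log b) (-(n+1)) * log α) * Ik (k+1) (sn (log b) (-(n+1))))
      + ((log b * ∑ h ∈ Finset.Ioo (0:ℤ) ⌈log N / log b⌉, pf (k+1) ((b:ℝ) ^ h * α) : ℝ) : ℂ)‖ ≤ C + ε * log N := by
  have hb1 : (1:ℝ) < b := by exact_mod_cast (by omega : 1 < b)
  have hb0 : (0:ℝ) < b := by linarith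
  have hL : 0 < log b := log_pos hb1
  have hexp : exp (log b) = b := exp_log hb0
  obtain ⟨m, hm⟩ := pow_unbounded_of_one_lt α hb1
  obtain ⟨K1, hK1, h1⟩ := Rpair hα hL k m
  obtain ⟨K2, hK2, h2⟩ := sum_bd (p := 2) (by norm_num) hK1.le (fun n => (h1 n).trans_eq (by rw [← rpow_natCast]; norm_num))
  obtain ⟨K3, hK3, h3⟩ := window hα hb k m
  obtain ⟨K4, hK4, h4⟩ := MMsum hα hb k m
  have hps := fun N H => pairsum hα hL k m N H
  simp only [hexp] at h2 hps
  set L := log b with hLdef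
  set a := α / b ^ m * exp (-(L/2)) with ha
  have ha0 : 0 < a := by positivity
  have ha1 : a < 1 := by
    have e1 : α / (b:ℝ) ^ m < 1 := (div_lt_one (by positivity)).mpr hm
    have e2 : exp (-(L/2)) < 1 := exp_lt_one_iff.mpr (by linarith)
    have e3 := exp_pos (-(L/2))
    have e4 : 0 < α / (b:ℝ) ^ m := by positivity
    rw [ha]; nlinarith
  refine ⟨K2 + L * (K3 + K4), by positivity, fun ε hε => ?_⟩
  obtain ⟨N0, h0⟩ := asmT hα halg hirr hb k m (ε := ε / L) (by positivity)
  refine ⟨max N0 1, fun N hN => ?_⟩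
  have hN0 : N0 ≤ N := (le_max_left _ _).trans hN
  have hN1 : 1 ≤ N := (le_max_right _ _).trans hN
  have hX : Tendsto (fun H : ℕ => α / (b:ℝ) ^ m * (b:ℝ) ^ H * exp (-(L/2))) atTop atTop :=
    ((tendsto_pow_atTop_atTop_of_one_lt hb1).const_mul_atTop (by positivity)).atTop_mul_const (exp_pos _)
  have hcc : ∀ n : ℤ, n ≠ 0 → Tendsto (fun H : ℕ => ∫ x in a..(α / (b:ℝ) ^ m * (b:ℝ) ^ H * exp (-(L/2))), (pf (k+1) x : ℂ) * (x : ℂ) ^ (-(sn L n) - 1)) atTop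
      (𝓝 (Rr a (k+1) (sn L n) - Ik (k+1) (sn L n))) := by
    intro n hn
    obtain ⟨f1, f2, f3⟩ := sn_facts hL n
    have hn1 : (0:ℝ) < |(n:ℝ)| := abs_pos.mpr (by exact_mod_cast hn)
    have hpi := pi_pos
    have hs0 : sn L n ≠ 0 := norm_pos_iff.mp (by rw [f2]; positivity)
    have := CC_imag ha0 ha1 k f1 hs0
    unfold CC at this
    exact this.comp hX
  have lim := tendsto_finset_sum (range N) (fun (n : ℕ) _ =>
    ((hcc (n+1) (by omega)).const_mul (Complex.exp (sn L (n+1) * log α))).add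
    ((hcc (-(n+1)) (by omega)).const_mul (Complex.exp (sn L (-(n+1)) * log α))))
  simp only [hps] at lim
  set Ψ := ∑ h ∈ Finset.Ioo (0:ℤ) ⌈log N / L⌉, pf (k+1) ((b:ℝ) ^ h * α) with hΨ
  have lim2 := (lim.sub_const ((L * Ψ : ℝ) : ℂ)).norm
  have bd := le_of_tendsto lim2 (b := L * (ε / L * log N + K3 + K4)) (by
    filter_upwards [h3 N hN1] with H hH
    rw [← ofReal_sub, norm_real, norm_eq_abs, ← mul_sub, abs_mul, abs_of_pos hL]
    refine mul_le_mul_of_nonneg_left ?_ hL.le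
    have g1 := (abs_sum_le_sum_abs _ _).trans (h0 N hN0 H)
    rw [sum_sub_distrib] at g1
    have g2 := h4 H
    rw [sum_sub_distrib]
    rw [abs_le] at g1 g2 hH ⊢
    constructor <;> linarith [g1.1, g1.2, g2.1, g2.2, hH.1, hH.2])
  have fin := h2 N
  have e : ∀ u v w : ℂ, ‖u‖ ≤ K2 → ‖(u - v) - w‖ ≤ L * (ε / L * log N + K3 + K4) → ‖v + w‖ ≤ K2 + L * (K3 + K4) + ε * log N := by
    intro u v w hu hv
    have e0 : v + w = u - ((u - v) - w) := by ring
    have e1 : L * (ε / L * log N + K3 + K4) = L * (K3 + K4) + ε * log N := by field_simp; ring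
    rw [e0]; refine (norm_sub_le _ _).trans ?_
    linarith
  refine e _ _ _ fin ?_
  rw [← sum_sub_distrib]
  refine le_trans (le_of_eq ?_) bd
  congr 2
  refine sum_congr rfl fun n _ => ?_
  ring

end Rid

theorem statement0 (α : ℝ) (hα : 0 < α) (halg : IsAlgebraic ℚ α) (hirr : Irrational α)
    (b : ℕ) (hb : 2 ≤ b) (k : ℕ) :
    (fun N : ℕ =>
        ((Nat.factorial (k + 1) : ℂ) / (2 * (Real.pi : ℂ) * Complex.I) ^ (k + 1)) *
            ∑ n ∈ (Finset.Icc (-(N : ℤ)) (N : ℤ)).erase 0,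
              riemannZeta (-(k : ℂ) + 2 * (Real.pi : ℂ) * Complex.I * (n : ℂ) / (Real.log b : ℂ)) *
                Complex.exp (2 * (Real.pi : ℂ) * Complex.I * (n : ℂ) * (Real.log α : ℂ) /
                  (Real.log b : ℂ)) / (n : ℂ) ^ (k + 1)
          - (-(1 / (Real.log b : ℂ) ^ k) *
              ∑ h ∈ Finset.Ioo (0 : ℤ) ⌈Real.log N / Real.log b⌉,
                (psiB (k + 1) ((b : ℝ) ^ h * α) : ℂ)))
      =o[Filter.atTop] (fun N : ℕ => Real.log N) := by
  have hb1 : (1:ℝ) < b := by exact_mod_cast (by omega : 1 < b)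
  have hL : 0 < log b := log_pos hb1
  have hLc : (log b : ℂ) ≠ 0 := by exact_mod_cast hL.ne'
  have hpi : (π : ℂ) ≠ 0 := by exact_mod_cast pi_pos.ne'
  obtain ⟨C1, hC1, h1⟩ := Rid.Sbound hα halg hirr hb k
  obtain ⟨C2, hC2, h2⟩ := Rid.err hL k
  have hE : ∀ n : ℕ, ‖(Complex.exp (Rid.sn (log b) (n+1) * log α) * (((k+1).factorial : ℂ) * riemannZeta (-(k:ℂ) + Rid.sn (log b) (n+1)) / Rid.sn (log b) (n+1) ^ (k+1) - Rid.Ik (k+1) (Rid.sn (log b) (n+1))))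
      + (Complex.exp (Rid.sn (log b) (-(n+1)) * log α) * (((k+1).factorial : ℂ) * riemannZeta (-k + Rid.sn (log b) (-(n+1))) / Rid.sn (log b) (-(n+1)) ^ (k+1) - Rid.Ik (k+1) (Rid.sn (log b) (-(n+1)))))‖
      ≤ 2 * C2 / (n+1) ^ (3/2:ℝ) := by
    intro n
    have hexp : ∀ l : ℤ, ‖Complex.exp (Rid.sn (log b) l * log α)‖ = 1 := by
      intro l
      obtain ⟨f1, f2, f3⟩ := Rid.sn_facts hL l
      rw [f3, mul_right_comm, ← ofReal_mul, norm_exp_ofReal_mul_I]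
    have hn : 0 < (n:ℝ) + 1 := by positivity
    refine (norm_add_le _ _).trans ?_
    rw [norm_mul, norm_mul, hexp, hexp, one_mul, one_mul]
    have a1 := h2 (n+1) (by omega)
    have a2 := h2 (-(n+1)) (by omega)
    push_cast at a1 a2
    rw [abs_neg] at a2
    rw [abs_of_pos hn] at a1 a2
    refine (add_le_add a1 a2).trans_eq (by ring)
  obtain ⟨C3, hC3, h3⟩ := Rid.sum_bd (by norm_num) (by positivity) hE
  have hid : ∀ N : ℕ, ((Nat.factorial (k + 1) : ℂ) / (2 * π * I) ^ (k + 1)) *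
            ∑ n ∈ (Finset.Icc (-(N : ℤ)) N).erase 0,
              riemannZeta (-k + 2 * π * I * n / (log b : ℂ)) *
                Complex.exp (2 * π * I * n * (log α : ℂ) /
                  (log b : ℂ)) / n ^ (k + 1)
      = 1 / (log b : ℂ) ^ (k+1) * ∑ n ∈ (Finset.Icc (-(N : ℤ)) N).erase 0,
          Complex.exp (Rid.sn (log b) n * log α) * (((k+1).factorial : ℂ) * riemannZeta (-k + Rid.sn (log b) n) / Rid.sn (log b) n ^ (k+1)) := by
    intro N
    rw [mul_sum, mul_sum]
    refine sum_congr rfl fun n hn => ?_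
    have hn0 : n ≠ 0 := by exact_mod_cast (Finset.mem_erase.mp hn).1
    have e1 : 2 * π * I * n * (log α : ℂ) / (log b : ℂ) = Rid.sn (log b) n * log α := by
      simp only [Rid.sn]; ring
    have e2 : (log b : ℂ) ^ (k+1) * Rid.sn (log b) n ^ (k+1) = (2 * π * I) ^ (k+1) * n ^ (k+1) := by
      rw [← mul_pow, ← mul_pow]; congr 1; simp only [Rid.sn]; field_simp
    rw [e1, show 2 * π * I * n / (log b : ℂ) = Rid.sn (log b) n from rfl]
    generalize riemannZeta (-k + Rid.sn (log b) n) = z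
    generalize Complex.exp (Rid.sn (log b) n * log α) = y
    calc _ = ((k+1).factorial : ℂ) * z * y / ((2 * π * I) ^ (k+1) * n ^ (k+1)) := by
          rw [div_mul_div_comm]; ring
      _ = _ := by rw [← e2, div_mul_eq_mul_div, one_mul, ← mul_div_assoc, div_div, mul_comm (Rid.sn (log b) n ^ (k+1))]; ring
  rw [Asymptotics.isLittleO_iff]
  intro c hc
  have hlk : 0 < log b ^ (k+1) := by positivity
  obtain ⟨N0, hN0⟩ := h1 (c / 2 * log b ^ (k+1)) (by positivity)
  have hlog := (tendsto_log_atTop.comp tendsto_natCast_atTop_atTop).eventually_ge_atTop ((C1 + C3) / (c / 2 * log b ^ (k+1)))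
  filter_upwards [Filter.eventually_ge_atTop N0, hlog] with N hN hl
  simp only [Function.comp] at hl
  have hl0 : 0 ≤ log N := le_trans (by positivity) hl
  rw [div_le_iff₀ (by positivity)] at hl
  have hψ : ∑ h ∈ Finset.Ioo 0 ⌈log N / log b⌉, (psiB (k + 1) (b ^ h * α) : ℂ)
      = ((∑ h ∈ Finset.Ioo 0 ⌈log N / log b⌉, Rid.pf (k+1) (b ^ h * α) : ℝ) : ℂ) := by
    rw [ofReal_sum]
    refine sum_congr rfl fun h hh => ?_
    rw [Rid.psi_pf]
    have hh0 : 0 < h := (Finset.mem_Ioo.mp hh).1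
    obtain ⟨j, rfl⟩ := Int.eq_ofNat_of_zero_le hh0.le
    rw [zpow_natCast]
    have := hirr.natCast_mul (m := b ^ j) (by have : b ≠ 0 := by omega
                                              positivity)
    simpa using this
  rw [hid N, Rid.sumpair, hψ]
  have b1 := hN0 N hN
  have b2 := h3 N
  set Ψ := ∑ h ∈ Finset.Ioo 0 ⌈log N / log b⌉, Rid.pf (k+1) (b ^ h * α) with hΨ
  have hn : ‖(log b : ℂ) ^ (k+1)‖ = log b ^ (k+1) := by rw [norm_pow, norm_real, norm_eq_abs, abs_of_pos hL]
  have fin : ∀ G S E : ℂ, G = S + E → ‖S + ((log b * Ψ : ℝ) : ℂ)‖ ≤ C1 + c / 2 * log b ^ (k+1) * log N → ‖E‖ ≤ C3 →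
      ‖1 / (log b : ℂ) ^ (k+1) * G - (-(1 / (log b : ℂ) ^ k) * Ψ)‖ ≤ c * ‖log N‖ := by
    intro G S E hG hS hE
    have e : 1 / (log b : ℂ) ^ (k+1) * G - (-(1 / (log b : ℂ) ^ k) * Ψ) = ((S + ((log b * Ψ : ℝ) : ℂ)) + E) / (log b : ℂ) ^ (k+1) := by
      rw [hG, ofReal_mul, pow_succ]; field_simp; ring
    rw [e, norm_div, hn, div_le_iff₀ hlk, norm_eq_abs, abs_of_nonneg hl0]
    refine (norm_add_le _ _).trans ?_
    nlinarith
  refine fin _ _ _ ?_ b1 b2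
  rw [← sum_add_distrib]
  refine sum_congr rfl fun n _ => ?_
  ring
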